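/- arXiv:2405.14395 — 4 statements merged into one kernel-verified Lean document; each statement's English description precedes it below -/
import Mathlib

section
/- Assume the BN-pair has equal parameters: |BsB|/|B| = q for every s ∈ S, for a fixed integer q ≥ 2. Let I ⊆ S, let w = w_S be the longest element of W, and set J = w⁻¹ I w. Then every eigenvalue λ of the operator of right multiplication by a_{P_I w P_J} · a_{P_J w P_I} on ℂG·e_{P_I} is nonzero and satisfies λ = q^{f − 2ℓ(w_I)} for some nonnegative integer f; in particular every such eigenvalue times q^{2ℓ(w_I)} is an integer power of q. -/
/-!
STATEMENT 11. Let G be a finite group with a BN-pair with equal parameters: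
|BsB|/|B| = q for every s ∈ S, q ≥ 2 a fixed integer. Let I ⊆ S, w = w_S the longest
element of W, J = w⁻¹ I w. Then every eigenvalue λ of the operator of right
multiplication by a_{P_I w P_J} · a_{P_J w P_I} on ℂG·e_{P_I} is nonzero and satisfies
λ = q^{f − 2ℓ(w_I)} for some nonnegative integer f; in particular every such eigenvalue
times q^{2ℓ(w_I)} is an integer power of q. (λ is an eigenvalue iff it has a nonzero
eigenvector in the ideal ℂG·e_{P_I}.)
-/


open scoped Pointwise

variable {G : Type*} [Group G]

/-- The set of lifts in `G` of an element of the Weyl group `W = N/(B ⊓ N)` of a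
BN-pair. (All statements about double cosets `BwB` are independent of the lift.) -/
def lifts (B N : Subgroup G) (w : ↥N ⧸ (B ⊓ N).subgroupOf N) : Set G :=
  {g : G | ∃ x : ↥N, QuotientGroup.mk x = w ∧ g = (x : G)}

/-- The double coset `BwB ⊆ G`, for `w` in the Weyl group. -/
def BwB (B N : Subgroup G) (w : ↥N ⧸ (B ⊓ N).subgroupOf N) : Set G :=
  (B : Set G) * lifts B N w * (B : Set G)

/-- The standard parabolic subgroup `P_I = B W_I B ⊆ G` (as a subset of `G`),
for a subset `I` of the Weyl group. -/
def para (B N : Subgroup G) [((B ⊓ N).subgroupOf N).Normal] (I : Set (↥N ⧸ (B ⊓ N).subgroupOf N)) : Set G :=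
  {g : G | ∃ w ∈ Subgroup.closure I, g ∈ BwB B N w}

/-- Word length with respect to a generating set `S`. -/
noncomputable def wordLen {W : Type*} [Monoid W] (S : Set W) (w : W) : ℕ :=
  sInf {m | ∃ L : List W, L.length = m ∧ (∀ x ∈ L, x ∈ S) ∧ L.prod = w}

/-- The element `a_{PwQ} = |Q|⁻¹ Σ_{x ∈ PwQ} x` of the group algebra `ℂG`. -/
noncomputable def aPwQ [Fintype G] (B N : Subgroup G) (P : Set G)
    (w : ↥N ⧸ (B ⊓ N).subgroupOf N) (Q : Set G) : MonoidAlgebra ℂ G :=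
  ((Q.ncard : ℂ))⁻¹ •
    ∑ x ∈ (Set.toFinite (P * lifts B N w * Q)).toFinset, MonoidAlgebra.single x (1 : ℂ)

/-- The idempotent `e_P = |P|⁻¹ Σ_{x ∈ P} x` of the group algebra `ℂG`. -/
noncomputable def ePset [Fintype G] (P : Set G) : MonoidAlgebra ℂ G :=
  ((P.ncard : ℂ))⁻¹ • ∑ x ∈ (Set.toFinite P).toFinset, MonoidAlgebra.single x (1 : ℂ)

set_option linter.unusedSectionVars false

section Len

variable {W : Type*} [Group W] {S : Set W}

theorem wl_exists (hgen : Subgroup.closure S = ⊤) (hinv : ∀ s ∈ S, s * s = 1) (w : W) :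
    ∃ L : List W, (∀ x ∈ L, x ∈ S) ∧ L.prod = w := by
  have hw : w ∈ Subgroup.closure S := by rw [hgen]; trivial
  induction hw using Subgroup.closure_induction with
  | mem x hx => exact ⟨[x], by simpa using hx, by simp⟩
  | one => exact ⟨[], by simp, by simp⟩
  | mul x y _ _ hx hy =>
    obtain ⟨L, h1, h2⟩ := hx
    obtain ⟨L', h1', h2'⟩ := hy
    refine ⟨L ++ L', ?_, by simp [h2, h2']⟩
    intro z hz
    rcases List.mem_append.1 hz with h | h
    · exact h1 z h
    · exact h1' z h
  | inv x _ hx =>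
    obtain ⟨L, h1, h2⟩ := hx
    refine ⟨(L.map (·⁻¹)).reverse, ?_, by rw [← h2, List.prod_inv_reverse]⟩
    intro z hz
    simp only [List.mem_reverse, List.mem_map] at hz
    obtain ⟨a, ha, rfl⟩ := hz
    rw [inv_eq_of_mul_eq_one_left (hinv a (h1 a ha))]
    exact h1 a ha

theorem wl_red (hgen : Subgroup.closure S = ⊤) (hinv : ∀ s ∈ S, s * s = 1) (w : W) :
    ∃ L : List W, L.length = wordLen S w ∧ (∀ x ∈ L, x ∈ S) ∧ L.prod = w := by
  obtain ⟨L, h1, h2⟩ := wl_exists hgen hinv w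
  exact Nat.sInf_mem (s := {m | ∃ L : List W, L.length = m ∧ (∀ x ∈ L, x ∈ S) ∧ L.prod = w})
    ⟨_, L, rfl, h1, h2⟩

theorem wl_le (L : List W) (h : ∀ x ∈ L, x ∈ S) : wordLen S L.prod ≤ L.length :=
  Nat.sInf_le ⟨L, rfl, h, rfl⟩

theorem wl_one : wordLen S (1 : W) = 0 := by
  have := wl_le (S := S) ([] : List W) (by simp)
  simpa using this

structure LenSys (S : Set W) : Prop where
  gen : Subgroup.closure S = ⊤
  inv : ∀ s ∈ S, s * s = 1

namespace LenSys

variable (h : LenSys S)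
include h

theorem eq_one {w : W} (hw : wordLen S w = 0) : w = 1 := by
  obtain ⟨L, h1, _, h3⟩ := wl_red h.gen h.inv w
  rw [hw, List.length_eq_zero_iff] at h1
  simp [← h3, h1]

theorem sinv {s : W} (hs : s ∈ S) : s⁻¹ = s := inv_eq_of_mul_eq_one_left (h.inv s hs)

theorem ss {s : W} (hs : s ∈ S) (w : W) : s * (s * w) = w := by
  rw [← mul_assoc, h.inv s hs, one_mul]

theorem ss' {s : W} (hs : s ∈ S) (w : W) : w * s * s = w := by
  rw [mul_assoc, h.inv s hs, mul_one]

theorem mul_le (u v : W) : wordLen S (u * v) ≤ wordLen S u + wordLen S v := by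
  obtain ⟨L, h1, h2, h3⟩ := wl_red h.gen h.inv u
  obtain ⟨L', h1', h2', h3'⟩ := wl_red h.gen h.inv v
  have := wl_le (S := S) (L ++ L') (by
    intro z hz
    rcases List.mem_append.1 hz with h | h
    · exact h2 z h
    · exact h2' z h)
  simpa [h1, h1', h3, h3'] using this

theorem inv_le (u : W) : wordLen S u⁻¹ ≤ wordLen S u := by
  obtain ⟨L, h1, h2, h3⟩ := wl_red h.gen h.inv u
  have := wl_le (S := S) (L.map (·⁻¹)).reverse (by
    intro z hz
    simp only [List.mem_reverse, List.mem_map] at hz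
    obtain ⟨a, ha, rfl⟩ := hz
    rw [inv_eq_of_mul_eq_one_left (h.inv a (h2 a ha))]
    exact h2 a ha)
  rw [← List.prod_inv_reverse, h3] at this
  simpa [h1] using this

theorem len_inv (u : W) : wordLen S u⁻¹ = wordLen S u :=
  le_antisymm (h.inv_le u) (by simpa using h.inv_le u⁻¹)

theorem s_le {s : W} (hs : s ∈ S) : wordLen S s ≤ 1 := by
  simpa using wl_le (S := S) [s] (by simpa using hs)

theorem mul_s_le {s : W} (hs : s ∈ S) (u : W) : wordLen S (u * s) ≤ wordLen S u + 1 :=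
  (h.mul_le u s).trans (by have := h.s_le hs; omega)

theorem s_mul_le {s : W} (hs : s ∈ S) (u : W) : wordLen S (s * u) ≤ wordLen S u + 1 :=
  (h.mul_le s u).trans (by have := h.s_le hs; omega)

theorem le_mul_s {s : W} (hs : s ∈ S) (u : W) : wordLen S u ≤ wordLen S (u * s) + 1 := by
  have := h.mul_s_le hs (u * s)
  rwa [h.ss' hs] at this

theorem le_s_mul {s : W} (hs : s ∈ S) (u : W) : wordLen S u ≤ wordLen S (s * u) + 1 := by
  have := h.s_mul_le hs (s * u)
  rwa [h.ss hs] at this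

/-- left descent -/
theorem desc_left {w : W} {n : ℕ} (hw : wordLen S w = n + 1) :
    ∃ s ∈ S, ∃ u, w = s * u ∧ wordLen S u = n := by
  obtain ⟨L, h1, h2, h3⟩ := wl_red h.gen h.inv w
  cases L with
  | nil => simp [hw] at h1
  | cons s L =>
    have hs : s ∈ S := h2 s (by simp)
    refine ⟨s, hs, L.prod, by simpa using h3.symm, ?_⟩
    have a1 := wl_le (S := S) L (fun x hx => h2 x (by simp [hx]))
    have a2 := h.s_mul_le hs L.prod
    have : s * L.prod = w := by simpa using h3
    rw [this] at a2
    simp only [List.length_cons] at h1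
    omega

theorem desc_right {w : W} {n : ℕ} (hw : wordLen S w = n + 1) :
    ∃ s ∈ S, ∃ u, w = u * s ∧ wordLen S u = n := by
  obtain ⟨s, hs, u, h1, h2⟩ := h.desc_left (w := w⁻¹) (n := n) (by rw [h.len_inv, hw])
  refine ⟨s, hs, u⁻¹, ?_, by rw [h.len_inv, h2]⟩
  rw [← inv_inv w, h1, mul_inv_rev, h.sinv hs]

end LenSys

/-- length system with parity and folding -/
structure CoxSys (S : Set W) : Prop extends LenSys S where
  ne : ∀ s ∈ S, ∀ w, wordLen S (s * w) ≠ wordLen S w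
  fold : ∀ s ∈ S, ∀ t ∈ S, ∀ u, wordLen S (s * u) = wordLen S u + 1 →
    wordLen S (u * t) = wordLen S u + 1 → wordLen S (s * u * t) = wordLen S u → s * u = u * t

namespace CoxSys

variable (h : CoxSys S)
include h

theorem ne' {s : W} (hs : s ∈ S) (w : W) : wordLen S (w * s) ≠ wordLen S w := by
  have := h.ne s hs w⁻¹
  rwa [← h.len_inv (w * s), mul_inv_rev, h.sinv hs, ← h.len_inv w]

theorem len_s {s : W} (hs : s ∈ S) : wordLen S s = 1 := by
  have h1 := h.ne s hs 1
  have h2 := h.s_le hs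
  rw [mul_one, wl_one] at h1
  omega

theorem cases_l {s : W} (hs : s ∈ S) (w : W) :
    wordLen S (s * w) = wordLen S w + 1 ∨ wordLen S (s * w) + 1 = wordLen S w := by
  have := h.ne s hs w
  have := h.s_mul_le hs w
  have := h.le_s_mul hs w
  omega

theorem cases_r {s : W} (hs : s ∈ S) (w : W) :
    wordLen S (w * s) = wordLen S w + 1 ∨ wordLen S (w * s) + 1 = wordLen S w := by
  have := h.ne' hs w
  have := h.mul_s_le hs w
  have := h.le_mul_s hs w
  omega

theorem fold' {s t : W} (hs : s ∈ S) (ht : t ∈ S) (u : W)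
    (h1 : wordLen S u < wordLen S (s * u)) (h2 : wordLen S (s * u * t) < wordLen S (u * t)) :
    s * u = u * t := by
  have a := h.cases_l hs u
  have b := h.cases_r ht u
  have c := h.cases_r ht (s * u)
  have d := h.cases_l hs (u * t)
  rw [← mul_assoc] at d
  exact h.fold s hs t ht u (by omega) (by omega) (by omega)

/-- exchange -/
theorem exch {t : W} (ht : t ∈ S) (n : ℕ) : ∀ x y : W, wordLen S x = n →
    wordLen S (x * y) = wordLen S x + wordLen S y →
    wordLen S (x * y * t) < wordLen S (x * y) →
    wordLen S (y * t) < wordLen S y ∨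
      ∃ x', wordLen S x' < wordLen S x ∧ x * y * t = x' * y := by
  induction n with
  | zero =>
    intro x y hx hxy hlt
    obtain rfl := h.eq_one hx
    left; simpa using hlt
  | succ n ih =>
    intro x y hx hxy hlt
    obtain ⟨s, hs, x1, rfl, h1⟩ := h.desc_left hx
    have e1 : s * x1 * y = s * (x1 * y) := mul_assoc _ _ _
    have c := h.mul_le x1 y
    have c2 := h.s_mul_le hs (x1 * y)
    rw [e1] at hxy hlt
    by_cases hc : wordLen S (x1 * y * t) < wordLen S (x1 * y)
    · rcases ih x1 y h1 (by omega) hc with h3 | ⟨x', h3, h4⟩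
      · exact Or.inl h3
      · right
        refine ⟨s * x', ?_, by rw [e1, mul_assoc s, h4, mul_assoc]⟩
        have := h.s_mul_le hs x'
        omega
    · right
      refine ⟨x1, by omega, ?_⟩
      have b := h.cases_r ht (x1 * y)
      have := h.fold' hs ht (x1 * y) (by omega) (by omega)
      rw [e1, this, h.ss' ht]

theorem del {I : Set W} (hI : I ⊆ S) {t : W} (ht : t ∈ S) : ∀ L : List W, (∀ x ∈ L, x ∈ I) →
    wordLen S L.prod = L.length → wordLen S (L.prod * t) < wordLen S L.prod →
    ∃ L' : List W, (∀ x ∈ L', x ∈ I) ∧ L'.length + 1 = L.length ∧ L'.prod = L.prod * t := by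
  intro L
  induction L with
  | nil => intro _ _ h3; simp [wl_one] at h3
  | cons s L ih =>
    intro h1 h2 h3
    have hsI : s ∈ I := h1 s (by simp)
    have hs : s ∈ S := hI hsI
    have hL : ∀ x ∈ L, x ∈ I := fun x hx => h1 x (by simp [hx])
    simp only [List.prod_cons, List.length_cons] at h2 h3
    have a1 := wl_le (S := S) L (fun x hx => hI (hL x hx))
    have a2 := h.s_mul_le hs L.prod
    by_cases hc : wordLen S (L.prod * t) < wordLen S L.prod
    · obtain ⟨L', b1, b2, b3⟩ := ih hL (by omega) hc
      refine ⟨s :: L', ?_, by simp [b2], by simp [b3, mul_assoc]⟩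
      intro x hx
      rcases List.mem_cons.1 hx with rfl | hx
      · exact hsI
      · exact b1 x hx
    · refine ⟨L, hL, by simp, ?_⟩
      have b := h.cases_r ht L.prod
      have := h.fold' hs ht L.prod (by omega) (by omega)
      rw [List.prod_cons, this, h.ss' ht]

theorem redI {I : Set W} (hI : I ⊆ S) {u : W} (hu : u ∈ Subgroup.closure I) :
    ∃ L : List W, (∀ x ∈ L, x ∈ I) ∧ L.length = wordLen S u ∧ L.prod = u := by
  induction hu using Subgroup.closure_induction_right with
  | one => exact ⟨[], by simp, by simp [wl_one], by simp⟩
  | mul_right x hx y hy ih =>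
    obtain ⟨L, h1, h2, h3⟩ := ih
    rcases h.cases_r (hI hy) x with hc | hc
    · refine ⟨L ++ [y], ?_, by simp [h2, hc], by simp [h3]⟩
      intro z hz
      rcases List.mem_append.1 hz with hz | hz
      · exact h1 z hz
      · rw [List.mem_singleton.1 hz]; exact hy
    · obtain ⟨L', b1, b2, b3⟩ := h.del hI (hI hy) L h1 (by rw [h3, h2]) (by rw [h3]; omega)
      exact ⟨L', b1, by omega, by rw [b3, h3]⟩
  | mul_inv_cancel x hx y hy ih =>
    rw [h.sinv (hI hy)]
    obtain ⟨L, h1, h2, h3⟩ := ih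
    rcases h.cases_r (hI hy) x with hc | hc
    · refine ⟨L ++ [y], ?_, by simp [h2, hc], by simp [h3]⟩
      intro z hz
      rcases List.mem_append.1 hz with hz | hz
      · exact h1 z hz
      · rw [List.mem_singleton.1 hz]; exact hy
    · obtain ⟨L', b1, b2, b3⟩ := h.del hI (hI hy) L h1 (by rw [h3, h2]) (by rw [h3]; omega)
      exact ⟨L', b1, by omega, by rw [b3, h3]⟩

/-- elements of a parabolic subgroup have descents in it -/
theorem descI {I : Set W} (hI : I ⊆ S) {u : W} (hu : u ∈ Subgroup.closure I) {n : ℕ}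
    (hn : wordLen S u = n + 1) :
    ∃ t ∈ I, ∃ v ∈ Subgroup.closure I, u = v * t ∧ wordLen S v = n := by
  obtain ⟨L, h1, h2, h3⟩ := h.redI hI hu
  rcases List.eq_nil_or_concat L with rfl | ⟨L', t, rfl⟩
  · simp [hn] at h2
  · have ht : t ∈ I := h1 t (by simp)
    have hL : ∀ x ∈ L', x ∈ I := fun x hx => h1 x (by simp [hx])
    have e : u = L'.prod * t := by rw [← h3]; simp
    refine ⟨t, ht, L'.prod, Subgroup.list_prod_mem _ (fun x hx => Subgroup.subset_closure (hL x hx)),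
      e, ?_⟩
    have a1 := wl_le (S := S) L' (fun x hx => hI (hL x hx))
    have a2 := h.mul_s_le (hI ht) L'.prod
    rw [← e] at a2
    simp at h2
    omega

theorem longest {I : Set W} (hI : I ⊆ S) {w : W} (hw : ∀ t ∈ I, wordLen S (w * t) ≤ wordLen S w)
    (n : ℕ) : ∀ u ∈ Subgroup.closure I, wordLen S u = n →
    wordLen S (w * u⁻¹) + wordLen S u = wordLen S w := by
  induction n with
  | zero =>
    intro u hu hn
    obtain rfl := h.eq_one hn
    simp [wl_one]
  | succ n ih =>
    intro u hu hn
    obtain ⟨t, ht, v, hv, rfl, hvn⟩ := h.descI hI hu hn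
    have a := ih v hv hvn
    have b := hw t ht
    have b' := h.ne' (hI ht) w
    have e : w = w * v⁻¹ * v := by group
    rcases h.exch (hI ht) _ (w * v⁻¹) v rfl (by rw [← e, a]) (by rw [← e]; omega) with h3 | ⟨x', h3, h4⟩
    · omega
    · rw [← e] at h4
      have e2 : w * (v * t)⁻¹ = x' := by
        rw [mul_inv_rev, h.sinv (hI ht), ← mul_assoc, h4]; group
      have c := h.mul_le (w * (v * t)⁻¹) (v * t)
      rw [inv_mul_cancel_right] at c
      rw [e2] at c ⊢
      omega

end CoxSys
end Len

section Longest

variable {W : Type*} [Group W] {S : Set W}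

namespace CoxSys

variable (h : CoxSys S) {w : W} (hw : ∀ u, wordLen S u ≤ wordLen S w)
include h hw

theorem w_mul (u : W) : wordLen S (w * u) + wordLen S u = wordLen S w := by
  have := h.longest (I := S) subset_rfl (w := w) (fun t _ => hw _) _ u⁻¹
    (by rw [h.gen]; trivial) rfl
  rwa [inv_inv, h.len_inv] at this

theorem ww : w * w = 1 := h.eq_one (by have := h.w_mul hw w; omega)

theorem winv : w⁻¹ = w := inv_eq_of_mul_eq_one_left (h.ww hw)

theorem mul_w (u : W) : wordLen S (u * w) + wordLen S u = wordLen S w := by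
  have := h.w_mul hw u⁻¹
  rw [← h.len_inv (u * w), mul_inv_rev, h.winv hw]
  rwa [h.len_inv u] at this

theorem conj_len (u : W) : wordLen S (w * u * w) = wordLen S u := by
  have h1 := h.w_mul hw (u * w)
  have h2 := h.mul_w hw u
  rw [← mul_assoc] at h1
  omega

theorem conj_mem {s : W} (hs : s ∈ S) : w * s * w ∈ S := by
  have h1 := h.conj_len hw s
  rw [h.len_s hs] at h1
  obtain ⟨t, ht, u, e, hu⟩ := h.desc_left (n := 0) h1
  rw [e, h.eq_one hu, mul_one]; exact ht

end CoxSys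

namespace LenSys

variable (h : LenSys S) {A : Type*} [Semiring A] {T : W → A}
  (hone : ∀ v, T 1 * T v = T v)
  (hasc : ∀ s ∈ S, ∀ v, wordLen S v < wordLen S (s * v) → T s * T v = T (s * v))
include h hone hasc

theorem T_add (n : ℕ) : ∀ u v, wordLen S u = n → wordLen S (u * v) = wordLen S u + wordLen S v →
    T u * T v = T (u * v) := by
  induction n with
  | zero =>
    intro u v hu _
    obtain rfl := h.eq_one hu
    rw [hone, one_mul]
  | succ n ih =>
    intro u v hu huv
    obtain ⟨s, hs, x, rfl, hx⟩ := h.desc_left hu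
    have c := h.mul_le x v
    have c2 := h.s_mul_le hs (x * v)
    rw [mul_assoc] at huv
    rw [← hasc s hs x (by omega), mul_assoc, ih x v hx (by omega), hasc s hs _ (by omega), mul_assoc]

end LenSys

namespace CoxSys

variable (h : CoxSys S) {A : Type*} [Semiring A] {T : W → A}
  (hone : ∀ v, T 1 * T v = T v)
  (hasc : ∀ s ∈ S, ∀ v, wordLen S v < wordLen S (s * v) → T s * T v = T (s * v))
include h hone hasc

variable {w : W} (hw : ∀ u, wordLen S u ≤ wordLen S w)
include hw

theorem T_conj {s : W} (hs : s ∈ S) : T w * T s = T (w * s * w) * T w := by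
  have hs' := h.conj_mem hw hs
  have a := h.w_mul hw s
  have b := h.len_s hs
  have b' := h.len_s hs'
  have e1 : T (w * s) * T s = T w := by
    have := h.T_add hone hasc _ (w * s) s rfl (by rw [h.ss' hs]; omega)
    rwa [h.ss' hs] at this
  have e : w * s * w * (w * s) = w := by
    calc w * s * w * (w * s) = w * s * (w * w) * s := by group
      _ = w := by rw [h.ww hw, mul_one, h.ss' hs]
  have e2 : T (w * s * w) * T (w * s) = T w := by
    have := h.T_add hone hasc _ (w * s * w) (w * s) rfl (by rw [e]; omega)
    rwa [e] at this
  rw [← e2, mul_assoc, e1, e2]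

theorem T_comm_s {s : W} (hs : s ∈ S) : (T w * T w) * T s = T s * (T w * T w) := by
  have hs' := h.conj_mem hw hs
  have e : w * (w * s * w) * w = s := by
    calc w * (w * s * w) * w = (w * w) * s * (w * w) := by group
      _ = s := by rw [h.ww hw, mul_one, one_mul]
  rw [mul_assoc, h.T_conj hone hasc hw hs, ← mul_assoc, h.T_conj hone hasc hw hs', e, mul_assoc]

theorem T_comm (n : ℕ) : ∀ u, wordLen S u = n → (T w * T w) * T u = T u * (T w * T w) := by
  induction n with
  | zero =>
    intro u hu
    obtain rfl := h.eq_one hu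
    rw [← mul_assoc, hone, mul_assoc, h.T_add hone hasc _ w 1 rfl (by simp [wl_one]), mul_one]
  | succ n ih =>
    intro u hu
    obtain ⟨s, hs, x, rfl, hx⟩ := h.desc_left hu
    rw [← hasc s hs x (by omega), ← mul_assoc, h.T_comm_s hone hasc hw hs, mul_assoc, ih x hx,
      mul_assoc]

end CoxSys

end Longest

section Generic

variable {W : Type*} [Group W] [Fintype W] [DecidableEq W] {S : Set W}
  {R : Type*} [CommRing R]

/-- matrix of right multiplication by `T_s` -/
noncomputable def Rm (S : Set W) (x : R) (s : W) : Matrix W W R := fun u =>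
  if wordLen S u < wordLen S (u * s) then Pi.single (u * s) 1
  else (x - 1) • Pi.single u 1 + x • Pi.single (u * s) 1

/-- matrix of left multiplication by `T_s` -/
noncomputable def Lm (S : Set W) (x : R) (s : W) : Matrix W W R := fun u =>
  if wordLen S u < wordLen S (s * u) then Pi.single (s * u) 1
  else (x - 1) • Pi.single u 1 + x • Pi.single (s * u) 1

noncomputable def RL (S : Set W) (x : R) (L : List W) : Matrix W W R := (L.map (Rm S x)).prod

open Matrix

theorem ev (M : Matrix W W R) (u : W) : (Pi.single u 1 : W → R) ᵥ* M = M u := by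
  rw [Matrix.single_one_vecMul]; rfl

theorem ev_ext {M M' : Matrix W W R}
    (hM : ∀ u, (Pi.single u 1 : W → R) ᵥ* M = (Pi.single u 1 : W → R) ᵥ* M') : M = M' := by
  funext u
  have := hM u
  rwa [ev, ev] at this

theorem Rm_map {R' : Type*} [CommRing R'] (f : R →+* R') (x : R) (s : W) :
    (Rm S x s).map f = Rm S (f x) s := by
  ext u v
  simp only [Matrix.map_apply, Rm]
  split_ifs <;> simp [Pi.single_apply, apply_ite f]

theorem RL_map {R' : Type*} [CommRing R'] (f : R →+* R') (x : R) (L : List W) :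
    (RL S x L).map f = RL S (f x) L := by
  induction L with
  | nil => simp [RL]
  | cons s L ih =>
    simp only [RL, List.map_cons, List.prod_cons] at ih ⊢
    rw [Matrix.map_mul, ih, Rm_map]

theorem RL_one (L : List W) (u : W) :
    (Pi.single u 1 : W → R) ᵥ* RL S 1 L = Pi.single (u * L.prod) 1 := by
  induction L generalizing u with
  | nil => simp [RL]
  | cons s L ih =>
    have : (Pi.single u 1 : W → R) ᵥ* Rm S 1 s = Pi.single (u * s) 1 := by
      rw [ev]; simp [Rm]
    simp only [RL, List.map_cons, List.prod_cons] at ih ⊢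
    rw [← Matrix.vecMul_vecMul, this, ih, mul_assoc]

namespace CoxSys

variable (h : CoxSys S) (x : R)
include h

theorem R_asc {s u : W} (hs : wordLen S u < wordLen S (u * s)) :
    (Pi.single u 1 : W → R) ᵥ* Rm S x s = Pi.single (u * s) 1 := by
  rw [ev, Rm, if_pos hs]

theorem R_desc {s u : W} (hs : wordLen S (u * s) < wordLen S u) :
    (Pi.single u 1 : W → R) ᵥ* Rm S x s = (x - 1) • Pi.single u 1 + x • Pi.single (u * s) 1 := by
  rw [ev, Rm, if_neg (by omega)]

theorem L_asc {s u : W} (hs : wordLen S u < wordLen S (s * u)) :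
    (Pi.single u 1 : W → R) ᵥ* Lm S x s = Pi.single (s * u) 1 := by
  rw [ev, Lm, if_pos hs]

theorem L_desc {s u : W} (hs : wordLen S (s * u) < wordLen S u) :
    (Pi.single u 1 : W → R) ᵥ* Lm S x s = (x - 1) • Pi.single u 1 + x • Pi.single (s * u) 1 := by
  rw [ev, Lm, if_neg (by omega)]

theorem Rm_quad {s : W} (hs : s ∈ S) : Rm S x s * Rm S x s = (x - 1) • Rm S x s + x • 1 := by
  apply ev_ext
  intro u
  rw [← Matrix.vecMul_vecMul, Matrix.vecMul_add, Matrix.vecMul_smul, Matrix.vecMul_smul,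
    Matrix.vecMul_one]
  rcases h.cases_r hs u with hc | hc
  · rw [h.R_asc x (by omega), h.R_desc x (by rw [h.ss' hs]; omega), h.ss' hs]
  · rw [h.R_desc x (by omega), Matrix.add_vecMul, Matrix.smul_vecMul, Matrix.smul_vecMul,
      h.R_desc x (by omega), h.R_asc x (by rw [h.ss' hs]; omega), h.ss' hs]

theorem LR_comm {s t : W} (hs : s ∈ S) (ht : t ∈ S) :
    Lm S x s * Rm S x t = Rm S x t * Lm S x s := by
  apply ev_ext
  intro u
  rw [← Matrix.vecMul_vecMul, ← Matrix.vecMul_vecMul]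
  have a := h.cases_l hs u
  have b := h.cases_r ht u
  have c := h.cases_r ht (s * u)
  have d := h.cases_l hs (u * t)
  have e : s * (u * t) = s * u * t := (mul_assoc _ _ _).symm
  have f1 := h.fold' hs ht u
  have f2 := h.fold' hs ht (s * u)
  rw [h.ss hs] at f2
  rw [e] at d
  have e' := congrArg (wordLen S) e
  rcases a with a | a
  · rw [h.L_asc x (u := u) (by omega)]
    rcases b with b | b
    · rw [h.R_asc x (u := u) (by omega)]
      rcases c with c | c
      · rw [h.R_asc x (u := s * u) (by omega), h.L_asc x (u := u * t) (by omega), e]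
      · rw [h.R_desc x (u := s * u) (by omega), h.L_desc x (u := u * t) (by omega), e,
          f1 (by omega) (by omega)]
    · rw [h.R_desc x (u := u) (by omega), Matrix.add_vecMul, Matrix.smul_vecMul,
        Matrix.smul_vecMul, h.L_asc x (u := u) (by omega), h.L_asc x (u := u * t) (by omega),
        h.R_desc x (u := s * u) (by omega), e]
  · rw [h.L_desc x (u := u) (by omega), Matrix.add_vecMul, Matrix.smul_vecMul, Matrix.smul_vecMul]
    rcases b with b | b
    · rw [h.R_asc x (u := u) (by omega), h.R_asc x (u := s * u) (by omega),
        h.L_desc x (u := u * t) (by omega), e]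
    · rw [h.R_desc x (u := u) (by omega), Matrix.add_vecMul, Matrix.smul_vecMul,
        Matrix.smul_vecMul, h.L_desc x (u := u) (by omega)]
      rcases c with c | c
      · have g := f2 (by omega) (by omega)
        have g2 : s * u = u * t := by
          calc s * u = s * (s * u * t) := by rw [← g]
            _ = u * t := by rw [e.symm, h.ss hs]
        rw [h.R_asc x (u := s * u) (by omega), h.L_asc x (u := u * t) (by omega), e, g2]
      · rw [h.R_desc x (u := s * u) (by omega), h.L_desc x (u := u * t) (by omega), e]
        module

theorem LRL_comm {s : W} (hs : s ∈ S) (L : List W) (hL : ∀ t ∈ L, t ∈ S) :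
    Lm S x s * RL S x L = RL S x L * Lm S x s := by
  induction L with
  | nil => simp [RL]
  | cons t L ih =>
    have ih := ih (fun t ht => hL t (by simp [ht]))
    simp only [RL, List.map_cons, List.prod_cons] at ih ⊢
    rw [← mul_assoc, h.LR_comm x hs (hL t (by simp)), mul_assoc, ih, mul_assoc]

theorem determ {M M' : Matrix W W R} (h1 : ∀ s ∈ S, Lm S x s * M = M * Lm S x s)
    (h2 : ∀ s ∈ S, Lm S x s * M' = M' * Lm S x s)
    (h3 : (Pi.single 1 1 : W → R) ᵥ* M = (Pi.single 1 1 : W → R) ᵥ* M') : M = M' := by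
  apply ev_ext
  have : ∀ n u, wordLen S u = n →
      (Pi.single u 1 : W → R) ᵥ* M = (Pi.single u 1 : W → R) ᵥ* M' := by
    intro n
    induction n with
    | zero => intro u hu; rw [h.eq_one hu, h3]
    | succ n ih =>
      intro u hu
      obtain ⟨s, hs, v, rfl, hv⟩ := h.desc_left hu
      rw [← h.L_asc x (by omega), Matrix.vecMul_vecMul, Matrix.vecMul_vecMul, h1 s hs, h2 s hs,
        ← Matrix.vecMul_vecMul, ← Matrix.vecMul_vecMul, ih v hv]
  exact fun u => this _ u rfl

theorem RL_red (L : List W) (hL : ∀ t ∈ L, t ∈ S) (u : W)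
    (hu : wordLen S (u * L.prod) = wordLen S u + L.length) :
    (Pi.single u 1 : W → R) ᵥ* RL S x L = Pi.single (u * L.prod) 1 := by
  induction L generalizing u with
  | nil => simp [RL]
  | cons s L ih =>
    have hL' : ∀ t ∈ L, t ∈ S := fun t ht => hL t (by simp [ht])
    simp only [List.prod_cons, List.length_cons, ← mul_assoc] at hu ⊢
    have a1 := wl_le (S := S) L hL'
    have a2 := h.mul_le (u * s) L.prod
    have a3 := h.mul_s_le (hL s (by simp)) u
    have ih := ih hL' (u * s) (by omega)
    simp only [RL, List.map_cons, List.prod_cons] at ih ⊢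
    rw [← Matrix.vecMul_vecMul, h.R_asc x (by omega), ih]

omit [Fintype W] [DecidableEq W] in
theorem exL (u : W) : ∃ L : List W, L.length = wordLen S u ∧ (∀ x ∈ L, x ∈ S) ∧ L.prod = u :=
  wl_red h.gen h.inv u

noncomputable def Tm (u : W) : Matrix W W R := RL S x (h.exL u).choose

theorem Tm_comm (u : W) : ∀ s ∈ S, Lm S x s * h.Tm x u = h.Tm x u * Lm S x s :=
  fun _ hs => h.LRL_comm x hs _ (h.exL u).choose_spec.2.1

theorem Tm_add (u v : W) (huv : wordLen S (v * u) = wordLen S v + wordLen S u) :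
    (Pi.single v 1 : W → R) ᵥ* h.Tm x u = Pi.single (v * u) 1 := by
  obtain ⟨a, b, c⟩ := (h.exL u).choose_spec
  have := h.RL_red x _ b v (by rw [c, a, huv])
  rwa [c] at this

theorem Tm_e (u : W) : (Pi.single 1 1 : W → R) ᵥ* h.Tm x u = Pi.single u 1 := by
  have := h.Tm_add x u 1 (by simp [wl_one])
  rwa [one_mul] at this

theorem Tm_one : h.Tm x 1 = 1 := by
  apply h.determ x (h.Tm_comm x 1) (by simp)
  rw [h.Tm_e, Matrix.vecMul_one]

theorem Tm_s {s : W} (hs : s ∈ S) : h.Tm x s = Rm S x s := by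
  apply h.determ x (h.Tm_comm x s) (fun t ht => h.LR_comm x ht hs)
  rw [h.Tm_e, h.R_asc x (by rw [one_mul, h.len_s hs, wl_one]; omega), one_mul]

theorem Tm_asc : ∀ s ∈ S, ∀ v, wordLen S v < wordLen S (s * v) →
    h.Tm x s * h.Tm x v = h.Tm x (s * v) := by
  intro s hs v hv
  apply h.determ x _ (h.Tm_comm x _)
  · rw [← Matrix.vecMul_vecMul, h.Tm_e, h.Tm_e, h.Tm_add]
    rw [h.len_s hs]
    have := h.s_mul_le hs v
    omega
  · intro t ht
    rw [← mul_assoc, h.Tm_comm x s t ht, mul_assoc, h.Tm_comm x v t ht, mul_assoc]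

theorem Zm_comm {w : W} (hw : ∀ u, wordLen S u ≤ wordLen S w) {s : W} (hs : s ∈ S) :
    (h.Tm x w * h.Tm x w) * Rm S x s = Rm S x s * (h.Tm x w * h.Tm x w) := by
  rw [← h.Tm_s x hs]
  exact h.T_comm_s (by simp [h.Tm_one]) (h.Tm_asc x) hw hs

theorem Tm_map {R' : Type*} [CommRing R'] (f : R →+* R') (u : W) :
    (h.Tm x u).map f = h.Tm (f x) u := RL_map f x _

theorem Zm_one {w : W} (hw : ∀ u, wordLen S u ≤ wordLen S w) :
    h.Tm (1 : R) w * h.Tm (1 : R) w = 1 := by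
  apply ev_ext
  intro u
  rw [← Matrix.vecMul_vecMul, Tm, RL_one, RL_one, (h.exL w).choose_spec.2.2,
    mul_assoc, h.ww hw, mul_one, Matrix.vecMul_one]

end CoxSys

end Generic

section Eig

theorem quad_det {K V : Type*} [Field K] [IsAlgClosed K] [AddCommGroup V] [Module K V]
    [FiniteDimensional K V] (x : K) (A : Module.End K V)
    (hA : ∀ v, A (A v) = (x - 1) • A v + x • v) : ∃ k : ℕ, (LinearMap.det A) ^ 2 = x ^ k := by
  rw [Module.End.det_eq_prod_roots_charpoly_of_splits (IsAlgClosed.splits _)]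
  have hr : ∀ r ∈ A.charpoly.roots, r = x ∨ r = -1 := by
    intro r hr
    have h1 := Polynomial.isRoot_of_mem_roots hr
    rw [← Module.End.hasEigenvalue_iff_isRoot_charpoly] at h1
    obtain ⟨v, hv⟩ := h1.exists_hasEigenvector
    have h2 := hA v
    have e := hv.apply_eq_smul
    rw [e, map_smul, e] at h2
    have h3 : ((r - x) * (r + 1)) • v = 0 := by
      have : ((r - x) * (r + 1)) • v = r • r • v - ((x - 1) • r • v + x • v) := by module
      rw [this, h2, sub_self]
    rcases smul_eq_zero.1 h3 with h4 | h4
    · rcases mul_eq_zero.1 h4 with h5 | h5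
      · left; exact sub_eq_zero.1 h5
      · right; exact eq_neg_of_add_eq_zero_left h5
    · exact absurd h4 hv.2
  generalize A.charpoly.roots = m at hr
  induction m using Multiset.induction_on with
  | empty => exact ⟨0, by simp⟩
  | cons a m ih =>
    obtain ⟨k, hk⟩ := ih (fun r hr' => hr r (Multiset.mem_cons_of_mem hr'))
    rw [Multiset.prod_cons, mul_pow, hk]
    rcases hr a (Multiset.mem_cons_self _ _) with rfl | rfl
    · exact ⟨2 + k, by rw [pow_add]⟩
    · exact ⟨k, by simp⟩

variable {W : Type*} [Group W] [Fintype W] [DecidableEq W] {S : Set W}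

namespace CoxSys

variable (h : CoxSys S) {w : W} (hw : ∀ u, wordLen S u ≤ wordLen S w)
include h hw

open Matrix

theorem eig_pow {K : Type*} [Field K] [IsAlgClosed K] (x μ : K)
    (hμ : (h.Tm x w * h.Tm x w).charpoly.IsRoot μ) :
    ∃ d k : ℕ, 1 ≤ d ∧ d ≤ Fintype.card W ∧ μ ^ d = x ^ k := by
  set Z := h.Tm x w * h.Tm x w with hZ
  rw [← Matrix.charpoly_toLin', ← Module.End.hasEigenvalue_iff_isRoot_charpoly] at hμ
  set E := Module.End.eigenspace (Matrix.toLin' Z) μ with hE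
  have memE : ∀ v, v ∈ E ↔ Z *ᵥ v = μ • v := by
    intro v
    rw [hE, Module.End.mem_eigenspace_iff, Matrix.toLin'_apply]
  have key : ∀ L : List W, (∀ s ∈ L, s ∈ S) → ∃ g : Module.End K E,
      (∀ v : E, (g v : W → K) = RL S x L *ᵥ (v : W → K)) ∧
      ∃ k : ℕ, (LinearMap.det g) ^ 2 = x ^ k := by
    intro L
    induction L with
    | nil => intro _; exact ⟨1, by simp [RL], 0, by simp⟩
    | cons s L ih =>
      intro hL
      have hs : s ∈ S := hL s (by simp)
      obtain ⟨g, hg, k, hk⟩ := ih (fun t ht => hL t (by simp [ht]))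
      have hmap : ∀ v ∈ E, Matrix.toLin' (Rm S x s) v ∈ E := by
        intro v hv
        rw [memE] at hv ⊢
        rw [Matrix.toLin'_apply, Matrix.mulVec_mulVec, hZ, h.Zm_comm x hw hs, ← hZ,
          ← Matrix.mulVec_mulVec, hv, Matrix.mulVec_smul]
      let A : Module.End K E := (Matrix.toLin' (Rm S x s)).restrict hmap
      have hA : ∀ v : E, (A v : W → K) = Rm S x s *ᵥ (v : W → K) := by
        intro v
        simp only [A, LinearMap.coe_restrict_apply, Matrix.toLin'_apply]
      obtain ⟨k', hk'⟩ := quad_det x A (by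
        intro v
        apply Subtype.ext
        rw [hA, hA, Matrix.mulVec_mulVec, h.Rm_quad x hs]
        simp [Matrix.add_mulVec, Matrix.smul_mulVec, hA])
      refine ⟨A * g, ?_, k' + k, ?_⟩
      · intro v
        rw [Module.End.mul_apply, hA, hg, Matrix.mulVec_mulVec]
        simp [RL]
      · rw [map_mul, mul_pow, hk, hk', pow_add]
  obtain ⟨g, hg, k, hk⟩ := key _ (h.exL w).choose_spec.2.1
  refine ⟨Module.finrank K E, k, ?_, ?_, ?_⟩
  · have : Nontrivial E := Submodule.nontrivial_iff_ne_bot.2 hμ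
    exact Module.finrank_pos
  · have := Submodule.finrank_le E
    simpa using this
  · have e : g * g = μ • (1 : Module.End K E) := by
      ext1 v
      apply Subtype.ext
      rw [Module.End.mul_apply, hg, hg, Matrix.mulVec_mulVec]
      exact (memE _).1 v.2
    rw [← hk, pow_two, ← map_mul, e, LinearMap.det_smul]
    simp

open Polynomial in
theorem generic_factor : ∃ m : Multiset (ℂ × ℕ),
    (h.Tm (X ^ (Fintype.card W).factorial : ℂ[X]) w *
      h.Tm (X ^ (Fintype.card W).factorial : ℂ[X]) w).charpoly =
    (m.map fun p => (X - C (C p.1 * X ^ p.2) : ℂ[X][X])).prod := by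
  set M := (Fintype.card W).factorial with hM
  have hM0 : M ≠ 0 := Nat.factorial_ne_zero _
  set Z := h.Tm (X ^ M : ℂ[X]) w * h.Tm (X ^ M : ℂ[X]) w with hZ
  let K := AlgebraicClosure (FractionRing ℂ[X])
  let ψ : ℂ[X] →+* K := (algebraMap (FractionRing ℂ[X]) K).comp (algebraMap ℂ[X] (FractionRing ℂ[X]))
  have hψ : Function.Injective ψ :=
    (algebraMap (FractionRing ℂ[X]) K).injective.comp (IsFractionRing.injective ℂ[X] _)
  have hchar : Z.charpoly.map ψ = (h.Tm (ψ X ^ M) w * h.Tm (ψ X ^ M) w).charpoly := by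
    rw [← Matrix.charpoly_map, hZ, Matrix.map_mul, h.Tm_map, map_pow]
  have hy0 : ψ X ≠ 0 := by
    rw [Ne, map_eq_zero_iff ψ hψ]; exact X_ne_zero
  have hroot : ∀ μ ∈ (Z.charpoly.map ψ).roots,
      ∃ p : ℂ × ℕ, ψ (C p.1 * X ^ p.2) = μ := by
    intro μ hμ
    have h1 := Polynomial.isRoot_of_mem_roots hμ
    rw [hchar] at h1
    obtain ⟨d, k, hd1, hd2, e⟩ := h.eig_pow hw _ _ h1
    obtain ⟨c, hc⟩ : d ∣ M := Nat.dvd_factorial hd1 hd2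
    have e1 : μ ^ M = (ψ X ^ (k * c)) ^ M := by
      rw [hc, pow_mul, e, ← hc]; ring
    have hη := (Complex.isPrimitiveRoot_exp M hM0).map_of_injective
      (f := ψ.comp C) (hψ.comp C_injective)
    obtain ⟨i, _, hi⟩ := (haveI : NeZero M := ⟨hM0⟩; hη.eq_pow_of_pow_eq_one (ξ := μ / ψ X ^ (k * c))
      (by rw [div_pow, e1, div_self (pow_ne_zero _ (pow_ne_zero _ hy0))]))
    refine ⟨⟨Complex.exp (2 * Real.pi * Complex.I / M) ^ i, k * c⟩, ?_⟩
    rw [map_mul, map_pow, map_pow, map_pow]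
    change (ψ.comp C _) ^ i * _ = _
    rw [hi, div_mul_cancel₀ _ (pow_ne_zero _ hy0)]
  choose! g hg using hroot
  refine ⟨(Z.charpoly.map ψ).roots.map g, ?_⟩
  apply Polynomial.map_injective ψ hψ
  conv_lhs => rw [(IsAlgClosed.splits (Z.charpoly.map ψ)).eq_prod_roots_of_monic
    ((Matrix.charpoly_monic Z).map ψ)]
  rw [Polynomial.map_multiset_prod, Multiset.map_map, Multiset.map_map]
  congr 1
  apply Multiset.map_congr rfl
  intro μ hμ
  simp only [Function.comp_apply, Polynomial.map_sub, Polynomial.map_X, Polynomial.map_C, hg μ hμ]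

open Polynomial in
theorem eig_q (q : ℕ) (μ : ℂ)
    (hμ : (h.Tm (q : ℂ) w * h.Tm (q : ℂ) w).charpoly.IsRoot μ) : ∃ f : ℕ, μ = (q : ℂ) ^ f := by
  obtain ⟨m, hm⟩ := h.generic_factor hw
  set M := (Fintype.card W).factorial with hM
  have hM0 : M ≠ 0 := Nat.factorial_ne_zero _
  have spec : ∀ y : ℂ, (h.Tm (y ^ M) w * h.Tm (y ^ M) w).charpoly =
      (m.map fun p => (X - C (p.1 * y ^ p.2) : ℂ[X])).prod := by
    intro y
    have := congrArg (Polynomial.map (evalRingHom y)) hm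
    rw [← Matrix.charpoly_map, Matrix.map_mul, h.Tm_map, Polynomial.map_multiset_prod,
      Multiset.map_map] at this
    simpa [Function.comp_def] using this
  have hroot : ∀ y : ℂ, y ^ M = 1 → ∀ p ∈ m, p.1 * y ^ p.2 = 1 := by
    intro y hy p hp
    have h1 := spec y
    rw [hy, h.Zm_one hw, Matrix.charpoly_one] at h1
    have h2 := congrArg (Polynomial.eval (p.1 * y ^ p.2)) h1
    rw [Polynomial.eval_multiset_prod, Multiset.map_map, Multiset.prod_eq_zero
      (Multiset.mem_map.2 ⟨p, hp, by simp⟩)] at h2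
    simp only [eval_pow, eval_sub, eval_X, eval_one] at h2
    exact sub_eq_zero.1 ((pow_eq_zero_iff Fintype.card_ne_zero).1 h2)
  obtain ⟨y, hy⟩ := IsAlgClosed.exists_pow_nat_eq (q : ℂ) (Nat.pos_of_ne_zero hM0)
  rw [← hy, spec y, IsRoot.def, Polynomial.eval_multiset_prod, Multiset.map_map,
    Multiset.prod_eq_zero_iff, Multiset.mem_map] at hμ
  obtain ⟨p, hp, e⟩ := hμ
  have e' : μ = p.1 * y ^ p.2 := by
    simpa [sub_eq_zero] using e
  have h1 : p.1 = 1 := by simpa using hroot 1 (one_pow _) p hp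
  have h2 := hroot _ ((Complex.isPrimitiveRoot_exp M hM0).pow_eq_one) p hp
  rw [h1, one_mul] at h2
  obtain ⟨c, hc⟩ := (Complex.isPrimitiveRoot_exp M hM0).dvd_of_pow_eq_one _ h2
  exact ⟨c, by rw [e', h1, one_mul, hc, pow_mul, hy]⟩

end CoxSys
end Eig

section HeckeAlg

variable {W : Type*} [Group W] {S : Set W} {A : Type*} [Ring A] [Algebra ℂ A] {T : W → A}

namespace LenSys

variable (h : LenSys S) (q : ℂ)
  (hone : ∀ v, T 1 * T v = T v)
  (hasc : ∀ s ∈ S, ∀ v, wordLen S v < wordLen S (s * v) → T s * T v = T (s * v))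
  (hquad : ∀ s ∈ S, T s * T s = (q - 1) • T s + q • T 1)
  (hne : ∀ s ∈ S, ∀ w, wordLen S (s * w) ≠ wordLen S w)
include h hone hasc hne

theorem T_r_asc {t : W} (ht : t ∈ S) (u : W) (hu : wordLen S u < wordLen S (u * t)) :
    T u * T t = T (u * t) := by
  apply h.T_add hone hasc _ u t rfl
  have h1 := hne t ht 1
  have h2 := h.s_le ht
  have h3 := h.mul_s_le ht u
  rw [mul_one, wl_one] at h1
  omega

theorem T_mul_one (u : W) : T u * T 1 = T u := by
  have := h.T_add hone hasc _ u 1 rfl (by simp [wl_one])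
  rwa [mul_one] at this

include hquad

theorem T_r_desc {t : W} (ht : t ∈ S) (u : W) (hu : wordLen S (u * t) < wordLen S u) :
    T u * T t = (q - 1) • T u + q • T (u * t) := by
  have e := h.T_r_asc hone hasc hne ht (u * t) (by rw [h.ss' ht]; exact hu)
  rw [h.ss' ht] at e
  have e2 : T u * T t = T (u * t) * (T t * T t) := by rw [← mul_assoc, e]
  rw [e2, hquad t ht, mul_add, mul_smul_comm, mul_smul_comm, e, h.T_mul_one hone hasc hne]

theorem T_l_desc {t : W} (ht : t ∈ S) (u : W) (hu : wordLen S (t * u) < wordLen S u) :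
    T t * T u = (q - 1) • T u + q • T (t * u) := by
  have e := hasc t ht (t * u) (by rw [h.ss ht]; exact hu)
  rw [h.ss ht] at e
  have e2 : T t * T u = (T t * T t) * T (t * u) := by rw [mul_assoc, e]
  rw [e2, hquad t ht, add_mul, smul_mul_assoc, smul_mul_assoc, e, hone]

theorem toCox (hinj : Function.Injective T) (hq : q ≠ 1) : CoxSys S where
  toLenSys := h
  ne := hne
  fold := by
    intro s hs t ht u h1 h2 h3
    have e1 := h.T_r_desc q hone hasc hquad hne ht (s * u) (by omega)
    have e2 := h.T_l_desc q hone hasc hquad hne hs (u * t) (by rw [← mul_assoc]; omega)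
    rw [← hasc s hs u (by omega), mul_assoc, h.T_r_asc hone hasc hne ht u (by omega), e2,
      hasc s hs u (by omega), ← mul_assoc, add_left_inj] at e1
    exact (hinj (smul_right_injective A (sub_ne_zero.2 hq) e1)).symm

end LenSys

namespace CoxSys

variable [Fintype W] [DecidableEq W] (h : CoxSys S) (q : ℂ)
  (hone : ∀ v, T 1 * T v = T v)
  (hasc : ∀ s ∈ S, ∀ v, wordLen S v < wordLen S (s * v) → T s * T v = T (s * v))
  (hquad : ∀ s ∈ S, T s * T s = (q - 1) • T s + q • T 1)
include h hone hasc hquad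

open Matrix

theorem Phi_s {s : W} (hs : s ∈ S) (c : W → ℂ) :
    Fintype.linearCombination ℂ T (c ᵥ* Rm S q s) = Fintype.linearCombination ℂ T c * T s := by
  have : (Fintype.linearCombination ℂ T) ∘ₗ (Matrix.vecMulLinear (Rm S q s)) =
      (LinearMap.mulRight ℂ (T s)) ∘ₗ (Fintype.linearCombination ℂ T) := by
    apply (Pi.basisFun ℂ W).ext
    intro u
    simp only [Pi.basisFun_apply, LinearMap.comp_apply, Matrix.vecMulLinear_apply,
      LinearMap.mulRight_apply, Fintype.linearCombination_apply_single, one_smul]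
    rcases h.cases_r hs u with hc | hc
    · rw [h.R_asc q (by omega), h.T_r_asc hone hasc h.ne hs u (by omega),
        Fintype.linearCombination_apply_single, one_smul]
    · rw [h.R_desc q (by omega), h.T_r_desc q hone hasc hquad h.ne hs u (by omega), map_add,
        map_smul, map_smul, Fintype.linearCombination_apply_single,
        Fintype.linearCombination_apply_single, one_smul, one_smul]
  exact LinearMap.congr_fun this c

theorem Phi_L (L : List W) (hL : ∀ s ∈ L, s ∈ S) (hred : wordLen S L.prod = L.length) (c : W → ℂ) :
    Fintype.linearCombination ℂ T (c ᵥ* RL S q L) =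
      Fintype.linearCombination ℂ T c * T L.prod := by
  induction L generalizing c with
  | nil =>
    simp only [RL, List.map_nil, List.prod_nil, Matrix.vecMul_one]
    rw [Fintype.linearCombination_apply, Finset.sum_mul]
    refine Finset.sum_congr rfl fun u _ => ?_
    rw [smul_mul_assoc, h.T_mul_one hone hasc h.ne]
  | cons s L ih =>
    have hs : s ∈ S := hL s (by simp)
    have hL' : ∀ t ∈ L, t ∈ S := fun t ht => hL t (by simp [ht])
    simp only [List.prod_cons, List.length_cons] at hred
    have a1 := wl_le (S := S) L hL'
    have a2 := h.s_mul_le hs L.prod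
    have ih := ih hL' (by omega)
    simp only [RL, List.map_cons, List.prod_cons] at ih ⊢
    rw [← Matrix.vecMul_vecMul, ih, h.Phi_s q hone hasc hquad hs, mul_assoc,
      hasc s hs _ (by omega)]

theorem eig_root (w : W) (v : A) (hv : v * T 1 = v) (hv0 : v ≠ 0) (μ : ℂ)
    (hμ : v * (T w * T w) = μ • v) : (h.Tm q w * h.Tm q w).charpoly.IsRoot μ := by
  have hZ : ∀ c : W → ℂ, Fintype.linearCombination ℂ T (c ᵥ* (h.Tm q w * h.Tm q w)) =
      Fintype.linearCombination ℂ T c * (T w * T w) := by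
    intro c
    obtain ⟨a, b, d⟩ := (h.exL w).choose_spec
    have := h.Phi_L q hone hasc hquad _ b (by rw [d, a])
    rw [d] at this
    rw [← Matrix.vecMul_vecMul, Tm, this, this, mul_assoc]
  set Z := h.Tm q w * h.Tm q w
  have hf : ∀ (f : Polynomial ℂ) (c : W → ℂ),
      v * Fintype.linearCombination ℂ T (c ᵥ* Polynomial.aeval Z f) =
      v * Fintype.linearCombination ℂ T c * Polynomial.aeval (T w * T w) f := by
    intro f
    induction f using Polynomial.induction_on' with
    | add p q hp hq =>
      intro c
      rw [map_add, map_add, Matrix.vecMul_add, map_add, mul_add, mul_add, hp, hq]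
    | monomial n a =>
      intro c
      rw [Polynomial.aeval_monomial, Polynomial.aeval_monomial, ← Algebra.smul_def,
        ← Algebra.smul_def, Matrix.vecMul_smul, map_smul, mul_smul_comm, mul_smul_comm]
      congr 1
      induction n generalizing c with
      | zero => simp
      | succ n ih =>
        rw [pow_succ', pow_succ', ← Matrix.vecMul_vecMul, ih, hZ]
        simp only [mul_assoc]
  have hg : ∀ f : Polynomial ℂ, v * Polynomial.aeval (T w * T w) f = (f.eval μ) • v := by
    intro f
    induction f using Polynomial.induction_on' with
    | add p q hp hq => rw [map_add, mul_add, hp, hq, Polynomial.eval_add, add_smul]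
    | monomial n a =>
      rw [Polynomial.aeval_monomial, ← Algebra.smul_def, mul_smul_comm, Polynomial.eval_monomial,
        mul_smul]
      congr 1
      induction n with
      | zero => simp
      | succ n ih => rw [pow_succ, ← mul_assoc, ih, smul_mul_assoc, hμ, smul_smul, pow_succ]
  have h1 := hf Z.charpoly (Pi.single 1 1)
  rw [Matrix.aeval_self_charpoly, Matrix.vecMul_zero, map_zero, mul_zero,
    Fintype.linearCombination_apply_single, one_smul, hv, hg] at h1
  exact (smul_eq_zero.1 h1.symm).resolve_right hv0

end CoxSys
end HeckeAlg

section BNpair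

variable (B N : Subgroup G) [((B ⊓ N).subgroupOf N).Normal]

theorem mem_BwB (x : N) (g : G) :
    g ∈ BwB B N (QuotientGroup.mk x) ↔ ∃ b ∈ B, ∃ c ∈ B, g = b * x * c := by
  constructor
  · rintro ⟨y, ⟨b, hb, n, ⟨z, hz, rfl⟩, rfl⟩, c, hc, rfl⟩
    have := QuotientGroup.eq.1 hz.symm
    rw [Subgroup.mem_subgroupOf] at this
    refine ⟨b, hb, ((x : G)⁻¹ * z) * c, B.mul_mem this.1 hc, ?_⟩
    simp [mul_assoc]
  · rintro ⟨b, hb, c, hc, rfl⟩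
    exact ⟨_, ⟨b, hb, x, ⟨x, rfl, rfl⟩, rfl⟩, c, hc, rfl⟩

variable {B N} {S : Set (↥N ⧸ (B ⊓ N).subgroupOf N)}

theorem C_left {w : ↥N ⧸ (B ⊓ N).subgroupOf N} {b g : G} (hb : b ∈ B) (hg : g ∈ BwB B N w) :
    b * g ∈ BwB B N w := by
  obtain ⟨x, rfl⟩ := QuotientGroup.mk_surjective w
  rw [mem_BwB] at hg ⊢
  obtain ⟨c, hc, d, hd, rfl⟩ := hg
  exact ⟨b * c, B.mul_mem hb hc, d, hd, by simp [mul_assoc]⟩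

theorem C_right {w : ↥N ⧸ (B ⊓ N).subgroupOf N} {b g : G} (hb : b ∈ B) (hg : g ∈ BwB B N w) :
    g * b ∈ BwB B N w := by
  obtain ⟨x, rfl⟩ := QuotientGroup.mk_surjective w
  rw [mem_BwB] at hg ⊢
  obtain ⟨c, hc, d, hd, rfl⟩ := hg
  exact ⟨c, hc, d * b, B.mul_mem hd hb, by simp [mul_assoc]⟩

theorem C_one : BwB B N (1 : ↥N ⧸ (B ⊓ N).subgroupOf N) = (B : Set G) := by
  ext g
  rw [← QuotientGroup.mk_one, mem_BwB]
  constructor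
  · rintro ⟨b, hb, c, hc, rfl⟩
    simpa using B.mul_mem hb hc
  · intro hg
    exact ⟨g, hg, 1, B.one_mem, by simp⟩

theorem C_inv {w : ↥N ⧸ (B ⊓ N).subgroupOf N} {g : G} (hg : g ∈ BwB B N w) :
    g⁻¹ ∈ BwB B N w⁻¹ := by
  obtain ⟨x, rfl⟩ := QuotientGroup.mk_surjective w
  rw [← QuotientGroup.mk_inv, mem_BwB]
  rw [mem_BwB] at hg
  obtain ⟨c, hc, d, hd, rfl⟩ := hg
  exact ⟨d⁻¹, B.inv_mem hd, c⁻¹, B.inv_mem hc, by simp [mul_assoc]⟩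

theorem C_eq {u v : ↥N ⧸ (B ⊓ N).subgroupOf N} {g k : G} (hg : g ∈ BwB B N u)
    (hg' : g ∈ BwB B N v) (hk : k ∈ BwB B N u) : k ∈ BwB B N v := by
  obtain ⟨x, rfl⟩ := QuotientGroup.mk_surjective u
  rw [mem_BwB] at hg hk
  obtain ⟨c, hc, d, hd, rfl⟩ := hg
  obtain ⟨c', hc', d', hd', rfl⟩ := hk
  have := C_right (B.mul_mem (B.inv_mem hd) hd')
    (C_left (B.mul_mem hc' (B.inv_mem hc)) hg')
  convert this using 1
  group

theorem C_prod {u v : ↥N ⧸ (B ⊓ N).subgroupOf N} {g : G} (hg : g ∈ BwB B N (u * v)) :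
    ∃ a ∈ BwB B N u, ∃ b ∈ BwB B N v, g = a * b := by
  obtain ⟨x, rfl⟩ := QuotientGroup.mk_surjective u
  obtain ⟨y, rfl⟩ := QuotientGroup.mk_surjective v
  rw [← QuotientGroup.mk_mul, mem_BwB] at hg
  obtain ⟨c, hc, d, hd, rfl⟩ := hg
  refine ⟨c * x, (mem_BwB B N x _).2 ⟨c, hc, 1, B.one_mem, by simp⟩, y * d,
    (mem_BwB B N y _).2 ⟨1, B.one_mem, d, hd, by simp⟩, by simp [mul_assoc]⟩

theorem C_ne (u : ↥N ⧸ (B ⊓ N).subgroupOf N) : ∃ g, g ∈ BwB B N u := by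
  obtain ⟨x, rfl⟩ := QuotientGroup.mk_surjective u
  exact ⟨x, (mem_BwB B N x _).2 ⟨1, B.one_mem, 1, B.one_mem, by simp⟩⟩

variable (B N) in
structure BNP (S : Set (↥N ⧸ (B ⊓ N).subgroupOf N)) : Prop extends LenSys S where
  ne1 : ∀ s ∈ S, s ≠ 1
  ax1 : ∀ s ∈ S, ∀ w : ↥N ⧸ (B ⊓ N).subgroupOf N,
      lifts B N s * (B : Set G) * lifts B N w ⊆ BwB B N (s * w) ∪ BwB B N w
  ax2 : ∀ s ∈ S, ¬(lifts B N s * (B : Set G) * lifts B N s ⊆ (B : Set G))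

namespace BNP

variable (h : BNP B N S)
include h

theorem A1 {s w : ↥N ⧸ (B ⊓ N).subgroupOf N} (hs : s ∈ S) {a b : G} (ha : a ∈ BwB B N s)
    (hb : b ∈ BwB B N w) : a * b ∈ BwB B N (s * w) ∨ a * b ∈ BwB B N w := by
  obtain ⟨x, rfl⟩ := QuotientGroup.mk_surjective s
  obtain ⟨y, rfl⟩ := QuotientGroup.mk_surjective w
  have ax := h.ax1 _ hs (QuotientGroup.mk y)
  rw [mem_BwB] at ha hb
  obtain ⟨c, hc, d, hd, rfl⟩ := ha
  obtain ⟨c', hc', d', hd', rfl⟩ := hb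
  have h1 : (x : G) * (d * c') * y ∈ lifts B N (QuotientGroup.mk x) * (B : Set G) *
      lifts B N (QuotientGroup.mk y) :=
    ⟨_, ⟨x, ⟨x, rfl, rfl⟩, d * c', B.mul_mem hd hc', rfl⟩, y, ⟨y, rfl, rfl⟩, rfl⟩
  have e : c * x * d * (c' * y * d') = c * ((x : G) * (d * c') * y) * d' := by
    simp only [mul_assoc]
  rw [e]
  rcases ax h1 with h2 | h2
  · left; exact C_right hd' (C_left hc h2)
  · right; exact C_right hd' (C_left hc h2)

theorem A1' {s w : ↥N ⧸ (B ⊓ N).subgroupOf N} (hs : s ∈ S) {a b : G} (ha : a ∈ BwB B N w)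
    (hb : b ∈ BwB B N s) : a * b ∈ BwB B N (w * s) ∨ a * b ∈ BwB B N w := by
  have hb' := C_inv hb
  rw [h.sinv hs] at hb'
  rcases h.A1 hs hb' (C_inv ha) with h1 | h1
  · left
    have := C_inv h1
    simpa [h.sinv hs] using this
  · right
    have := C_inv h1
    simpa using this

theorem A2 {s : ↥N ⧸ (B ⊓ N).subgroupOf N} (hs : s ∈ S) :
    ∃ a ∈ BwB B N s, ∃ b ∈ BwB B N s, a * b ∈ BwB B N s := by
  have := h.ax2 s hs
  rw [Set.not_subset] at this
  obtain ⟨_, ⟨_, ⟨n, hn, b, hb, rfl⟩, m, hm, rfl⟩, hnB⟩ := this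
  have hl : ∀ n ∈ lifts B N s, n ∈ BwB B N s := by
    intro n hn
    exact ⟨n, ⟨1, B.one_mem, n, hn, by simp⟩, 1, B.one_mem, by simp⟩
  have ha := C_right hb (hl n hn)
  refine ⟨_, ha, m, hl m hm, ?_⟩
  rcases h.A1 hs ha (hl m hm) with h1 | h1
  · rw [h.inv s hs, C_one] at h1
    exact absurd h1 hnB
  · exact h1

theorem bruhat' (n : ℕ) : ∀ u v : ↥N ⧸ (B ⊓ N).subgroupOf N, wordLen S u = n →
    wordLen S u ≤ wordLen S v → ∀ g, g ∈ BwB B N u → g ∈ BwB B N v → u = v := by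
  induction n with
  | zero =>
    intro u v hu _ g hg hg'
    obtain rfl := h.eq_one hu
    rw [C_one] at hg
    obtain ⟨x, rfl⟩ := QuotientGroup.mk_surjective v
    rw [mem_BwB] at hg'
    obtain ⟨b, hb, c, hc, rfl⟩ := hg'
    symm
    rw [QuotientGroup.eq_one_iff, Subgroup.mem_subgroupOf]
    refine ⟨?_, x.2⟩
    have := B.mul_mem (B.mul_mem (B.inv_mem hb) hg) (B.inv_mem hc)
    simpa [mul_assoc] using this
  | succ n ih =>
    intro u v hu huv g hg hg'
    obtain ⟨s, hs, x, rfl, hx⟩ := h.desc_left hu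
    obtain ⟨a, ha, b, hb, rfl⟩ := C_prod hg
    have ha' := C_inv ha
    rw [h.sinv hs] at ha'
    have h1 := h.A1 hs ha' hg'
    rw [inv_mul_cancel_left] at h1
    have c := h.le_s_mul hs v
    rcases h1 with h1 | h1
    · have := ih x (s * v) hx (by omega) b hb h1
      rw [this, h.ss hs]
    · have := ih x v hx (by omega) b hb h1
      subst this
      omega

theorem bruhat {u v : ↥N ⧸ (B ⊓ N).subgroupOf N} {g : G} (h1 : g ∈ BwB B N u)
    (h2 : g ∈ BwB B N v) : u = v := by
  rcases le_total (wordLen S u) (wordLen S v) with hc | hc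
  · exact h.bruhat' _ u v rfl hc g h1 h2
  · exact (h.bruhat' _ v u rfl hc g h2 h1).symm

theorem s_ne {s : ↥N ⧸ (B ⊓ N).subgroupOf N} (hs : s ∈ S) (w : ↥N ⧸ (B ⊓ N).subgroupOf N) :
    s * w ≠ w := fun e => h.ne1 s hs (by simpa using e)

theorem asc' (n : ℕ) : ∀ s ∈ S, ∀ w : ↥N ⧸ (B ⊓ N).subgroupOf N, wordLen S w = n →
    wordLen S w ≤ wordLen S (s * w) → ∀ a ∈ BwB B N s, ∀ b ∈ BwB B N w, a * b ∉ BwB B N w := by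
  induction n with
  | zero =>
    intro s hs w hw _ a ha b hb hab
    obtain rfl := h.eq_one hw
    rw [C_one] at hb
    exact h.ne1 s hs (h.bruhat (C_right hb ha) hab)
  | succ n ih =>
    intro s hs w hw hl a ha b hb hab
    obtain ⟨t, ht, w', rfl, hw'⟩ := h.desc_right hw
    obtain ⟨c, hc, d, hd, rfl⟩ := C_prod hb
    have hd' := C_inv hd
    rw [h.sinv ht] at hd'
    have h1 := h.A1' ht hab hd'
    rw [h.ss' ht] at h1
    have e : a * (c * d) * d⁻¹ = a * c := by group
    rw [e] at h1
    have l1 := h.mul_s_le ht (s * w')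
    rw [mul_assoc] at l1
    have h2 := ih s hs w' hw' (by omega) a ha c hc
    have h3 := (h.A1 hs ha hc).resolve_right h2
    rcases h1 with h1 | h1
    · exact h2 h1
    · have := h.bruhat h1 h3
      rw [this, h.ss hs] at hl
      rw [← this] at hl
      omega

theorem asc {s w : ↥N ⧸ (B ⊓ N).subgroupOf N} (hs : s ∈ S)
    (hl : wordLen S w ≤ wordLen S (s * w)) {a b : G} (ha : a ∈ BwB B N s) (hb : b ∈ BwB B N w) :
    a * b ∈ BwB B N (s * w) :=
  (h.A1 hs ha hb).resolve_right (h.asc' _ s hs w rfl hl a ha b hb)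

theorem len_ne : ∀ s ∈ S, ∀ w, wordLen S (s * w) ≠ wordLen S w := by
  intro s hs w e
  obtain ⟨a, ha, b, hb, hab⟩ := h.A2 hs
  obtain ⟨c, hc⟩ := C_ne (B := B) w
  have h1 := h.asc hs e.ge hb hc
  have h2 := h.asc hs (by rw [h.ss hs, e]) ha h1
  rw [h.ss hs] at h2
  have h3 := h.asc hs e.ge hab hc
  rw [mul_assoc] at h3
  exact h.s_ne hs w (h.bruhat h3 h2)

theorem para_mul {I : Set (↥N ⧸ (B ⊓ N).subgroupOf N)} (hI : I ⊆ S)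
    {u : ↥N ⧸ (B ⊓ N).subgroupOf N} (hu : u ∈ Subgroup.closure I) :
    ∀ w, ∀ a ∈ BwB B N u, ∀ b ∈ BwB B N w, ∃ v ∈ Subgroup.closure I, a * b ∈ BwB B N (v * w) := by
  have step : ∀ x ∈ I, ∀ y, (∀ w, ∀ a ∈ BwB B N y, ∀ b ∈ BwB B N w,
      ∃ v ∈ Subgroup.closure I, a * b ∈ BwB B N (v * w)) →
      ∀ w, ∀ a ∈ BwB B N (x * y), ∀ b ∈ BwB B N w,
      ∃ v ∈ Subgroup.closure I, a * b ∈ BwB B N (v * w) := by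
    intro x hx y ih w a ha b hb
    obtain ⟨c, hc, d, hd, rfl⟩ := C_prod ha
    obtain ⟨v, hv, h1⟩ := ih w d hd b hb
    rw [mul_assoc]
    rcases h.A1 (hI hx) hc h1 with h2 | h2
    · exact ⟨x * v, Subgroup.mul_mem _ (Subgroup.subset_closure hx) hv, by rwa [mul_assoc]⟩
    · exact ⟨v, hv, h2⟩
  induction hu using Subgroup.closure_induction_left with
  | one =>
    intro w a ha b hb
    rw [C_one] at ha
    exact ⟨1, Subgroup.one_mem _, by rw [one_mul]; exact C_left ha hb⟩
  | mul_left x hx y hy ih => exact step x hx y ih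
  | inv_mul_cancel x hx y hy ih => rw [h.sinv (hI hx)]; exact step x hx y ih

def paraS {I : Set (↥N ⧸ (B ⊓ N).subgroupOf N)} (hI : I ⊆ S) : Subgroup G where
  carrier := para B N I
  mul_mem' := by
    rintro a b ⟨u, hu, ha⟩ ⟨v, hv, hb⟩
    obtain ⟨x, hx, h1⟩ := h.para_mul hI hu v a ha b hb
    exact ⟨x * v, Subgroup.mul_mem _ hx hv, h1⟩
  one_mem' := ⟨1, Subgroup.one_mem _, by rw [C_one]; exact B.one_mem⟩
  inv_mem' := by
    rintro a ⟨u, hu, ha⟩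
    exact ⟨u⁻¹, Subgroup.inv_mem _ hu, C_inv ha⟩

def Ps {s : ↥N ⧸ (B ⊓ N).subgroupOf N} (hs : s ∈ S) : Subgroup G where
  carrier := BwB B N 1 ∪ BwB B N s
  mul_mem' := by
    rintro a b (ha | ha) (hb | hb)
    · left; rw [C_one] at ha; exact C_left ha hb
    · right; rw [C_one] at ha; exact C_left ha hb
    · right; rw [C_one] at hb; exact C_right hb ha
    · have := h.A1 hs ha hb
      rwa [h.inv s hs] at this
  one_mem' := by left; rw [C_one]; exact B.one_mem
  inv_mem' := by
    rintro a (ha | ha)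
    · left; simpa using C_inv ha
    · right; simpa [h.sinv hs] using C_inv ha

end BNP
end BNpair

section GrpAlg

variable [Fintype G]

noncomputable def ind (X : Set G) : MonoidAlgebra ℂ G :=
  ∑ x ∈ (Set.toFinite X).toFinset, MonoidAlgebra.single x (1 : ℂ)

open Classical in
theorem ind_coeff (X : Set G) (g : G) : (ind X).coeff g = if g ∈ X then 1 else 0 := by
  unfold ind
  rw [MonoidAlgebra.coeff_sum, Finsupp.finsetSum_apply]
  simp [MonoidAlgebra.coeff_single, Finsupp.single_apply]

theorem ind_mul_coeff (Y X : Set G) (g : G) :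
    (ind Y * ind X).coeff g = (({y ∈ Y | y⁻¹ * g ∈ X} : Set G).ncard : ℂ) := by
  classical
  conv_lhs => rw [ind, Finset.sum_mul, MonoidAlgebra.coeff_sum, Finsupp.finsetSum_apply]
  simp only [MonoidAlgebra.coeff_single_mul_apply, ind_coeff, one_mul]
  rw [Finset.sum_boole, Set.ncard_eq_toFinset_card _ (Set.toFinite _)]
  congr 2
  ext y
  simp

theorem ind_ext {x y : MonoidAlgebra ℂ G} (h : ∀ g, x.coeff g = y.coeff g) : x = y :=
  MonoidAlgebra.coeff_inj.1 (Finsupp.ext h)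

theorem ind_left (Y X : Set G) (h : ∀ y ∈ Y, ∀ g, y⁻¹ * g ∈ X ↔ g ∈ X) :
    ind Y * ind X = (Y.ncard : ℂ) • ind X := by
  classical
  apply ind_ext
  intro g
  rw [ind_mul_coeff, MonoidAlgebra.coeff_smul_apply, ind_coeff]
  split_ifs with hg
  · have : ({y ∈ Y | y⁻¹ * g ∈ X} : Set G) = Y := by
      ext y
      simp only [Set.mem_ofPred_eq, and_iff_left_iff_imp]
      exact fun hy => (h y hy g).2 hg
    rw [this]; simp
  · have : ({y ∈ Y | y⁻¹ * g ∈ X} : Set G) = ∅ := by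
      ext y
      simp only [Set.mem_ofPred_eq, Set.mem_empty_iff_false, iff_false]
      exact fun hy => hg ((h y hy.1 g).1 hy.2)
    rw [this]; simp

theorem ind_right (X Y : Set G) (h : ∀ y ∈ Y, ∀ g, g * y⁻¹ ∈ X ↔ g ∈ X) :
    ind X * ind Y = (Y.ncard : ℂ) • ind X := by
  classical
  apply ind_ext
  intro g
  rw [ind_mul_coeff, MonoidAlgebra.coeff_smul_apply, ind_coeff]
  split_ifs with hg
  · have : ({y ∈ X | y⁻¹ * g ∈ Y} : Set G) = (fun y => g * y⁻¹) '' Y := by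
      ext y
      simp only [Set.mem_ofPred_eq, Set.mem_image]
      constructor
      · rintro ⟨_, h2⟩
        exact ⟨_, h2, by group⟩
      · rintro ⟨z, hz, rfl⟩
        exact ⟨(h z hz g).2 hg, by simpa using hz⟩
    rw [this, Set.ncard_image_of_injective]
    · simp
    · intro a b hab
      simpa using hab
  · have : ({y ∈ X | y⁻¹ * g ∈ Y} : Set G) = ∅ := by
      ext y
      simp only [Set.mem_ofPred_eq, Set.mem_empty_iff_false, iff_false]
      rintro ⟨h1, h2⟩
      apply hg
      rw [← h _ h2]
      simpa using h1
    rw [this]; simp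

theorem ind_sub_left (P : Subgroup G) (X : Set G) (hX : X ⊆ P) :
    ind X * ind (P : Set G) = (X.ncard : ℂ) • ind (P : Set G) :=
  ind_left _ _ fun y hy g => P.mul_mem_cancel_left (P.inv_mem (hX hy))

theorem ind_sub_right (P : Subgroup G) (X : Set G) (hX : X ⊆ P) :
    ind (P : Set G) * ind X = (X.ncard : ℂ) • ind (P : Set G) :=
  ind_right _ _ fun y hy g => P.mul_mem_cancel_right (P.inv_mem (hX hy))

noncomputable def aug : MonoidAlgebra ℂ G →ₐ[ℂ] ℂ := MonoidAlgebra.lift ℂ ℂ G 1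

theorem aug_ind (X : Set G) : aug (ind X) = (X.ncard : ℂ) := by
  unfold aug ind
  rw [map_sum]
  simp only [MonoidAlgebra.lift_single]
  simp [Set.ncard_eq_toFinset_card _ (Set.toFinite X)]

theorem ind_biUnion {ι : Type*} (F : Finset ι) (C : ι → Set G)
    (hd : ∀ i ∈ F, ∀ j ∈ F, ∀ g, g ∈ C i → g ∈ C j → i = j) (X : Set G)
    (hX : ∀ g, g ∈ X ↔ ∃ i ∈ F, g ∈ C i) : ind X = ∑ i ∈ F, ind (C i) := by
  classical
  apply ind_ext
  intro g
  rw [MonoidAlgebra.coeff_sum, Finsupp.finsetSum_apply]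
  simp only [ind_coeff]
  split_ifs with hg
  · obtain ⟨i, hi, hgi⟩ := (hX g).1 hg
    rw [Finset.sum_eq_single i]
    · simp [hgi]
    · intro j hj hji
      rw [if_neg]
      exact fun hc => hji (hd j hj i hi g hc hgi)
    · exact fun h => absurd hi h
  · symm
    apply Finset.sum_eq_zero
    intro i hi
    rw [if_neg]
    exact fun hc => hg ((hX g).2 ⟨i, hi, hc⟩)

variable {B N : Subgroup G} [((B ⊓ N).subgroupOf N).Normal] {S : Set (↥N ⧸ (B ⊓ N).subgroupOf N)}

variable (B N) in
noncomputable def TT (w : ↥N ⧸ (B ⊓ N).subgroupOf N) : MonoidAlgebra ℂ G :=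
  ((B : Set G).ncard : ℂ)⁻¹ • ind (BwB B N w)

theorem b_ne : ((B : Set G).ncard : ℂ) ≠ 0 := by
  have : (B : Set G).ncard ≠ 0 := (Set.ncard_pos (Set.toFinite _)).2 ⟨1, B.one_mem⟩ |>.ne'
  exact_mod_cast this

theorem ind_eq (w : ↥N ⧸ (B ⊓ N).subgroupOf N) :
    ind (BwB B N w) = ((B : Set G).ncard : ℂ) • TT B N w := by
  rw [TT, smul_smul, mul_inv_cancel₀ b_ne, one_smul]

theorem TT_one (v : ↥N ⧸ (B ⊓ N).subgroupOf N) : TT B N 1 * TT B N v = TT B N v := by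
  have : ind (BwB B N 1) * ind (BwB B N v) = ((B : Set G).ncard : ℂ) • ind (BwB B N v) := by
    rw [C_one]
    apply ind_left
    intro y hy g
    constructor
    · intro hg
      simpa using C_left hy hg
    · intro hg
      exact C_left (B.inv_mem hy) hg
  conv_lhs => rw [TT, TT]
  rw [smul_mul_smul_comm, this, smul_smul, TT]
  congr 1
  have := b_ne (B := B)
  field_simp

namespace BNP

variable (h : BNP B N S)
include h

theorem TT_inj : Function.Injective (TT B N) := by
  classical
  intro u v huv
  obtain ⟨g, hg⟩ := C_ne (B := B) u
  have h1 : ind (BwB B N u) = ind (BwB B N v) := by rw [ind_eq, ind_eq, huv]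
  have h2 : (ind (BwB B N u)).coeff g = (ind (BwB B N v)).coeff g := by rw [h1]
  rw [ind_coeff, ind_coeff, if_pos hg] at h2
  by_cases hv : g ∈ BwB B N v
  · exact h.bruhat hg hv
  · rw [if_neg hv] at h2
    exact absurd h2 one_ne_zero

theorem TT_asc : ∀ s ∈ S, ∀ v, wordLen S v < wordLen S (s * v) →
    TT B N s * TT B N v = TT B N (s * v) := by
  classical
  intro s hs v hl
  have : ind (BwB B N s) * ind (BwB B N v) = ((B : Set G).ncard : ℂ) • ind (BwB B N (s * v)) := by
    apply ind_ext
    intro g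
    rw [ind_mul_coeff, MonoidAlgebra.coeff_smul_apply, ind_coeff]
    split_ifs with hg
    · obtain ⟨a, ha, b, hb, rfl⟩ := C_prod hg
      have : ({y ∈ BwB B N s | y⁻¹ * (a * b) ∈ BwB B N v} : Set G) =
          (fun y => a * y) '' (B : Set G) := by
        ext y
        simp only [Set.mem_ofPred_eq, Set.mem_image]
        constructor
        · rintro ⟨h1, h2⟩
          have h1' := C_inv h1
          rw [h.sinv hs] at h1'
          rcases h.A1 hs h1' ha with h3 | h3
          · rw [h.inv s hs, C_one] at h3
            exact ⟨a⁻¹ * y, by simpa using B.inv_mem h3, by group⟩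
          · have h4 := h.asc hs hl.le h3 hb
            rw [mul_assoc] at h4
            exact absurd (h.bruhat h4 h2) (h.s_ne hs v)
        · rintro ⟨z, hz, rfl⟩
          refine ⟨C_right hz ha, ?_⟩
          have := C_left (B.inv_mem hz) hb
          convert this using 1
          group
      rw [this, Set.ncard_image_of_injective _ (mul_right_injective a)]
      simp
    · have : ({y ∈ BwB B N s | y⁻¹ * g ∈ BwB B N v} : Set G) = ∅ := by
        ext y
        simp only [Set.mem_ofPred_eq, Set.mem_empty_iff_false, iff_false]
        rintro ⟨h1, h2⟩
        apply hg
        have := h.asc hs hl.le h1 h2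
        simpa using this
      rw [this]; simp
  conv_lhs => rw [TT, TT]
  rw [smul_mul_smul_comm, this, smul_smul, TT]
  congr 1
  have := b_ne (B := B)
  field_simp

variable {q : ℕ} (hq : ∀ s ∈ S, (BwB B N s).ncard = q * (B : Set G).ncard)
include hq

theorem aug_s {s : ↥N ⧸ (B ⊓ N).subgroupOf N} (hs : s ∈ S) : aug (TT B N s) = q := by
  rw [TT, map_smul, aug_ind, hq s hs, Nat.cast_mul, smul_eq_mul]
  have := b_ne (B := B)
  field_simp

theorem TT_quad : ∀ s ∈ S, TT B N s * TT B N s = ((q : ℂ) - 1) • TT B N s + (q : ℂ) • TT B N 1 := by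
  classical
  intro s hs
  have hP : ind (h.Ps hs : Set G) = ((B : Set G).ncard : ℂ) • (TT B N 1 + TT B N s) := by
    rw [smul_add, ← ind_eq, ← ind_eq]
    have := ind_biUnion ({1, s} : Finset (↥N ⧸ (B ⊓ N).subgroupOf N)) (BwB B N)
      (fun i _ j _ g => h.bruhat) (h.Ps hs : Set G) (by
        intro g
        simp only [Finset.mem_insert, Finset.mem_singleton, exists_eq_or_imp, exists_eq_left]
        rfl)
    rw [this, Finset.sum_pair (h.ne1 s hs).symm]
  have hPs : TT B N s * ind (h.Ps hs : Set G) = (q : ℂ) • ind (h.Ps hs : Set G) := by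
    rw [TT, smul_mul_assoc, ind_sub_left _ _ (fun g hg => Or.inr hg), smul_smul, hq s hs]
    congr 1
    have := b_ne (B := B)
    push_cast
    field_simp
  rw [hP, mul_smul_comm, smul_comm] at hPs
  have h2 := smul_right_injective _ (b_ne (B := B)) hPs
  have h3 : TT B N s * TT B N 1 = TT B N s :=
    h.toLenSys.T_mul_one TT_one h.TT_asc h.len_ne s
  rw [mul_add, h3, smul_add] at h2
  rw [sub_smul, one_smul, sub_add_eq_add_sub, eq_sub_iff_add_eq, add_comm, h2, add_comm]

theorem cox (hq2 : 2 ≤ q) : CoxSys S :=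
  h.toLenSys.toCox (q : ℂ) TT_one h.TT_asc (h.TT_quad hq) h.len_ne h.TT_inj (by
    intro hc
    have : q = 1 := by exact_mod_cast hc
    omega)

theorem aug_T (n : ℕ) : ∀ u, wordLen S u = n → aug (TT B N u) = (q : ℂ) ^ n := by
  induction n with
  | zero =>
    intro u hu
    obtain rfl := h.eq_one hu
    rw [TT, map_smul, aug_ind, C_one, smul_eq_mul, inv_mul_cancel₀ b_ne, pow_zero]
  | succ n ih =>
    intro u hu
    obtain ⟨s, hs, x, rfl, hx⟩ := h.desc_left hu
    rw [← h.TT_asc s hs x (by omega), map_mul, h.aug_s hq hs, ih x hx, pow_succ']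

theorem card_C (u : ↥N ⧸ (B ⊓ N).subgroupOf N) :
    ((BwB B N u).ncard : ℂ) = (B : Set G).ncard * (q : ℂ) ^ wordLen S u := by
  rw [← aug_ind, ind_eq, map_smul, h.aug_T hq _ u rfl, smul_eq_mul]

end BNP
end GrpAlg

section FinalAlg

namespace CoxSys

variable {W : Type*} [Group W] {S : Set W} (h : CoxSys S)
  {w : W} (hw : ∀ u, wordLen S u ≤ wordLen S w) {I : Set W} (hI : I ⊆ S) {wI : W}
  (hwI : wI ∈ Subgroup.closure I ∧ ∀ u ∈ Subgroup.closure I, wordLen S u ≤ wordLen S wI)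
include h hI hwI

theorem lI (u : W) (hu : u ∈ Subgroup.closure I) : wordLen S (wI * u) + wordLen S u = wordLen S wI := by
  have := h.longest hI (w := wI) (fun t ht => hwI.2 _ (Subgroup.mul_mem _ hwI.1
    (Subgroup.subset_closure ht))) _ u⁻¹ (Subgroup.inv_mem _ hu) rfl
  rwa [inv_inv, h.len_inv] at this

theorem wwI : wI * wI = 1 := h.eq_one (by have := h.lI hI hwI wI hwI.1; omega)

theorem lI' (u : W) (hu : u ∈ Subgroup.closure I) : wordLen S (u * wI) + wordLen S u = wordLen S wI := by
  have := h.lI hI hwI u⁻¹ (Subgroup.inv_mem _ hu)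
  have e : wI * u⁻¹ = (u * wI)⁻¹ := by
    rw [mul_inv_rev, inv_eq_of_mul_eq_one_left (h.wwI hI hwI)]
  rwa [e, h.len_inv, h.len_inv] at this

variable {A : Type*} [Ring A] [Algebra ℂ A] {T : W → A}
  (hone : ∀ v, T 1 * T v = T v)
  (hasc : ∀ s ∈ S, ∀ v, wordLen S v < wordLen S (s * v) → T s * T v = T (s * v))
include hone hasc hw

theorem sum_l (F : Finset W) (hF : ∀ u, u ∈ F ↔ u ∈ Subgroup.closure I) (c : ℂ) (hc : c ≠ 0)
    (h1 : (∑ u ∈ F, T u) * T wI = c • ∑ u ∈ F, T u) :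
    ∑ u ∈ F, T (u * w) = c⁻¹ • ((∑ u ∈ F, T u) * T w) := by
  have e2 := h.wwI hI hwI
  have a1 : ∀ u ∈ F, T u * T (wI * w) = T (u * wI * w) := by
    intro u hu
    rw [mul_assoc]
    apply h.T_add hone hasc _ u _ rfl
    have l1 := h.mul_w hw (u * wI)
    have l2 := h.mul_w hw wI
    have l3 := h.lI' hI hwI u ((hF u).1 hu)
    rw [← mul_assoc]
    omega
  have a2 : ∑ u ∈ F, T (u * w) = (∑ u ∈ F, T u) * T (wI * w) := by
    rw [Finset.sum_mul, Finset.sum_congr rfl a1]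
    refine Finset.sum_bij' (fun u _ => u * wI) (fun u _ => u * wI) ?_ ?_ ?_ ?_ ?_
    · intro u hu
      exact (hF _).2 (Subgroup.mul_mem _ ((hF u).1 hu) hwI.1)
    · intro u hu
      exact (hF _).2 (Subgroup.mul_mem _ ((hF u).1 hu) hwI.1)
    · intro u hu; rw [mul_assoc, e2, mul_one]
    · intro u hu; rw [mul_assoc, e2, mul_one]
    · intro u hu
      rw [mul_assoc u, e2, mul_one]
  have a3 : T wI * T (wI * w) = T w := by
    rw [a1 wI ((hF _).2 hwI.1), e2, one_mul]
  rw [a2, ← a3, ← mul_assoc, h1, smul_mul_assoc, smul_smul, inv_mul_cancel₀ hc, one_smul]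

theorem sum_r (F : Finset W) (hF : ∀ u, u ∈ F ↔ u ∈ Subgroup.closure I) (c : ℂ) (hc : c ≠ 0)
    (h1 : T wI * (∑ u ∈ F, T u) = c • ∑ u ∈ F, T u) :
    ∑ u ∈ F, T (w * u) = c⁻¹ • (T w * (∑ u ∈ F, T u)) := by
  have e2 := h.wwI hI hwI
  have a1 : ∀ u ∈ F, T (w * wI) * T u = T (w * (wI * u)) := by
    intro u hu
    rw [← mul_assoc]
    apply h.T_add hone hasc _ _ _ rfl
    have l1 := h.w_mul hw (wI * u)
    have l2 := h.w_mul hw wI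
    have l3 := h.lI hI hwI u ((hF u).1 hu)
    rw [mul_assoc]
    omega
  have a2 : ∑ u ∈ F, T (w * u) = T (w * wI) * (∑ u ∈ F, T u) := by
    rw [Finset.mul_sum, Finset.sum_congr rfl a1]
    refine Finset.sum_bij' (fun u _ => wI * u) (fun u _ => wI * u) ?_ ?_ ?_ ?_ ?_
    · intro u hu
      exact (hF _).2 (Subgroup.mul_mem _ hwI.1 ((hF u).1 hu))
    · intro u hu
      exact (hF _).2 (Subgroup.mul_mem _ hwI.1 ((hF u).1 hu))
    · intro u hu; rw [← mul_assoc, e2, one_mul]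
    · intro u hu; rw [← mul_assoc, e2, one_mul]
    · intro u hu
      rw [← mul_assoc wI, e2, one_mul]
  have a3 : T (w * wI) * T wI = T w := by
    rw [a1 wI ((hF _).2 hwI.1), e2, mul_one]
  rw [a2, ← a3, mul_assoc, h1, mul_smul_comm, smul_smul, inv_mul_cancel₀ hc, one_smul]

theorem sum_lr (F : Finset W) (hF : ∀ u, u ∈ F ↔ u ∈ Subgroup.closure I) (c p : ℂ) (hc : c ≠ 0)
    (h1 : T wI * (∑ u ∈ F, T u) = c • ∑ u ∈ F, T u)
    (h2 : (∑ u ∈ F, T u) * T wI = c • ∑ u ∈ F, T u)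
    (h3 : (∑ u ∈ F, T u) * (∑ u ∈ F, T u) = p • ∑ u ∈ F, T u) :
    (∑ u ∈ F, T (u * w)) * (∑ u ∈ F, T (w * u)) =
      (c⁻¹ * c⁻¹ * p) • ((∑ u ∈ F, T u) * (T w * T w)) := by
  rw [h.sum_l hw hI hwI hone hasc F hF c hc h2, h.sum_r hw hI hwI hone hasc F hF c hc h1]
  have hcom : (T w * T w) * (∑ u ∈ F, T u) = (∑ u ∈ F, T u) * (T w * T w) := by
    rw [Finset.mul_sum, Finset.sum_mul]
    exact Finset.sum_congr rfl fun u _ => h.T_comm hone hasc hw _ u rfl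
  rw [smul_mul_smul_comm, mul_assoc, ← mul_assoc (T w), hcom, ← mul_assoc, h3, smul_mul_assoc,
    smul_smul]

end CoxSys
end FinalAlg

section Fin

variable {B N : Subgroup G} [((B ⊓ N).subgroupOf N).Normal] {S : Set (↥N ⧸ (B ⊓ N).subgroupOf N)}

theorem BNP.PwQ (h : BNP B N S) {I J : Set (↥N ⧸ (B ⊓ N).subgroupOf N)} (hI : I ⊆ S) (hJ : J ⊆ S)
    {w : ↥N ⧸ (B ⊓ N).subgroupOf N}
    (hw : ∀ v ∈ Subgroup.closure J, w * v * w⁻¹ ∈ Subgroup.closure I) (g : G) :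
    g ∈ para B N I * lifts B N w * para B N J ↔ ∃ u ∈ Subgroup.closure I, g ∈ BwB B N (u * w) := by
  constructor
  · rintro ⟨_, ⟨a, ⟨u, hu, ha⟩, n, hn, rfl⟩, c, ⟨v, hv, hc⟩, rfl⟩
    have hn' : n ∈ BwB B N w := ⟨n, ⟨1, B.one_mem, n, hn, by simp⟩, 1, B.one_mem, by simp⟩
    obtain ⟨v', hv', h1⟩ := h.para_mul hJ (Subgroup.inv_mem _ hv) w⁻¹ _ (C_inv hc) _ (C_inv hn')
    have h2 := C_inv h1
    simp only [mul_inv_rev, inv_inv] at h2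
    obtain ⟨u', hu', h3⟩ := h.para_mul hI hu _ _ ha _ h2
    refine ⟨u' * (w * v'⁻¹ * w⁻¹), Subgroup.mul_mem _ hu' (hw _ (Subgroup.inv_mem _ hv')), ?_⟩
    have e : u' * (w * v'⁻¹ * w⁻¹) * w = u' * (w * v'⁻¹) := by group
    have e2 : a * n * c = a * (n * c) := mul_assoc _ _ _
    rw [e]
    change a * n * c ∈ _
    rw [e2]
    exact h3
  · rintro ⟨u, hu, hg⟩
    obtain ⟨a, ha, b, ⟨_, ⟨b1, hb1, n, hn, rfl⟩, b2, hb2, rfl⟩, rfl⟩ := C_prod hg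
    refine ⟨_, ⟨a * b1, ⟨u, hu, C_right hb1 ha⟩, n, hn, rfl⟩, b2,
      ⟨1, Subgroup.one_mem _, by rw [C_one]; exact hb2⟩, by simp [mul_assoc]⟩

end Fin


theorem stmt_11 [Fintype G] (B N : Subgroup G) [((B ⊓ N).subgroupOf N).Normal]
    -- BN-pair axioms
    (hGN : Subgroup.closure ((B : Set G) ∪ (N : Set G)) = ⊤)
    (S : Set (↥N ⧸ (B ⊓ N).subgroupOf N))
    (hSgen : Subgroup.closure S = ⊤)
    (hSinv : ∀ s ∈ S, s * s = 1 ∧ s ≠ 1)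
    (hBN1 : ∀ s ∈ S, ∀ w : ↥N ⧸ (B ⊓ N).subgroupOf N,
      lifts B N s * (B : Set G) * lifts B N w ⊆ BwB B N (s * w) ∪ BwB B N w)
    (hBN2 : ∀ s ∈ S, ¬(lifts B N s * (B : Set G) * lifts B N s ⊆ (B : Set G)))
    -- equal parameters: |BsB| = q·|B| for all s ∈ S
    (q : ℕ) (hq2 : 2 ≤ q)
    (hq : ∀ s ∈ S, (BwB B N s).ncard = q * (B : Set G).ncard)
    -- I ⊆ S, the longest element w = w_S of W, the longest element w_I of W_I, J = w⁻¹Iw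
    (I J : Set (↥N ⧸ (B ⊓ N).subgroupOf N)) (hIS : I ⊆ S)
    (wS : ↥N ⧸ (B ⊓ N).subgroupOf N)
    (hwS : ∀ u : ↥N ⧸ (B ⊓ N).subgroupOf N, wordLen S u ≤ wordLen S wS)
    (wI : ↥N ⧸ (B ⊓ N).subgroupOf N)
    (hwI : wI ∈ Subgroup.closure I ∧ ∀ u ∈ Subgroup.closure I,
      wordLen S u ≤ wordLen S wI)
    (hJ : (fun x => wS⁻¹ * x * wS) '' I = J) :
    ∀ lam : ℂ,
      (∃ v : MonoidAlgebra ℂ G, (∃ x : MonoidAlgebra ℂ G, v = x * ePset (para B N I)) ∧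
        v ≠ 0 ∧
        v * (aPwQ B N (para B N I) wS (para B N J) *
          aPwQ B N (para B N J) wS (para B N I)) = lam • v) →
      lam ≠ 0 ∧
      (∃ f : ℕ, lam = (q : ℂ) ^ ((f : ℤ) - 2 * (wordLen S wI : ℤ))) ∧
      (∃ f : ℕ, lam * (q : ℂ) ^ (2 * wordLen S wI) = (q : ℂ) ^ f) := by
  classical
  have hB : BNP B N S :=
    { gen := hSgen, inv := fun s hs => (hSinv s hs).1, ne1 := fun s hs => (hSinv s hs).2,
      ax1 := hBN1, ax2 := hBN2 }
  have h : CoxSys S := hB.cox hq hq2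
  letI : Fintype (↥N ⧸ (B ⊓ N).subgroupOf N) := Fintype.ofFinite _
  have hww := h.ww hwS
  have hwi := h.winv hwS
  have hJS : J ⊆ S := by
    rintro _ hj
    rw [← hJ] at hj
    obtain ⟨x, hx, rfl⟩ := hj
    simp only [hwi]
    exact h.conj_mem hwS (hIS hx)
  have hcl : Subgroup.closure J = (Subgroup.closure I).map (MulAut.conj wS⁻¹).toMonoidHom := by
    rw [MonoidHom.map_closure, ← hJ]
    congr 1
    ext x
    simp
  have hmem : ∀ u, u ∈ Subgroup.closure I → wS * u * wS ∈ Subgroup.closure J := by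
    intro u hu
    rw [hcl]
    exact ⟨u, hu, by simp [hwi]⟩
  have hmem' : ∀ u, u ∈ Subgroup.closure J → wS * u * wS ∈ Subgroup.closure I := by
    intro u hu
    rw [hcl] at hu
    obtain ⟨x, hx, rfl⟩ := hu
    have : wS * ((MulAut.conj wS⁻¹).toMonoidHom x) * wS = x := by
      simp only [MulEquiv.toMonoidHom_eq_coe, MonoidHom.coe_coe, MulAut.conj_apply, hwi]
      simp only [mul_assoc, hww, mul_one]
      rw [← mul_assoc, hww, one_mul]
    rw [this]
    exact hx
  have hinv2 : ∀ u, wS * (wS * u * wS) * wS = u := by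
    intro u
    simp only [mul_assoc, hww, mul_one]
    rw [← mul_assoc, hww, one_mul]
  obtain ⟨F, hF⟩ : ∃ F : Finset (↥N ⧸ (B ⊓ N).subgroupOf N),
      ∀ u, u ∈ F ↔ u ∈ Subgroup.closure I :=
    ⟨Finset.univ.filter (· ∈ Subgroup.closure I), by simp⟩
  obtain ⟨F', hF'⟩ : ∃ F : Finset (↥N ⧸ (B ⊓ N).subgroupOf N),
      ∀ u, u ∈ F ↔ u ∈ Subgroup.closure J :=
    ⟨Finset.univ.filter (· ∈ Subgroup.closure J), by simp⟩
  set b : ℂ := ((B : Set G).ncard : ℂ) with hb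
  have hb0 : b ≠ 0 := b_ne
  set E : MonoidAlgebra ℂ G := ∑ u ∈ F, TT B N u with hE
  have hqC : (q : ℂ) ≠ 0 := by
    have : q ≠ 0 := by omega
    exact_mod_cast this
  -- indicator of parabolic
  have iI : ind (para B N I) = b • E := by
    rw [hE, Finset.smul_sum, ind_biUnion F (BwB B N) (fun i _ j _ g => hB.bruhat) _
      (fun g => by simp only [hF]; rfl)]
    exact Finset.sum_congr rfl fun u _ => ind_eq u
  have iJ : ind (para B N J) = b • ∑ u ∈ F', TT B N u := by
    rw [Finset.smul_sum, ind_biUnion F' (BwB B N) (fun i _ j _ g => hB.bruhat) _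
      (fun g => by simp only [hF']; rfl)]
    exact Finset.sum_congr rfl fun u _ => ind_eq u
  set p : ℂ := aug E with hp
  have cI : ((para B N I).ncard : ℂ) = b * p := by
    rw [← aug_ind, iI, map_smul, smul_eq_mul]
  have cJ : ((para B N J).ncard : ℂ) = b * p := by
    rw [← aug_ind, iJ, map_smul, smul_eq_mul, hp, hE, map_sum, map_sum]
    congr 1
    refine Finset.sum_bij' (fun u _ => wS * u * wS) (fun u _ => wS * u * wS) ?_ ?_ ?_ ?_ ?_
    · intro u hu; exact (hF _).2 (hmem' _ ((hF' _).1 hu))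
    · intro u hu; exact (hF' _).2 (hmem _ ((hF _).1 hu))
    · intro u _; exact hinv2 u
    · intro u _; exact hinv2 u
    · intro u _
      rw [hB.aug_T hq _ u rfl, hB.aug_T hq _ _ rfl, h.conj_len hwS]
  have hp0 : p ≠ 0 := by
    have : ((para B N I).ncard : ℂ) ≠ 0 := by
      have : (para B N I).ncard ≠ 0 :=
        ((Set.ncard_pos (Set.toFinite _)).2 ⟨1, (hB.paraS hIS).one_mem⟩).ne'
      exact_mod_cast this
    rw [cI] at this
    exact right_ne_zero_of_mul this
  have iPJ : ind (para B N I * lifts B N wS * para B N J) = b • ∑ u ∈ F, TT B N (u * wS) := by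
    rw [Finset.smul_sum, ind_biUnion F (fun u => BwB B N (u * wS))
      (fun i _ j _ g h1 h2 => mul_right_cancel (hB.bruhat h1 h2)) _
      (fun g => by
        rw [hB.PwQ hIS hJS (by rw [hwi]; exact hmem')]
        simp only [hF])]
    exact Finset.sum_congr rfl fun u _ => ind_eq _
  have iPJ' : ind (para B N J * lifts B N wS * para B N I) = b • ∑ u ∈ F, TT B N (wS * u) := by
    rw [Finset.smul_sum, ind_biUnion F (fun u => BwB B N (wS * u))
      (fun i _ j _ g h1 h2 => mul_left_cancel (hB.bruhat h1 h2)) _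
      (fun g => by
        rw [hB.PwQ hJS hIS (by rw [hwi]; exact hmem)]
        simp only [hF]
        constructor
        · rintro ⟨u, hu, hg⟩
          refine ⟨_, hmem' u hu, ?_⟩
          rw [mul_assoc wS u, ← mul_assoc, hww, one_mul]
          exact hg
        · rintro ⟨u, hu, hg⟩
          refine ⟨_, hmem u hu, ?_⟩
          rw [mul_assoc _ wS wS, hww, mul_one]
          exact hg)]
    exact Finset.sum_congr rfl fun u _ => ind_eq _
  have hsub : BwB B N wI ⊆ (hB.paraS hIS : Set G) := fun g hg => ⟨wI, hwI.1, hg⟩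
  have hcar : (hB.paraS hIS : Set G) = para B N I := rfl
  set c : ℂ := (q : ℂ) ^ wordLen S wI with hc
  have hc0 : c ≠ 0 := pow_ne_zero _ hqC
  have h1 : TT B N wI * E = c • E := by
    have := ind_sub_left (hB.paraS hIS) _ hsub
    rw [hcar, iI, hB.card_C hq, ind_eq, smul_mul_smul_comm, smul_smul] at this
    have h' := congrArg (fun x => (b * b)⁻¹ • x) this
    simp only [smul_smul] at h'
    rw [inv_mul_cancel₀ (mul_ne_zero hb0 hb0), one_smul] at h'
    rw [h']
    congr 1
    rw [hc, ← hb]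
    field_simp
  have h2 : E * TT B N wI = c • E := by
    have := ind_sub_right (hB.paraS hIS) _ hsub
    rw [hcar, iI, hB.card_C hq, ind_eq, smul_mul_smul_comm, smul_smul] at this
    have h' := congrArg (fun x => (b * b)⁻¹ • x) this
    simp only [smul_smul] at h'
    rw [inv_mul_cancel₀ (mul_ne_zero hb0 hb0), one_smul] at h'
    rw [h']
    congr 1
    rw [hc, ← hb]
    field_simp
  have h3 : E * E = p • E := by
    have := ind_sub_right (hB.paraS hIS) _ (subset_refl _)
    rw [hcar, cI, iI, smul_mul_smul_comm, smul_smul] at this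
    have h' := congrArg (fun x => (b * b)⁻¹ • x) this
    simp only [smul_smul] at h'
    rw [inv_mul_cancel₀ (mul_ne_zero hb0 hb0), one_smul] at h'
    rw [h']
    congr 1
    field_simp
  have key := h.sum_lr hwS hIS hwI TT_one hB.TT_asc F hF c p hc0 h1 h2 h3
  have he : ePset (para B N I) = p⁻¹ • E := by
    have : ePset (para B N I) = ((para B N I).ncard : ℂ)⁻¹ • ind (para B N I) := rfl
    rw [this, cI, iI, smul_smul]
    congr 1
    field_simp
  have ha : aPwQ B N (para B N I) wS (para B N J) = p⁻¹ • ∑ u ∈ F, TT B N (u * wS) := by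
    have : aPwQ B N (para B N I) wS (para B N J) = ((para B N J).ncard : ℂ)⁻¹ •
      ind (para B N I * lifts B N wS * para B N J) := rfl
    rw [this, cJ, iPJ, smul_smul]
    congr 1
    field_simp
  have ha' : aPwQ B N (para B N J) wS (para B N I) = p⁻¹ • ∑ u ∈ F, TT B N (wS * u) := by
    have : aPwQ B N (para B N J) wS (para B N I) = ((para B N I).ncard : ℂ)⁻¹ •
      ind (para B N J * lifts B N wS * para B N I) := rfl
    rw [this, cI, iPJ', smul_smul]
    congr 1
    field_simp
  rintro lam ⟨v, ⟨x, hx⟩, hv0, hv⟩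
  have hvE : v * E = p • v := by
    rw [hx, he, mul_assoc, smul_mul_assoc, h3, smul_comm, mul_smul_comm]
  have hET : E * TT B N 1 = E := by
    rw [hE, Finset.sum_mul]
    exact Finset.sum_congr rfl fun u _ => h.toLenSys.T_mul_one TT_one hB.TT_asc hB.len_ne u
  have hv1 : v * TT B N 1 = v := by
    rw [hx, he, mul_assoc, smul_mul_assoc, hET]
  have hμ : v * (TT B N wS * TT B N wS) = (lam * (c * c)) • v := by
    rw [ha, ha', smul_mul_smul_comm, key, smul_smul, mul_smul_comm, ← mul_assoc v, hvE,
      smul_mul_assoc, smul_smul] at hv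
    have h' := congrArg (fun x => (c * c) • x) hv
    simp only [smul_smul] at h'
    have e : c * c * (p⁻¹ * p⁻¹ * (c⁻¹ * c⁻¹ * p) * p) = 1 := by field_simp
    rw [e, one_smul] at h'
    rw [h', mul_comm lam]
  obtain ⟨f, hf⟩ := h.eig_q hwS q _
    (h.eig_root (q : ℂ) TT_one hB.TT_asc (hB.TT_quad hq) wS v hv1 hv0 _ hμ)
  have hcc : c * c = (q : ℂ) ^ (2 * wordLen S wI) := by rw [hc, ← pow_add, two_mul]
  rw [hcc] at hf
  refine ⟨?_, ⟨f, ?_⟩, ⟨f, hf⟩⟩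
  · rintro rfl
    rw [zero_mul] at hf
    exact pow_ne_zero _ hqC hf.symm
  · rw [zpow_sub₀ hqC, eq_div_iff (zpow_ne_zero _ hqC), zpow_natCast, ← hf]
    congr 1
end

section
/- Let n = i + j + k with i, j, k ≥ 1 and let W = S_n be the symmetric group with simple reflections s_l = (l, l+1). Apply the Luo construction with s₀ = s_i и s₁ = s_{i+j}: then ℓ(w'₀w₁) = ij, ℓ(w'₁w₂) = ik, ℓ(w'₂w₃) = jk, and ℓ(w'₀ w_S) = ij + ik + jk, so that w'₀ w_S = (w'₀w₁)(w'₁w₂)(w'₂w₃) with additive lengths; in particular Luo's integer m equals 3 in type A_{n−1}. -/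
namespace Luo

/-- descending product s_m s_{m-1} ... with d factors -/
def D {G : Type*} [Group G] (s : ℕ → G) (m : ℕ) : ℕ → G
  | 0 => 1
  | d + 1 => D s m d * s (m - d)

section
variable {G : Type*} [Group G] (s : ℕ → G) (N : ℕ)

lemma D_comm (hcomm : ∀ a b, a + 1 < b → b < N → s a * s b = s b * s a)
    (m : ℕ) (hm : m < N) (l : ℕ) : ∀ d, l + d < m → D s m d * s l = s l * D s m d := by
  intro d
  induction d with
  | zero => intro _; simp [D]
  | succ d ih =>
    intro h
    simp only [D]
    rw [mul_assoc, ← hcomm l (m - d) (by omega) (by omega), ← mul_assoc, ih (by omega), mul_assoc]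

lemma D_shift (hcomm : ∀ a b, a + 1 < b → b < N → s a * s b = s b * s a)
    (hbraid : ∀ a, a + 1 < N → s (a + 1) * s a * s (a + 1) = s a * s (a + 1) * s a)
    (m : ℕ) (hm : m < N) (l : ℕ) (hl : l + 1 ≤ m) :
    ∀ d, d ≤ m + 1 → m < l + d → D s m d * s (l + 1) = s l * D s m d := by
  intro d
  induction d with
  | zero => intro _ h; omega
  | succ d ih =>
    intro hd h
    rcases Nat.lt_or_ge m (l + d) with h1 | h1
    · simp only [D]
      rw [mul_assoc, hcomm (m - d) (l + 1) (by omega) (by omega), ← mul_assoc,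
        ih (by omega) h1, mul_assoc]
    · obtain ⟨e, rfl⟩ : ∃ e, d = e + 1 := ⟨d - 1, by omega⟩
      have e1 : m - e = l + 1 := by omega
      have e2 : m - (e + 1) = l := by omega
      simp only [D]
      rw [e1, e2]
      have := D_comm s N hcomm m hm l e (by omega)
      calc D s m e * s (l + 1) * s l * s (l + 1)
          = D s m e * (s (l + 1) * s l * s (l + 1)) := by group
        _ = D s m e * s l * s (l + 1) * s l := by rw [hbraid l (by omega)]; group
        _ = _ := by rw [this]; group

lemma coset (hsq : ∀ a, a < N → s a * s a = 1)
    (hcomm : ∀ a b, a + 1 < b → b < N → s a * s b = s b * s a)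
    (hbraid : ∀ a, a + 1 < N → s (a + 1) * s a * s (a + 1) = s a * s (a + 1) * s a)
    (m : ℕ) (hm : m < N) (w : G) (hw : w ∈ Subgroup.closure (s '' Set.Iio (m + 1))) :
    ∃ v ∈ Subgroup.closure (s '' Set.Iio m), ∃ d ≤ m + 1, w = v * D s m d := by
  have key : ∀ x : G, (∃ v ∈ Subgroup.closure (s '' Set.Iio m), ∃ d ≤ m + 1, x = v * D s m d) →
      ∀ l ≤ m, ∃ v ∈ Subgroup.closure (s '' Set.Iio m), ∃ d ≤ m + 1, x * s l = v * D s m d := by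
    rintro x ⟨v, hv, d, hd, rfl⟩ l hl
    have mem : ∀ a, a < m → s a ∈ Subgroup.closure (s '' Set.Iio m) := fun a ha =>
      Subgroup.subset_closure ⟨a, ha, rfl⟩
    rcases Nat.lt_or_ge (l + d) m with h | h
    · refine ⟨v * s l, mul_mem hv (mem _ (by omega)), d, hd, ?_⟩
      rw [mul_assoc, D_comm s N hcomm m hm l d h, mul_assoc]
    rcases Nat.eq_or_lt_of_le h with h | h
    · refine ⟨v, hv, d + 1, by omega, ?_⟩
      have : m - d = l := by omega
      simp [D, this, mul_assoc]
    rcases Nat.eq_or_lt_of_le h with h | h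
    · obtain ⟨e, rfl⟩ : ∃ e, d = e + 1 := ⟨d - 1, by omega⟩
      refine ⟨v, hv, e, by omega, ?_⟩
      have : m - e = l := by omega
      simp [D, this, mul_assoc, hsq l (by omega)]
    · obtain ⟨a, rfl⟩ : ∃ a, l = a + 1 := ⟨l - 1, by omega⟩
      refine ⟨v * s a, mul_mem hv (mem _ (by omega)), d, hd, ?_⟩
      rw [mul_assoc, D_shift s N hcomm hbraid m hm a hl d hd (by omega), mul_assoc]
  induction hw using Subgroup.closure_induction_right with
  | one => exact ⟨1, one_mem _, 0, by omega, by simp [D]⟩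
  | mul_right x y hy h ih =>
    obtain ⟨l, hl, rfl⟩ := h
    exact key _ ih l (by simp at hl; omega)
  | mul_inv_cancel x y hy h ih =>
    obtain ⟨l, hl, rfl⟩ := h
    simp at hl
    rw [inv_eq_of_mul_eq_one_right (hsq l (by omega))]
    exact key _ ih l (by omega)

lemma inj_aux (hsq : ∀ a, a < N → s a * s a = 1)
    (hcomm : ∀ a b, a + 1 < b → b < N → s a * s b = s b * s a)
    (hbraid : ∀ a, a + 1 < N → s (a + 1) * s a * s (a + 1) = s a * s (a + 1) * s a)
    (f : G →* Equiv.Perm ℕ) (hf : ∀ a, a < N → f (s a) = Equiv.swap a (a + 1)) :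
    ∀ m ≤ N, ∀ w ∈ Subgroup.closure (s '' Set.Iio m), f w = 1 → w = 1 := by
  intro m
  induction m with
  | zero => intro _ w hw _; simpa using hw
  | succ m ih =>
    intro hm w hw hfw
    obtain ⟨v, hv, d, hd, rfl⟩ := coset s N hsq hcomm hbraid m hm w hw
    have hD : ∀ d ≤ m + 1, f (D s m d) (m + 1 - d) = m + 1 := by
      intro d
      induction d with
      | zero => intro _; simp [D]
      | succ d ihd =>
        intro h
        simp only [D, map_mul, Equiv.Perm.mul_apply]
        rw [hf _ (by omega)]
        have : m + 1 - (d + 1) = m - d := by omega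
        rw [this, Equiv.swap_apply_left, show m - d + 1 = m + 1 - d by omega]
        exact ihd (by omega)
    have hvfix : f v (m + 1) = m + 1 := by
      clear hfw hw
      have hgen : ∀ a, a < m → f (s a) (m + 1) = m + 1 := fun a ha => by
        rw [hf a (by omega)]
        exact Equiv.swap_apply_of_ne_of_ne (by omega) (by omega)
      have hle : Subgroup.closure (s '' Set.Iio m) ≤
          (MulAction.stabilizer (Equiv.Perm ℕ) (m + 1)).comap f := by
        rw [Subgroup.closure_le]
        rintro _ ⟨a, ha, rfl⟩
        simpa [MulAction.mem_stabilizer_iff] using hgen a ha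
      simpa [MulAction.mem_stabilizer_iff] using hle hv
    have h1 := congrArg (fun σ : Equiv.Perm ℕ => σ (m + 1 - d)) hfw
    simp only [map_mul, Equiv.Perm.mul_apply, hD d hd, hvfix, Equiv.Perm.one_apply] at h1
    have hd0 : d = 0 := by omega
    subst hd0
    simp only [D, mul_one] at hfw ⊢
    exact ih (by omega) v hv hfw

end

section
variable {N : ℕ} {W : Type*} [Group W] (cs : CoxeterSystem (CoxeterMatrix.A N) W)

lemma swap_braid (a : ℕ) : (Equiv.swap a (a+1) * Equiv.swap (a+1) (a+2)) ^ 3 = (1 : Equiv.Perm ℕ) := by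
  ext x
  simp only [pow_succ, pow_zero, one_mul, Equiv.Perm.mul_apply, Equiv.Perm.one_apply, Equiv.swap_apply_def]
  grind

lemma swap_braid' (a : ℕ) : (Equiv.swap (a+1) (a+2) * Equiv.swap a (a+1)) ^ 3 = (1 : Equiv.Perm ℕ) := by
  ext x
  simp only [pow_succ, pow_zero, one_mul, Equiv.Perm.mul_apply, Equiv.Perm.one_apply, Equiv.swap_apply_def]
  grind

lemma swap_comm (a b : ℕ) (h : a + 1 < b ∨ b + 1 < a) :
    (Equiv.swap a (a+1) * Equiv.swap b (b+1)) ^ 2 = (1 : Equiv.Perm ℕ) := by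
  ext x
  simp only [pow_succ, pow_zero, one_mul, Equiv.Perm.mul_apply, Equiv.Perm.one_apply, Equiv.swap_apply_def]
  grind

lemma liftable : (CoxeterMatrix.A N).IsLiftable
    (fun a : Fin N => (Equiv.swap (a : ℕ) (a + 1) : Equiv.Perm ℕ)) := by
  rintro ⟨a, ha⟩ ⟨b, hb⟩
  simp only [CoxeterMatrix.A, Matrix.of_apply, Fin.mk.injEq]
  split_ifs with h1 h2
  · subst h1; simp
  · rcases h2 with rfl | rfl
    · exact swap_braid' b
    · exact swap_braid a
  · exact swap_comm a b (by omega)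

noncomputable def F : W →* Equiv.Perm ℕ := cs.lift ⟨_, liftable⟩

lemma F_simple (a : Fin N) : F cs (cs.simple a) = Equiv.swap (a : ℕ) (a + 1) :=
  cs.lift_apply_simple liftable a

lemma F_inj : Function.Injective (F cs) := by
  rw [injective_iff_map_eq_one]
  intro w hw
  set s : ℕ → W := fun l => if h : l < N then cs.simple ⟨l, h⟩ else 1 with hs
  have hs' : ∀ l (h : l < N), s l = cs.simple ⟨l, h⟩ := fun l h => by simp [hs, h]
  refine inj_aux s N ?_ ?_ ?_ (F cs) ?_ N le_rfl w ?_ hw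
  · intro a ha; simp [hs' a ha]
  · intro a b h hb
    rw [hs' b hb, hs' a (by omega)]
    have := cs.simple_mul_simple_pow ⟨a, by omega⟩ ⟨b, hb⟩
    have hM : (CoxeterMatrix.A N) ⟨a, by omega⟩ ⟨b, hb⟩ = 2 := by
      simp only [CoxeterMatrix.A, Matrix.of_apply, Fin.mk.injEq]
      rw [if_neg (by omega), if_neg (by omega)]
    rw [hM, pow_two, mul_eq_one_iff_eq_inv] at this
    simpa using this
  · intro a h
    rw [hs' (a+1) h, hs' a (by omega)]
    have := cs.simple_mul_simple_pow ⟨a + 1, h⟩ ⟨a, by omega⟩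
    have hM : (CoxeterMatrix.A N) ⟨a + 1, h⟩ ⟨a, by omega⟩ = 3 := by
      simp only [CoxeterMatrix.A, Matrix.of_apply, Fin.mk.injEq]
      rw [if_neg (by omega), if_pos (by simp)]
    rw [hM, pow_succ, pow_two] at this
    have h2 := mul_eq_one_iff_eq_inv.mp ((show _ * (_) = (1:W) from by
      rw [← this]; simp only [mul_assoc]) :
      (cs.simple ⟨a + 1, h⟩ * cs.simple ⟨a, by omega⟩ * cs.simple ⟨a + 1, h⟩) *
      (cs.simple ⟨a, by omega⟩ * cs.simple ⟨a + 1, h⟩ * cs.simple ⟨a, by omega⟩) = 1)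
    simpa [mul_assoc] using h2
  · intro a ha
    rw [hs' a ha, F_simple]
  · have : s '' Set.Iio N = Set.range cs.simple := by
      ext x
      constructor
      · rintro ⟨a, ha, rfl⟩; exact ⟨⟨a, ha⟩, (hs' a ha).symm⟩
      · rintro ⟨⟨a, ha⟩, rfl⟩; exact ⟨a, ha, hs' a ha⟩
    rw [this, cs.subgroup_closure_range_simple]; trivial


/-- number of inversions among 0..n-1 -/
def invSet (n : ℕ) (σ : Equiv.Perm ℕ) : Finset (ℕ × ℕ) :=
  (Finset.range n ×ˢ Finset.range n).filter (fun p => p.1 < p.2 ∧ σ p.2 < σ p.1)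

lemma mem_invSet (n : ℕ) (σ : Equiv.Perm ℕ) (x y : ℕ) :
    (x, y) ∈ invSet n σ ↔ y < n ∧ x < y ∧ σ y < σ x := by
  simp only [invSet, Finset.mem_filter, Finset.mem_product, Finset.mem_range]
  constructor
  · rintro ⟨⟨_, _⟩, _, _⟩; exact ⟨by omega, by omega, by omega⟩
  · rintro ⟨_, _, _⟩; exact ⟨⟨by omega, by omega⟩, by omega, by omega⟩

lemma inv_asc (n l : ℕ) (hl : l + 1 < n) (σ : Equiv.Perm ℕ) (h : σ l < σ (l + 1)) :
    (invSet n (σ * Equiv.swap l (l + 1))).card = (invSet n σ).card + 1 := by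
  set τ : Equiv.Perm ℕ := Equiv.swap l (l + 1) with hτ
  have hττ : ∀ x, τ (τ x) = x := fun x => by simp [hτ]
  have e : invSet n (σ * τ) = insert (l, l + 1) ((invSet n σ).image (fun p => (τ p.1, τ p.2))) := by
    ext ⟨x, y⟩
    have h2 : (x, y) ∈ (invSet n σ).image (fun p => (τ p.1, τ p.2)) ↔ (τ x, τ y) ∈ invSet n σ := by
      rw [Finset.mem_image]
      constructor
      · rintro ⟨⟨a, b⟩, hab, heq⟩
        simp only [Prod.mk.injEq] at heq
        rw [← heq.1, ← heq.2, hττ, hττ]; exact hab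
      · intro hm; exact ⟨_, hm, by simp [hττ]⟩
    rw [Finset.mem_insert, h2, mem_invSet, mem_invSet]
    simp only [Prod.mk.injEq, Equiv.Perm.mul_apply]
    have hx : τ x = if x = l then l + 1 else if x = l + 1 then l else x := Equiv.swap_apply_def _ _ _
    have hy : τ y = if y = l then l + 1 else if y = l + 1 then l else y := Equiv.swap_apply_def _ _ _
    by_cases hxl : x = l
    · subst hxl
      by_cases hy1 : y = x + 1
      · subst hy1; simp at hx hy; rw [hx, hy]; constructor
        · intro _; left; simp
        · intro _; exact ⟨by omega, by omega, h⟩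
      · split_ifs at hx hy <;> rw [hx, hy] <;> constructor <;> intro H <;> omega
    · split_ifs at hx hy <;> rw [hx, hy] <;> subst_vars <;> constructor <;> intro H <;> omega
  rw [e, Finset.card_insert_of_notMem, Finset.card_image_of_injective]
  · rintro ⟨a, b⟩ ⟨c, d⟩ hh
    simpa using hh
  · rw [Finset.mem_image]
    rintro ⟨⟨a, b⟩, hab, heq⟩
    simp only [Prod.mk.injEq] at heq
    have ha : a = l + 1 := by rw [← hττ a, heq.1]; simp [hτ]
    have hb : b = l := by rw [← hττ b, heq.2]; simp [hτ]
    rw [mem_invSet] at hab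
    omega

lemma inv_desc (n l : ℕ) (hl : l + 1 < n) (σ : Equiv.Perm ℕ) (h : σ (l + 1) < σ l) :
    (invSet n (σ * Equiv.swap l (l + 1))).card + 1 = (invSet n σ).card := by
  have := inv_asc n l hl (σ * Equiv.swap l (l + 1)) (by simpa using h)
  rw [mul_assoc, Equiv.swap_mul_self, mul_one] at this
  exact this.symm

lemma F_fix (w : W) (x : ℕ) (hx : N + 1 ≤ x) : F cs w x = x := by
  induction w using cs.simple_induction_right with
  | one => simp
  | mul_simple_right w i ih =>
    rw [map_mul, F_simple, Equiv.Perm.mul_apply,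
      Equiv.swap_apply_of_ne_of_ne (by omega) (by omega), ih]

lemma F_lt (w : W) (x : ℕ) (hx : x < N + 1) : F cs w x < N + 1 := by
  by_contra h
  have := F_fix cs w _ (not_lt.mp h)
  have := (F cs w).injective this
  omega

lemma inv_le_length (w : W) : (invSet (N + 1) (F cs w)).card ≤ cs.length w := by
  obtain ⟨ω, hω, rfl⟩ := cs.exists_isReduced w
  rw [hω.eq]
  clear hω
  induction ω using List.reverseRecOn with
  | nil =>
    simp [invSet]
    intro a b _ _ _; omega
  | append_singleton ω i ih =>
    rw [cs.wordProd_append, cs.wordProd_singleton, map_mul, F_simple, List.length_append]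
    simp only [List.length_singleton]
    have hne : F cs (cs.wordProd ω) i ≠ F cs (cs.wordProd ω) (i + 1) := by
      intro h; have := (F cs (cs.wordProd ω)).injective h; omega
    rcases lt_or_gt_of_ne hne with h | h
    · rw [inv_asc _ _ (by omega) _ h]; omega
    · have := inv_desc (N + 1) i (by omega) _ h; omega

lemma strictMono_id (n : ℕ) (g : ℕ → ℕ) (hlt : ∀ x < n, g x < n)
    (hm : ∀ x, x + 1 < n → g x < g (x + 1)) (x : ℕ) (hx : x < n) : g x = x := by
  have h1 : ∀ x, x < n → x ≤ g x := by
    intro x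
    induction x with
    | zero => intro _; omega
    | succ x ih => intro h; have := ih (by omega); have := hm x h; omega
  have h2 : ∀ d x, x + d + 1 = n → g x ≤ x := by
    intro d
    induction d with
    | zero => intro x h; have := hlt x (by omega); omega
    | succ d ih => intro x h; have := ih (x + 1) (by omega); have := hm x (by omega); omega
  have := h1 x hx
  have := h2 (n - 1 - x) x (by omega)
  omega

lemma length_le_inv (m : ℕ) : ∀ w : W, (invSet (N + 1) (F cs w)).card = m → cs.length w ≤ m := by
  induction m with
  | zero =>
    intro w hw
    have h0 : invSet (N + 1) (F cs w) = ∅ := Finset.card_eq_zero.mp hw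
    have : w = 1 := by
      apply F_inj cs
      rw [map_one]
      ext x
      rw [Equiv.Perm.one_apply]
      rcases Nat.lt_or_ge x (N + 1) with hx | hx
      · apply strictMono_id (N + 1) (F cs w) (F_lt cs w) _ x hx
        intro y hy
        by_contra hc
        have hne : F cs w y ≠ F cs w (y + 1) := by
          intro h; have := (F cs w).injective h; omega
        have : (y, y + 1) ∈ invSet (N + 1) (F cs w) := by
          rw [mem_invSet]; omega
        simp [h0] at this
      · exact F_fix cs w x hx
    simp [this]
  | succ m ih =>
    intro w hw
    by_cases hd : ∃ y, y + 1 < N + 1 ∧ F cs w (y + 1) < F cs w y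
    · obtain ⟨y, hy, hlt⟩ := hd
      have h1 := inv_desc (N + 1) y hy _ hlt
      have h2 := ih (w * cs.simple ⟨y, by omega⟩) (by
        rw [map_mul, F_simple]; simp only; omega)
      rcases cs.length_mul_simple w ⟨y, by omega⟩ with h | h <;> omega
    · exfalso
      push Not at hd
      have hid : ∀ x < N + 1, F cs w x = x := by
        apply strictMono_id (N + 1) (F cs w) (F_lt cs w)
        intro y hy
        have := hd y hy
        have hne : F cs w y ≠ F cs w (y + 1) := by
          intro h; have := (F cs w).injective h; omega
        omega
      have : invSet (N + 1) (F cs w) = ∅ := by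
        ext ⟨x, y⟩
        rw [mem_invSet]
        simp only [Finset.notMem_empty, iff_false]
        rintro ⟨a, b, c⟩
        rw [hid y a, hid x (by omega)] at c
        omega
      rw [this] at hw; simp at hw

lemma length_eq (w : W) : cs.length w = (invSet (N + 1) (F cs w)).card :=
  le_antisymm (length_le_inv cs _ w rfl) (inv_le_length cs w)

/-- three-block reversal -/
def rev (n a b x : ℕ) : ℕ :=
  if x < a then a - 1 - x else if x < b then a + b - 1 - x else if x < n then b + n - 1 - x else x

lemma rev_block (g : ℕ → ℕ) (a b : ℕ) (h1 : ∀ x, a ≤ x → x < b → a ≤ g x ∧ g x < b)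
    (h2 : ∀ x, a ≤ x → x + 1 < b → g (x + 1) < g x) (x : ℕ) (hx : a ≤ x) (hx' : x < b) :
    g x = a + b - 1 - x := by
  have := strictMono_id (b - a) (fun y => b - 1 - g (a + y))
    (fun y hy => by have := h1 (a + y) (by omega) (by omega); omega)
    (fun y hy => by
      have := h1 (a + y) (by omega) (by omega)
      have := h2 (a + y) (by omega) (by omega)
      simp only [← add_assoc]; omega) (x - a) (by omega)
  simp only [show a + (x - a) = x by omega] at this
  have := h1 x hx hx'
  omega

def Jset (a b : ℕ) : Set W := {x | ∃ l : Fin N, (l : ℕ) + 1 ≠ a ∧ (l : ℕ) + 1 ≠ b ∧ cs.simple l = x}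

lemma pres (J : Set W) (c : ℕ) (hJ : ∀ x ∈ J, ∃ l : Fin N, (l : ℕ) + 1 ≠ c ∧ cs.simple l = x)
    (w : W) (hw : w ∈ Subgroup.closure J) : ∀ x, F cs w x < c ↔ x < c := by
  induction hw using Subgroup.closure_induction with
  | mem y hy =>
    obtain ⟨l, hl, rfl⟩ := hJ y hy
    intro x
    rw [F_simple, Equiv.swap_apply_def]
    split_ifs <;> omega
  | one => simp
  | mul x y _ _ hx hy => intro z; rw [map_mul, Equiv.Perm.mul_apply, hx, hy]
  | inv x _ hx =>
    intro z
    rw [← hx, map_inv]; simp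

lemma rev_eq (a b : ℕ) (hab : a ≤ b) (hb : b ≤ N + 1) (w : W)
    (hw : w ∈ Subgroup.closure (Jset cs a b))
    (hmax : ∀ u ∈ Subgroup.closure (Jset cs a b), cs.length u ≤ cs.length w) (x : ℕ) :
    F cs w x = rev (N + 1) a b x := by
  have pa := pres cs _ a (by rintro x ⟨l, h1, h2, h3⟩; exact ⟨l, h1, h3⟩) w hw
  have pb := pres cs _ b (by rintro x ⟨l, h1, h2, h3⟩; exact ⟨l, h2, h3⟩) w hw
  have pn : ∀ x < N + 1, F cs w x < N + 1 := F_lt cs w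
  have hd : ∀ y, y + 1 < N + 1 → y + 1 ≠ a → y + 1 ≠ b → F cs w (y + 1) < F cs w y := by
    intro y hy ha hb
    by_contra hc
    have hne : F cs w y ≠ F cs w (y + 1) := by
      intro h; have := (F cs w).injective h; omega
    have h1 := inv_asc (N + 1) y hy (F cs w) (by omega)
    have h2 := hmax (w * cs.simple ⟨y, by omega⟩)
      (mul_mem hw (Subgroup.subset_closure ⟨⟨y, by omega⟩, ha, hb, rfl⟩))
    rw [length_eq, length_eq, map_mul, F_simple] at h2
    simp only at h2
    omega
  unfold rev
  split_ifs with h1 h2 h3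
  · rw [rev_block (F cs w) 0 a (fun x _ hx => ⟨by omega, (pa x).2 hx⟩)
      (fun x _ hx => hd x (by omega) (by omega) (by omega)) x (by omega) h1]
    omega
  · exact rev_block (F cs w) a b (fun x hx hx' => ⟨by have := pa x; omega, (pb x).2 hx'⟩)
      (fun x _ hx => hd x (by omega) (by omega) (by omega)) x (by omega) h2
  · exact rev_block (F cs w) b (N + 1) (fun x hx hx' => ⟨by have := pb x; omega, pn x hx'⟩)
      (fun x _ hx => hd x (by omega) (by omega) (by omega)) x (by omega) h3
  · exact F_fix cs w x (by omega)

lemma simple_inj : Function.Injective cs.simple := by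
  intro a b h
  have h1 := congrArg (F cs) h
  rw [F_simple, F_simple] at h1
  have h2 := congrArg (fun σ : Equiv.Perm ℕ => σ a) h1
  have h3 := congrArg (fun σ : Equiv.Perm ℕ => σ b) h1
  simp only [Equiv.swap_apply_left] at h2 h3
  rw [Equiv.swap_apply_def] at h2 h3
  ext
  split_ifs at h2 h3 <;> omega

lemma J0 : Set.range cs.simple = Jset cs 0 0 := by
  ext x; simp [Jset]

lemma J1 (p : Fin N) : Set.range cs.simple \ {cs.simple p} = Jset cs 0 (p + 1) := by
  ext x
  simp only [Jset, Set.mem_sdiff, Set.mem_range, Set.mem_singleton_iff, Set.mem_ofPred_eq]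
  constructor
  · rintro ⟨⟨l, rfl⟩, h⟩
    refine ⟨l, by omega, fun hh => h ?_, rfl⟩
    congr 1; ext; omega
  · rintro ⟨l, _, h, rfl⟩
    refine ⟨⟨l, rfl⟩, fun hh => h ?_⟩
    rw [simple_inj cs hh]

lemma J2 (p q : Fin N) :
    Set.range cs.simple \ {cs.simple p, cs.simple q} = Jset cs (p + 1) (q + 1) := by
  ext x
  simp only [Jset, Set.mem_sdiff, Set.mem_range, Set.mem_insert_iff, Set.mem_singleton_iff,
    Set.mem_ofPred_eq]
  constructor
  · rintro ⟨⟨l, rfl⟩, h⟩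
    refine ⟨l, fun hh => h (Or.inl ?_), fun hh => h (Or.inr ?_), rfl⟩
    · congr 1; ext; omega
    · congr 1; ext; omega
  · rintro ⟨l, h1, h2, rfl⟩
    refine ⟨⟨l, rfl⟩, ?_⟩
    rintro (hh | hh)
    · exact h1 (by rw [simple_inj cs hh])
    · exact h2 (by rw [simple_inj cs hh])


lemma rev_spec (n a b x : ℕ) :
    (x < a ∧ rev n a b x = a - 1 - x) ∨ (a ≤ x ∧ x < b ∧ rev n a b x = a + b - 1 - x) ∨
    (a ≤ x ∧ b ≤ x ∧ x < n ∧ rev n a b x = b + n - 1 - x) ∨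
    (a ≤ x ∧ b ≤ x ∧ n ≤ x ∧ rev n a b x = x) := by
  unfold rev
  split_ifs <;> omega

lemma conj_swap (σ : Equiv.Perm ℕ) (a b c d : ℕ) (hσ : ∀ x, σ (σ x) = x) (h1 : σ a = c)
    (h2 : σ b = d) : σ * Equiv.swap a b * σ = Equiv.swap d c := by
  have : σ = σ⁻¹ := by
    rw [eq_inv_iff_mul_eq_one]; ext x; simp [hσ]
  calc _ = σ * Equiv.swap a b * σ⁻¹ := by rw [← this]
    _ = Equiv.swap d c := by rw [← Equiv.swap_apply_apply, h1, h2, Equiv.swap_comm]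

lemma rev_rev (n b x : ℕ) (hb : b ≤ n) : rev n 0 b (rev n 0 b x) = x := by
  have q1 := rev_spec n 0 b x
  have q2 := rev_spec n 0 b (rev n 0 b x)
  omega

set_option maxHeartbeats 4000000 in
lemma main (i j k : ℕ) (hi : 1 ≤ i) (hj : 1 ≤ j) (hk : 1 ≤ k)
    (hn : N + 1 = i + j + k)
    (S : Set W) (hS : S = Set.range cs.simple)
    (wl : Set W → W)
    (hwl : ∀ J ⊆ S, wl J ∈ Subgroup.closure J ∧
      ∀ u ∈ Subgroup.closure J, cs.length u ≤ cs.length (wl J))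
    (t : ℕ → W)
    (ht0 : t 0 = cs.simple ⟨i - 1, by omega⟩)
    (ht1 : t 1 = cs.simple ⟨i + j - 1, by omega⟩)
    (hrec : ∀ m : ℕ, t (m + 2) = wl (S \ {t (m + 1)}) * t m * wl (S \ {t (m + 1)})) :
    cs.length (wl (S \ {t 0, t 1}) * wl (S \ {t 1})) = i * j ∧
    cs.length (wl (S \ {t 1, t 2}) * wl (S \ {t 2})) = i * k ∧
    cs.length (wl (S \ {t 2, t 3}) * wl (S \ {t 3})) = j * k ∧
    cs.length (wl (S \ {t 0, t 1}) * wl S) = i * j + i * k + j * k ∧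
    wl (S \ {t 0, t 1}) * wl S =
      (wl (S \ {t 0, t 1}) * wl (S \ {t 1})) *
      (wl (S \ {t 1, t 2}) * wl (S \ {t 2})) *
      (wl (S \ {t 2, t 3}) * wl (S \ {t 3})) := by
  have R : ∀ a b : ℕ, a ≤ b → b ≤ N + 1 → ∀ x, F cs (wl (Jset cs a b)) x = rev (N + 1) a b x := by
    intro a b hab hb x
    have := hwl (Jset cs a b) (by rw [hS]; rintro _ ⟨l, _, _, rfl⟩; exact ⟨l, rfl⟩)
    exact rev_eq cs a b hab hb _ this.1 this.2 x
  have e1 : S \ {t 1} = Jset cs 0 (i + j) := by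
    rw [hS, ht1, J1]; congr 1; simp only; omega
  have ht2 : t 2 = cs.simple ⟨j - 1, by omega⟩ := by
    apply F_inj cs
    rw [hrec 0, zero_add, e1, ht0]
    rw [map_mul, map_mul, F_simple, F_simple]
    have q : ∀ x, _ := R 0 (i + j) (by omega) (by omega)
    refine conj_swap _ _ _ _ _ (fun x => ?_) ?_ ?_
    · rw [q, q, rev_rev _ _ _ (by omega)]
    · rw [q]
      have := rev_spec (N + 1) 0 (i + j) (i - 1)
      simp only
      omega
    · rw [q]
      have := rev_spec (N + 1) 0 (i + j) (i - 1 + 1)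
      simp only
      omega
  have e2 : S \ {t 2} = Jset cs 0 j := by
    rw [hS, ht2, J1]; congr 1; simp only; omega
  have ht3 : t 3 = cs.simple ⟨j + k - 1, by omega⟩ := by
    apply F_inj cs
    rw [hrec 1, show 1 + 1 = 2 from rfl, e2, ht1]
    rw [map_mul, map_mul, F_simple, F_simple]
    have q : ∀ x, _ := R 0 j (by omega) (by omega)
    refine conj_swap _ _ _ _ _ (fun x => ?_) ?_ ?_
    · rw [q, q, rev_rev _ _ _ (by omega)]
    · rw [q]
      have := rev_spec (N + 1) 0 j (i + j - 1)
      simp only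
      omega
    · rw [q]
      have := rev_spec (N + 1) 0 j (i + j - 1 + 1)
      simp only
      omega
  have e3 : S \ {t 3} = Jset cs 0 (j + k) := by
    rw [hS, ht3, J1]; congr 1; simp only; omega
  have e01 : S \ {t 0, t 1} = Jset cs i (i + j) := by
    rw [hS, ht0, ht1, J2]; congr 1 <;> simp only <;> omega
  have e12 : S \ {t 1, t 2} = Jset cs j (i + j) := by
    rw [hS, Set.pair_comm, ht1, ht2, J2]; congr 1 <;> simp only <;> omega
  have e23 : S \ {t 2, t 3} = Jset cs j (j + k) := by
    rw [hS, ht2, ht3, J2]; congr 1 <;> simp only <;> omega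
  have e : S = Jset cs 0 0 := by rw [hS, J0]
  rw [e01, e12, e23, e1, e2, e3, show wl S = wl (Jset cs 0 0) by rw [← e]]
  have c01 : ∀ x, F cs (wl (Jset cs i (i + j)) * wl (Jset cs 0 (i + j))) x =
      if x < j then x + i else if x < i + j then x - j else x := by
    intro x
    simp only [map_mul, Equiv.Perm.mul_apply, R 0 (i + j) (by omega) (by omega),
      R i (i + j) (by omega) (by omega)]
    have q1 := rev_spec (N + 1) 0 (i + j) x
    have q2 := rev_spec (N + 1) i (i + j) (rev (N + 1) 0 (i + j) x)
    generalize rev (N + 1) i (i + j) (rev (N + 1) 0 (i + j) x) = z at *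
    generalize rev (N + 1) 0 (i + j) x = y at *
    clear R
    rcases q1 with q1 | q1 | q1 | q1 <;> rcases q2 with q2 | q2 | q2 | q2 <;>
      first | (exfalso; omega) | (split_ifs <;> omega)
  have c12 : ∀ x, F cs (wl (Jset cs j (i + j)) * wl (Jset cs 0 j)) x =
      if x < j then x else if x < j + k then x + i else if x < N + 1 then x - k else x := by
    intro x
    simp only [map_mul, Equiv.Perm.mul_apply, R 0 j (by omega) (by omega),
      R j (i + j) (by omega) (by omega)]
    have q1 := rev_spec (N + 1) 0 j x
    have q2 := rev_spec (N + 1) j (i + j) (rev (N + 1) 0 j x)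
    generalize rev (N + 1) j (i + j) (rev (N + 1) 0 j x) = z at *
    generalize rev (N + 1) 0 j x = y at *
    clear R
    rcases q1 with q1 | q1 | q1 | q1 <;> rcases q2 with q2 | q2 | q2 | q2 <;>
      first | (exfalso; omega) | (split_ifs <;> omega)
  have c23 : ∀ x, F cs (wl (Jset cs j (j + k)) * wl (Jset cs 0 (j + k))) x =
      if x < k then x + j else if x < j + k then x - k else x := by
    intro x
    simp only [map_mul, Equiv.Perm.mul_apply, R 0 (j + k) (by omega) (by omega),
      R j (j + k) (by omega) (by omega)]
    have q1 := rev_spec (N + 1) 0 (j + k) x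
    have q2 := rev_spec (N + 1) j (j + k) (rev (N + 1) 0 (j + k) x)
    generalize rev (N + 1) j (j + k) (rev (N + 1) 0 (j + k) x) = z at *
    generalize rev (N + 1) 0 (j + k) x = y at *
    clear R
    rcases q1 with q1 | q1 | q1 | q1 <;> rcases q2 with q2 | q2 | q2 | q2 <;>
      first | (exfalso; omega) | (split_ifs <;> omega)
  have c0 : ∀ x, F cs (wl (Jset cs i (i + j)) * wl (Jset cs 0 0)) x =
      if x < k then x + i + j else if x < j + k then x - k + i else if x < N + 1 then x - (j + k)
      else x := by
    intro x
    simp only [map_mul, Equiv.Perm.mul_apply, R 0 0 (by omega) (by omega),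
      R i (i + j) (by omega) (by omega)]
    have q1 := rev_spec (N + 1) 0 0 x
    have q2 := rev_spec (N + 1) i (i + j) (rev (N + 1) 0 0 x)
    generalize rev (N + 1) i (i + j) (rev (N + 1) 0 0 x) = z at *
    generalize rev (N + 1) 0 0 x = y at *
    clear R
    rcases q1 with q1 | q1 | q1 | q1 <;> rcases q2 with q2 | q2 | q2 | q2 <;>
      first | (exfalso; omega) | (split_ifs <;> omega)
  refine ⟨?_, ?_, ?_, ?_, ?_⟩
  · rw [length_eq, show invSet _ _ = Finset.range j ×ˢ Finset.Ico j (i + j) from ?_]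
    · simp [mul_comm]
    · ext ⟨x, y⟩
      rw [mem_invSet, c01, c01]
      simp only [Finset.mem_product, Finset.mem_range, Finset.mem_Ico]
      split_ifs <;> omega
  · rw [length_eq, show invSet _ _ = Finset.Ico j (j + k) ×ˢ Finset.Ico (j + k) (j + k + i) from ?_]
    · simp [mul_comm]
    · ext ⟨x, y⟩
      rw [mem_invSet, c12, c12]
      simp only [Finset.mem_product, Finset.mem_Ico]
      split_ifs <;> omega
  · rw [length_eq, show invSet _ _ = Finset.range k ×ˢ Finset.Ico k (j + k) from ?_]
    · simp [mul_comm]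
    · ext ⟨x, y⟩
      rw [mem_invSet, c23, c23]
      simp only [Finset.mem_product, Finset.mem_range, Finset.mem_Ico]
      split_ifs <;> omega
  · rw [length_eq, show invSet _ _ = Finset.range k ×ˢ Finset.Ico k (k + (i + j)) ∪
      Finset.Ico k (k + j) ×ˢ Finset.Ico (k + j) (k + j + i) from ?_]
    · rw [Finset.card_union_of_disjoint]
      · simp; ring
      · rw [Finset.disjoint_left]
        rintro ⟨x, y⟩
        simp only [Finset.mem_product, Finset.mem_range, Finset.mem_Ico]
        omega
    · ext ⟨x, y⟩
      rw [mem_invSet, c0, c0]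
      simp only [Finset.mem_union, Finset.mem_product, Finset.mem_range, Finset.mem_Ico]
      split_ifs <;> omega
  · apply F_inj cs
    ext x
    rw [map_mul _ (_ * _ * _), map_mul _ (wl (Jset cs i (i + j)) * wl (Jset cs 0 (i + j))),
      Equiv.Perm.mul_apply, Equiv.Perm.mul_apply, c0, c01, c12, c23]
    split_ifs <;> omega

end
end Luo

theorem stmt_12 (n i j k : ℕ) (hi : 1 ≤ i) (hj : 1 ≤ j) (hk : 1 ≤ k)
    (hn : n = i + j + k)
    {W : Type*} [Group W] (cs : CoxeterSystem (CoxeterMatrix.Aₙ (n - 1)) W)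
    (S : Set W) (hS : S = Set.range cs.simple)
    -- longest elements of the standard parabolic subgroups
    (wl : Set W → W)
    (hwl : ∀ J ⊆ S, wl J ∈ Subgroup.closure J ∧
      ∀ u ∈ Subgroup.closure J, cs.length u ≤ cs.length (wl J))
    -- the Luo sequence starting at (s_i, s_{i+j})
    (t : ℕ → W)
    (ht0 : t 0 = cs.simple ⟨i - 1, by omega⟩)
    (ht1 : t 1 = cs.simple ⟨i + j - 1, by omega⟩)
    (hmem : ∀ m, t m ∈ S)
    (hrec : ∀ m : ℕ, t (m + 2) = wl (S \ {t (m + 1)}) * t m * wl (S \ {t (m + 1)})) :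
    cs.length (wl (S \ {t 0, t 1}) * wl (S \ {t 1})) = i * j ∧
    cs.length (wl (S \ {t 1, t 2}) * wl (S \ {t 2})) = i * k ∧
    cs.length (wl (S \ {t 2, t 3}) * wl (S \ {t 3})) = j * k ∧
    cs.length (wl (S \ {t 0, t 1}) * wl S) = i * j + i * k + j * k ∧
    wl (S \ {t 0, t 1}) * wl S =
      (wl (S \ {t 0, t 1}) * wl (S \ {t 1})) *
      (wl (S \ {t 1, t 2}) * wl (S \ {t 2})) *
      (wl (S \ {t 2, t 3}) * wl (S \ {t 3})) := by
  obtain ⟨N, rfl⟩ : ∃ N, n = N + 1 := ⟨n - 1, by omega⟩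
  exact Luo.main (N := N) cs i j k hi hj hk hn S hS wl hwl t ht0 ht1 hrec
end

section
/- Let n = 2i + k with i ≥ 1, k ≥ 0, and work in the hyperoctahedral group W(C_n) of signed permutations. Let w₀ = w_{S∖{s_i}}, w₁ = w_{S∖{s_{2i}}}, and w' = w_{S∖{s_i, s_{2i}}} be the longest elements of the indicated standard parabolic subgroups. Then the element u = w' w₁ w' w₀ is the signed permutation given by u(l) = l + i for 1 ≤ l ≤ i, u(l) = −(2i + 1 − l) for i + 1 ≤ l ≤ 2i, and u(l) = l for 2i + 1 ≤ l ≤ n. -/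
/-!
STATEMENT 17. The hyperoctahedral group W(C_n) is realized as the group of signed
permutations of {±1, …, ±n}, i.e. bijections σ of ℤ with σ(−l) = −σ(l) fixing
everything outside {±1,…,±n}; the Coxeter generators are
s_l = (l, l+1)(−l, −(l+1)) for 1 ≤ l < n and s_n = (n, −n).
Let n = 2i + k with i ≥ 1, k ≥ 0, and let w₀ = w_{S∖{s_i}}, w₁ = w_{S∖{s_{2i}}},
w' = w_{S∖{s_i, s_{2i}}} be longest elements of the indicated standard parabolic
subgroups (longest w.r.t. the word length over S). Then u = w' w₁ w' w₀ is the signed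
permutation with u(l) = l + i for 1 ≤ l ≤ i, u(l) = −(2i + 1 − l) for i+1 ≤ l ≤ 2i,
and u(l) = l for 2i + 1 ≤ l ≤ n.
-/

namespace Stmt17

/-- The Coxeter generator `s_l` of the group of signed permutations of `{±1, …, ±n}`:
`s_l = (l, l+1)(−l, −(l+1))` for `1 ≤ l < n`, and `s_n = (n, −n)`. -/
def gen (n : ℕ) (l : ℕ) : Equiv.Perm ℤ :=
  if l = n then Equiv.swap (n : ℤ) (-(n : ℤ))
  else Equiv.swap (l : ℤ) ((l : ℤ) + 1) * Equiv.swap (-(l : ℤ)) (-((l : ℤ) + 1))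

/-- The set of Coxeter generators of `W(C_n)`. -/
def S (n : ℕ) : Set (Equiv.Perm ℤ) := {σ | ∃ l : ℕ, 1 ≤ l ∧ l ≤ n ∧ σ = gen n l}

/-- Word length with respect to a generating set. -/
noncomputable def wordLen (n : ℕ) (w : Equiv.Perm ℤ) : ℕ :=
  sInf {m | ∃ L : List (Equiv.Perm ℤ), L.length = m ∧ (∀ x ∈ L, x ∈ S n) ∧ L.prod = w}

/-- `w` is the longest element of the standard parabolic subgroup `W_J = ⟨J⟩`. -/
def IsLongestOf (n : ℕ) (J : Set (Equiv.Perm ℤ)) (w : Equiv.Perm ℤ) : Prop :=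
  w ∈ Subgroup.closure J ∧ ∀ u ∈ Subgroup.closure J, wordLen n u ≤ wordLen n w

def nxt (n : ℕ) (l : ℕ) : ℤ := if l = n then -(n : ℤ) else (l : ℤ) + 1

def ff (n : ℕ) (x : ℤ) : ℤ := if 0 < x then x else x + 2 * n + 1

def InX (n : ℕ) (x : ℤ) : Prop := x ≠ 0 ∧ -(n : ℤ) ≤ x ∧ x ≤ n

lemma gen_apply (n l : ℕ) (h1 : 1 ≤ l) (x : ℤ) :
    gen n l x = if x = l then nxt n l else if x = nxt n l then (l : ℤ)
      else if x = -(l : ℤ) then -nxt n l else if x = -nxt n l then -(l : ℤ) else x := by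
  unfold gen nxt
  by_cases h : l = n
  · subst h
    simp only [if_true, Equiv.swap_apply_def]
    split_ifs <;> omega
  · simp only [h, if_false, Equiv.swap_apply_def, Equiv.Perm.mul_apply]
    split_ifs <;> omega

lemma gen_gen (n l : ℕ) (h1 : 1 ≤ l) (x : ℤ) : gen n l (gen n l x) = x := by
  have hn : (l = n ∧ nxt n l = -l) ∨ nxt n l = (l : ℤ) + 1 := by
    unfold nxt; split_ifs <;> omega
  rw [gen_apply n l h1 (gen n l x), gen_apply n l h1 x]
  generalize nxt n l = m at *
  split_ifs <;> omega

lemma gen_mul_self (n l : ℕ) (h1 : 1 ≤ l) : gen n l * gen n l = 1 := by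
  ext x
  simp [gen_gen n l h1]

structure PP (n : ℕ) (w : Equiv.Perm ℤ) : Prop where
  odd : ∀ x, w (-x) = - w x
  fix : ∀ x, ¬ InX n x → w x = x

lemma PP.inX {n : ℕ} {w : Equiv.Perm ℤ} (h : PP n w) {x : ℤ} (hx : InX n x) : InX n (w x) := by
  by_contra hc
  have := h.fix _ hc
  have := w.injective this
  rw [this] at hc
  exact hc hx

lemma PP.one (n : ℕ) : PP n 1 := ⟨fun x => rfl, fun x _ => rfl⟩

lemma PP.mul {n : ℕ} {v w : Equiv.Perm ℤ} (hv : PP n v) (hw : PP n w) : PP n (v * w) := by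
  refine ⟨fun x => ?_, fun x hx => ?_⟩
  · simp [hw.odd, hv.odd]
  · simp [hw.fix x hx, hv.fix x hx]

lemma PP.inv {n : ℕ} {v : Equiv.Perm ℤ} (hv : PP n v) : PP n v⁻¹ := by
  refine ⟨fun x => ?_, fun x hx => ?_⟩
  · rw [Equiv.Perm.inv_eq_iff_eq, hv.odd]; simp
  · rw [Equiv.Perm.inv_eq_iff_eq, hv.fix x hx]

lemma PP.gen (n l : ℕ) (h1 : 1 ≤ l) (hl : l ≤ n) : PP n (gen n l) := by
  refine ⟨fun x => ?_, fun x hx => ?_⟩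
  · simp only [gen_apply n l h1, nxt]
    split_ifs <;> omega
  · simp only [gen_apply n l h1, nxt]
    unfold InX at hx
    split_ifs <;> omega

lemma PP.closure {n : ℕ} {J : Set (Equiv.Perm ℤ)} (hJ : J ⊆ S n) {w : Equiv.Perm ℤ}
    (hw : w ∈ Subgroup.closure J) : PP n w := by
  induction hw using Subgroup.closure_induction with
  | mem x hx =>
    obtain ⟨l, h1, h2, rfl⟩ := hJ hx
    exact PP.gen n l h1 h2
  | one => exact PP.one n
  | mul x y _ _ hx hy => exact hx.mul hy
  | inv x _ hx => exact hx.inv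

lemma ff_inj {n : ℕ} {x y : ℤ} (hx : InX n x) (hy : InX n y) (h : ff n x = ff n y) : x = y := by
  unfold ff InX at *
  split_ifs at h <;> omega

lemma ff_neg {n : ℕ} {x : ℤ} (hx : InX n x) : ff n (-x) = 2 * n + 1 - ff n x := by
  unfold ff InX at *
  split_ifs <;> omega

lemma nxt_inX {n l : ℕ} (h1 : 1 ≤ l) (hl : l ≤ n) : InX n (nxt n l) := by
  unfold nxt InX; split_ifs <;> omega

lemma l_inX {n l : ℕ} (h1 : 1 ≤ l) (hl : l ≤ n) : InX n (l : ℤ) := by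
  unfold InX; omega

lemma neg_inX {n : ℕ} {x : ℤ} (h : InX n x) : InX n (-x) := by
  unfold InX at *; omega

lemma ff_nxt {n l : ℕ} (h1 : 1 ≤ l) (hl : l ≤ n) : ff n (nxt n l) = ff n l + 1 := by
  unfold nxt ff; split_ifs <;> omega

def wt (p : ℤ × ℤ) : ℤ := if p.2 = -p.1 then 2 else 1

lemma wt_pos (p : ℤ × ℤ) : 0 < wt p := by unfold wt; split_ifs <;> norm_num

noncomputable def XX (n : ℕ) : Finset (ℤ × ℤ) :=
  ((Finset.Icc (-(n : ℤ)) n).erase 0) ×ˢ ((Finset.Icc (-(n : ℤ)) n).erase 0)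

lemma mem_XX {n : ℕ} {p : ℤ × ℤ} : p ∈ XX n ↔ InX n p.1 ∧ InX n p.2 := by
  simp [XX, InX]

noncomputable def M (n : ℕ) (w : Equiv.Perm ℤ) : ℤ :=
  ∑ p ∈ XX n, if ff n p.1 < ff n p.2 ∧ ff n (w p.2) < ff n (w p.1) then wt p else 0

lemma M_nonneg (n : ℕ) (w : Equiv.Perm ℤ) : 0 ≤ M n w := by
  apply Finset.sum_nonneg
  intro p _
  have := wt_pos p
  split_ifs <;> omega

lemma M_mul (n l : ℕ) (h1 : 1 ≤ l) (hl : l ≤ n) (w : Equiv.Perm ℤ) :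
    M n (w * gen n l) = ∑ p ∈ XX n,
      if ff n (gen n l p.1) < ff n (gen n l p.2) ∧ ff n (w p.2) < ff n (w p.1)
        then wt p else 0 := by
  have hP := PP.gen n l h1 hl
  unfold M
  refine Finset.sum_nbij' (fun p => (gen n l p.1, gen n l p.2))
    (fun p => (gen n l p.1, gen n l p.2)) ?_ ?_ ?_ ?_ ?_
  · intro p hp
    rw [mem_XX] at *
    exact ⟨hP.inX hp.1, hP.inX hp.2⟩
  · intro p hp
    rw [mem_XX] at *
    exact ⟨hP.inX hp.1, hP.inX hp.2⟩
  · intro p _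
    simp [gen_gen n l h1]
  · intro p _
    simp [gen_gen n l h1]
  · intro p _
    have : wt (gen n l p.1, gen n l p.2) = wt p := by
      simp only [wt, ← hP.odd, (gen n l).injective.eq_iff]
    simp only [gen_gen n l h1, this, Equiv.Perm.mul_apply]
    exact if_congr Iff.rfl rfl rfl

lemma ff_gen (n l : ℕ) (h1 : 1 ≤ l) (hl : l ≤ n) (x : ℤ) (hx : InX n x) :
    ff n (gen n l x) = if ff n x = ff n l then ff n l + 1 else
      if ff n x = ff n l + 1 then ff n l else if ff n x = 2 * n + 1 - ff n l then 2 * n - ff n l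
      else if ff n x = 2 * n - ff n l then 2 * n + 1 - ff n l else ff n x := by
  have hn : (l = n ∧ nxt n l = -l) ∨ (l < n ∧ nxt n l = (l : ℤ) + 1) := by
    unfold nxt; split_ifs <;> omega
  have fl : ff n l = l := by unfold ff; split_ifs <;> omega
  rw [fl, gen_apply n l h1]
  generalize nxt n l = m at *
  clear fl
  obtain ⟨hx0, hx1, hx2⟩ := hx
  rcases hn with ⟨rfl, rfl⟩ | ⟨hlt, rfl⟩ <;> rcases lt_or_gt_of_ne hx0 with h0 | h0
  · have : ff l x = x + 2 * l + 1 := by rw [ff, if_neg (by omega)]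
    rw [this]; unfold ff; split_ifs <;> omega
  · have : ff l x = x := by rw [ff, if_pos (by omega)]
    rw [this]; unfold ff; split_ifs <;> omega
  · have : ff n x = x + 2 * n + 1 := by rw [ff, if_neg (by omega)]
    rw [this]; unfold ff; split_ifs <;> omega
  · have : ff n x = x := by rw [ff, if_pos (by omega)]
    rw [this]; unfold ff; split_ifs <;> omega

set_option maxHeartbeats 2000000 in
lemma key (n l : ℕ) (h1 : 1 ≤ l) (hl : l ≤ n) (a b : ℤ) (ha : InX n a) (hb : InX n b) :
    (ff n (gen n l a) < ff n (gen n l b) ↔ ff n a < ff n b) ∨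
    (a = l ∧ b = nxt n l) ∨ (a = nxt n l ∧ b = l) ∨
    (a = -l ∧ b = -nxt n l) ∨ (a = -nxt n l ∧ b = -l) := by
  have e := fun x hx => ff_gen n l h1 hl x hx
  have hm := nxt_inX h1 hl
  have hll := l_inX h1 hl
  have i1 : ∀ x, InX n x → ff n x = ff n l → x = l := fun x hx h => ff_inj hx hll h
  have i2 : ∀ x, InX n x → ff n x = ff n l + 1 → x = nxt n l := fun x hx h =>
    ff_inj hx hm (by rw [h, ff_nxt h1 hl])
  have i3 : ∀ x, InX n x → ff n x = 2 * n + 1 - ff n l → x = -l := fun x hx h =>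
    ff_inj hx (neg_inX hll) (by rw [h, ff_neg hll])
  have i4 : ∀ x, InX n x → ff n x = 2 * n - ff n l → x = -nxt n l := fun x hx h =>
    ff_inj hx (neg_inX hm) (by rw [h, ff_neg hm, ff_nxt h1 hl]; ring)
  have b0 : ff n l = l := by unfold ff; split_ifs <;> omega
  have arith : ∀ A B L N : ℤ, 1 ≤ L → L ≤ N →
      (((if A = L then L + 1 else if A = L + 1 then L else if A = 2 * N + 1 - L then 2 * N - L
        else if A = 2 * N - L then 2 * N + 1 - L else A) <
        (if B = L then L + 1 else if B = L + 1 then L else if B = 2 * N + 1 - L then 2 * N - L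
        else if B = 2 * N - L then 2 * N + 1 - L else B)) ↔ A < B) ∨
      (A = L ∧ B = L + 1) ∨ (A = L + 1 ∧ B = L) ∨
      (A = 2 * N + 1 - L ∧ B = 2 * N - L) ∨ (A = 2 * N - L ∧ B = 2 * N + 1 - L) := by
    intro A B L N _ _
    split_ifs <;> omega
  rw [e a ha, e b hb]
  rcases arith (ff n a) (ff n b) (ff n l) n (by omega) (by omega) with h | h | h | h | h
  · exact Or.inl h
  · exact Or.inr (Or.inl ⟨i1 a ha h.1, i2 b hb h.2⟩)
  · exact Or.inr (Or.inr (Or.inl ⟨i2 a ha h.1, i1 b hb h.2⟩))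
  · exact Or.inr (Or.inr (Or.inr (Or.inl ⟨i3 a ha h.1, i4 b hb h.2⟩)))
  · exact Or.inr (Or.inr (Or.inr (Or.inr ⟨i4 a ha h.1, i3 b hb h.2⟩)))

lemma M_asc (n l : ℕ) (h1 : 1 ≤ l) (hl : l ≤ n) (w : Equiv.Perm ℤ) (hw : PP n w)
    (h : ff n (w l) < ff n (w (nxt n l))) : M n (w * gen n l) = M n w + 2 := by
  have hm := nxt_inX h1 hl
  have hll := l_inX h1 hl
  have hf := ff_nxt h1 hl
  have g1 : gen n l l = nxt n l := by rw [gen_apply n l h1]; simp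
  have g2 : gen n l (nxt n l) = l := by rw [← g1, gen_gen n l h1]
  have hP := PP.gen n l h1 hl
  set T : Finset (ℤ × ℤ) := {(nxt n l, (l : ℤ)), (-(l : ℤ), -nxt n l)} with hT
  have hsub : T ⊆ XX n := by
    intro p hp
    simp only [hT, Finset.mem_insert, Finset.mem_singleton] at hp
    rw [mem_XX]
    rcases hp with rfl | rfl
    · exact ⟨hm, hll⟩
    · exact ⟨neg_inX hll, neg_inX hm⟩
  have hsum : ∑ p ∈ T, wt p = 2 := by
    by_cases hln : l = n
    · have : nxt n l = -(l : ℤ) := by simp [nxt, hln]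
      rw [hT, this]
      simp [wt]
    · have : nxt n l = (l : ℤ) + 1 := by simp [nxt, hln]
      rw [hT, this, Finset.sum_pair]
      · unfold wt
        rw [if_neg (by dsimp only; omega), if_neg (by dsimp only; omega)]; norm_num
      · intro hc
        rw [Prod.mk.injEq] at hc
        omega
  have hsum2 : ∑ p ∈ XX n, (if p ∈ T then wt p else 0) = 2 := by
    rw [← Finset.sum_filter, Finset.filter_mem_eq_inter, Finset.inter_eq_right.2 hsub, hsum]
  rw [M_mul n l h1 hl, M, ← hsum2, ← Finset.sum_add_distrib]
  apply Finset.sum_congr rfl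
  rintro ⟨a, b⟩ hp
  rw [mem_XX] at hp
  have hwl := ff_neg (hw.inX hll)
  have hwm := ff_neg (hw.inX hm)
  have hfl := ff_neg hll
  have hfm := ff_neg hm
  have k := key n l h1 hl a b hp.1 hp.2
  by_cases hab : (a, b) ∈ T
  · have hab' := hab
    simp only [hT, Finset.mem_insert, Finset.mem_singleton, Prod.mk.injEq] at hab'
    simp only [hab, if_true]
    rcases hab' with ⟨rfl, rfl⟩ | ⟨rfl, rfl⟩
    · simp only [g1, g2]
      rw [if_pos ⟨by omega, h⟩, if_neg (by omega)]; simp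
    · simp only [hP.odd, hw.odd, g1, g2]
      rw [if_pos (by omega), if_neg (by omega)]; simp
  · have hab' := hab
    simp only [hT, Finset.mem_insert, Finset.mem_singleton, Prod.mk.injEq] at hab'
    simp only [hab, if_false, add_zero]
    rcases k with k | ⟨rfl, rfl⟩ | k | k | ⟨rfl, rfl⟩
    · simp only [k]
    · rw [if_neg (by omega), if_neg (by omega)]
    · exact absurd (Or.inl k) hab'
    · exact absurd (Or.inr k) hab'
    · rw [if_neg (by simp only [hw.odd]; omega), if_neg (by simp only [hw.odd]; omega)]

lemma asc_or (n l : ℕ) (h1 : 1 ≤ l) (hl : l ≤ n) (w : Equiv.Perm ℤ) (hw : PP n w) :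
    ff n (w l) < ff n (w (nxt n l)) ∨ ff n (w (nxt n l)) < ff n (w l) := by
  rcases lt_trichotomy (ff n (w l)) (ff n (w (nxt n l))) with h | h | h
  · exact Or.inl h
  · have := w.injective (ff_inj (hw.inX (l_inX h1 hl)) (hw.inX (nxt_inX h1 hl)) h)
    have h3 := ff_nxt h1 hl
    rw [← this] at h3
    omega
  · exact Or.inr h

lemma M_desc (n l : ℕ) (h1 : 1 ≤ l) (hl : l ≤ n) (w : Equiv.Perm ℤ) (hw : PP n w)
    (h : ff n (w (nxt n l)) < ff n (w l)) : M n (w * gen n l) = M n w - 2 := by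
  have g1 : gen n l l = nxt n l := by rw [gen_apply n l h1]; simp
  have g2 : gen n l (nxt n l) = l := by rw [← g1, gen_gen n l h1]
  have := M_asc n l h1 hl (w * gen n l) (hw.mul (PP.gen n l h1 hl)) (by simpa [g1, g2] using h)
  rw [mul_assoc, gen_mul_self n l h1, mul_one] at this
  omega

lemma M_one (n : ℕ) : M n 1 = 0 := by
  apply Finset.sum_eq_zero
  intro p _
  rw [if_neg]
  simp only [Equiv.Perm.one_apply]
  omega

lemma M_list (n : ℕ) (L : List (Equiv.Perm ℤ)) (hL : ∀ x ∈ L, x ∈ S n) :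
    PP n L.prod ∧ M n L.prod ≤ 2 * L.length := by
  induction L using List.reverseRecOn with
  | nil => simp [M_one, PP.one]
  | append_singleton L s ih =>
    have ih := ih (fun x hx => hL x (by simp [hx]))
    obtain ⟨l, h1, h2, rfl⟩ := hL s (by simp)
    rw [List.prod_append, List.prod_singleton]
    refine ⟨ih.1.mul (PP.gen n l h1 h2), ?_⟩
    have := ih.2
    simp only [List.length_append, List.length_singleton]
    push_cast
    rcases asc_or n l h1 h2 _ ih.1 with h | h
    · rw [M_asc n l h1 h2 _ ih.1 h]; omega
    · rw [M_desc n l h1 h2 _ ih.1 h]; omega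

lemma mono_rigid (g : ℤ → ℤ) (p q c : ℤ) (hg : ∀ l, p ≤ l → l < q → g l < g (l + 1))
    (h1 : c ≤ g p) (h2 : g q ≤ c + q - p) : ∀ l, p ≤ l → l ≤ q → g l = l - p + c := by
  have up : ∀ l, p ≤ l → l ≤ q → c + (l - p) ≤ g l := by
    intro l hl
    induction l, hl using Int.le_induction with
    | base => intro _; omega
    | succ m hm ih => intro h; have := ih (by omega); have := hg m hm (by omega); omega
  have dn : ∀ l, l ≤ q → p ≤ l → g l ≤ c + (l - p) := by
    intro l hl
    induction l, hl using Int.le_induction_down with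
    | base => intro _; omega
    | pred m hm ih =>
      intro h
      have := ih (by omega)
      have := hg (m - 1) h (by omega)
      rw [sub_add_cancel] at this
      omega
  intro l ha hb
  have := up l ha hb
  have := dn l hb ha
  omega

lemma anti_rigid (g : ℤ → ℤ) (p q c : ℤ) (hg : ∀ l, p ≤ l → l < q → g (l + 1) < g l)
    (h1 : c ≤ g q) (h2 : g p ≤ c + q - p) : ∀ l, p ≤ l → l ≤ q → g l = q - l + c := by
  intro l ha hb
  have := mono_rigid (fun x => - g x) p q (-(c + q - p))
    (fun l h h' => by have := hg l h h'; omega) (by omega)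
    (by omega) l ha hb
  try simp only at this
  omega

lemma ff_range {n : ℕ} {x : ℤ} (hx : InX n x) : 1 ≤ ff n x ∧ ff n x ≤ 2 * n := by
  unfold ff InX at *; split_ifs <;> omega

lemma eq_one (n : ℕ) (w : Equiv.Perm ℤ) (hw : PP n w)
    (h : ∀ l : ℕ, 1 ≤ l → l ≤ n → ff n (w l) < ff n (w (nxt n l))) : w = 1 := by
  have pos : ∀ x : ℤ, 1 ≤ x → x ≤ n → w x = x := by
    intro x hx1 hx2
    have hn1 : 1 ≤ n := by omega
    have hnn := h n hn1 le_rfl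
    have nn : nxt n n = -(n : ℤ) := by simp [nxt]
    rw [nn, hw.odd, ff_neg (hw.inX (l_inX hn1 le_rfl))] at hnn
    have h1' : InX n 1 := by unfold InX; omega
    have := mono_rigid (fun x => ff n (w x)) 1 n 1 (by
      intro l hl hl'
      lift l to ℕ using by omega
      have := h l (by omega) (by omega)
      have e : nxt n l = (l : ℤ) + 1 := by simp only [nxt]; rw [if_neg]; omega
      rwa [e] at this) (ff_range (hw.inX h1')).1 (by omega) x hx1 hx2
    have hxX : InX n x := by unfold InX; omega
    apply ff_inj (hw.inX hxX) hxX
    try simp only at this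
    rw [this, ff, if_pos (by omega)]; ring
  ext x
  rw [Equiv.Perm.one_apply]
  by_cases hx : InX n x
  · rcases lt_or_ge 0 x with h0 | h0
    · exact pos x h0 hx.2.2
    · have := pos (-x) (by unfold InX at hx; omega) (by unfold InX at hx; omega)
      rw [hw.odd] at this
      omega
  · exact hw.fix x hx

lemma exists_list (n : ℕ) : ∀ (m : ℕ) (w : Equiv.Perm ℤ), PP n w → M n w ≤ m →
    ∃ L : List (Equiv.Perm ℤ), (∀ x ∈ L, x ∈ S n) ∧ L.prod = w ∧ 2 * (L.length : ℤ) ≤ M n w := by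
  intro m
  induction m with
  | zero =>
    intro w hw hM
    have : w = 1 := by
      apply eq_one n w hw
      intro l h1 h2
      rcases asc_or n l h1 h2 w hw with h | h
      · exact h
      · have := M_desc n l h1 h2 w hw h
        have := M_nonneg n (w * gen n l)
        push_cast at hM
        omega
    subst this
    exact ⟨[], by simp, rfl, by simp [M_one]⟩
  | succ m ih =>
    intro w hw hM
    by_cases hc : ∀ l : ℕ, 1 ≤ l → l ≤ n → ff n (w l) < ff n (w (nxt n l))
    · have := eq_one n w hw hc
      subst this
      exact ⟨[], by simp, rfl, by simp [M_one]⟩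
    · push Not at hc
      obtain ⟨l, h1, h2, h3⟩ := hc
      have h := (asc_or n l h1 h2 w hw).resolve_left (by omega)
      have hd := M_desc n l h1 h2 w hw h
      obtain ⟨L, hL, hp, hlen⟩ := ih (w * gen n l) (hw.mul (PP.gen n l h1 h2))
        (by push_cast at hM; omega)
      refine ⟨L ++ [gen n l], ?_, ?_, ?_⟩
      · intro x hx
        rw [List.mem_append, List.mem_singleton] at hx
        rcases hx with hx | rfl
        · exact hL x hx
        · exact ⟨l, h1, h2, rfl⟩
      · rw [List.prod_append, hp, List.prod_singleton, mul_assoc, gen_mul_self n l h1, mul_one]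
      · simp only [List.length_append, List.length_singleton]
        push_cast
        omega

lemma wordLen_eq (n : ℕ) (w : Equiv.Perm ℤ) (hw : PP n w) : 2 * (wordLen n w : ℤ) = M n w := by
  obtain ⟨L, hL, hp, hlen⟩ := exists_list n (M n w).toNat w hw (by omega)
  have hmem : L.length ∈ {m | ∃ L : List (Equiv.Perm ℤ),
      L.length = m ∧ (∀ x ∈ L, x ∈ S n) ∧ L.prod = w} := ⟨L, rfl, hL, hp⟩
  have h1 : wordLen n w ≤ L.length := Nat.sInf_le hmem
  obtain ⟨L', hl', hL', hp'⟩ := Nat.sInf_mem ⟨_, hmem⟩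
  have h2 := (M_list n L' hL').2
  rw [hp', hl'] at h2
  change _ ≤ 2 * ((wordLen n w : ℕ) : ℤ) at h2
  omega

lemma desc_of_longest {n : ℕ} {J : Set (Equiv.Perm ℤ)} (hJ : J ⊆ S n) {w : Equiv.Perm ℤ}
    (hw : IsLongestOf n J w) (l : ℕ) (h1 : 1 ≤ l) (hl : l ≤ n) (hlJ : gen n l ∈ J) :
    ff n (w (nxt n l)) < ff n (w l) := by
  have hP := PP.closure hJ hw.1
  refine (asc_or n l h1 hl w hP).resolve_left (fun h => ?_)
  have a := M_asc n l h1 hl w hP h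
  have b := hw.2 _ (Subgroup.mul_mem _ hw.1 (Subgroup.subset_closure hlJ))
  have c := wordLen_eq n w hP
  have d := wordLen_eq n _ (hP.mul (PP.gen n l h1 hl))
  omega

lemma gen_ne (n l j : ℕ) (h1 : 1 ≤ l) (hl : l ≤ n) (hj : 1 ≤ j) (hjn : j ≤ n) (h : l ≠ j) :
    gen n l ≠ gen n j := by
  have main : ∀ a b : ℕ, 1 ≤ a → a < b → b ≤ n → gen n a ≠ gen n b := by
    intro a b ha hab hb he
    have := congrArg (fun f => f (a : ℤ)) he
    simp only [gen_apply n a ha, gen_apply n b (by omega), nxt] at this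
    split_ifs at this <;> omega
  rcases lt_or_gt_of_ne h with h | h
  · exact main l j h1 h hjn
  · exact (main j l hj h hl).symm

lemma pres (n j : ℕ) (J : Set (Equiv.Perm ℤ)) (hJ : J ⊆ S n) (hjn : j ≤ n) (hj : gen n j ∉ J)
    (w : Equiv.Perm ℤ)
    (hw : w ∈ Subgroup.closure J) : ∀ x : ℤ, (1 ≤ x ∧ x ≤ j) ↔ (1 ≤ w x ∧ w x ≤ j) := by
  induction hw using Subgroup.closure_induction with
  | mem x hx =>
    obtain ⟨l, h1, h2, rfl⟩ := hJ hx
    have : l ≠ j := by rintro rfl; exact hj hx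
    intro x
    simp only [gen_apply n l h1, nxt]
    split_ifs <;> omega
  | one => intro x; rfl
  | mul x y _ _ hx hy => intro z; rw [hy z, hx (y z)]; rfl
  | inv x _ hx => intro z; rw [hx (x⁻¹ z)]; simp

lemma block (n p q : ℕ) (w : Equiv.Perm ℤ) (hp : 1 ≤ p) (hq : q ≤ n)
    (hd : ∀ l : ℕ, p ≤ l → l < q → ff n (w (nxt n l)) < ff n (w l))
    (hpr : ∀ x : ℤ, p ≤ x → x ≤ q → p ≤ w x ∧ w x ≤ q) :
    ∀ x : ℤ, p ≤ x → x ≤ q → w x = p + q - x := by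
  intro x hx hx'
  have hffw : ∀ x : ℤ, p ≤ x → x ≤ q → ff n (w x) = w x := by
    intro x a b
    have := hpr x a b
    rw [ff, if_pos (by omega)]
  have := anti_rigid w p q p (by
    intro l a b
    lift l to ℕ using by omega
    have := hd l (by omega) (by omega)
    have e : nxt n l = (l : ℤ) + 1 := by simp only [nxt]; rw [if_neg]; omega
    rw [e, hffw _ (by omega) (by omega), hffw _ (by omega) (by omega)] at this
    exact this) (hpr q (by omega) (by omega)).1
    (by have := (hpr p (by omega) (by omega)).2; omega) x hx hx'
  omega

lemma tail (n j : ℕ) (w : Equiv.Perm ℤ) (hw : PP n w) (hj : j ≤ n)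
    (hd : ∀ l : ℕ, j < l → l ≤ n → ff n (w (nxt n l)) < ff n (w l))
    (hpr : ∀ x : ℤ, (1 ≤ x ∧ x ≤ j) ↔ (1 ≤ w x ∧ w x ≤ j)) :
    ∀ x : ℤ, j < x → x ≤ n → w x = - x := by
  intro x hx hx'
  have hnn := hd n (by omega) le_rfl
  have nn : nxt n n = -(n : ℤ) := by simp [nxt]
  rw [nn, hw.odd, ff_neg (hw.inX (l_inX (by omega) le_rfl))] at hnn
  have h1X : InX n ((j : ℤ) + 1) := by unfold InX; omega
  have hb : ff n (w ((j : ℤ) + 1)) ≤ 2 * n - j := by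
    have a1 := hpr (-((j : ℤ) + 1))
    rw [hw.odd] at a1
    have := hw.inX h1X
    unfold ff
    unfold InX at this
    split_ifs <;> omega
  have := anti_rigid (fun x => ff n (w x)) (j + 1) n (n + 1) (by
    intro l a b
    lift l to ℕ using by omega
    have := hd l (by omega) (by omega)
    have e : nxt n l = (l : ℤ) + 1 := by simp only [nxt]; rw [if_neg]; omega
    rwa [e] at this) (by omega) (by omega) x hx hx'
  have hxX : InX n x := by unfold InX; omega
  apply ff_inj (hw.inX hxX) (neg_inX hxX)
  try simp only at this
  rw [this, ff, if_neg (by omega)]; ring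

theorem stmt_17 (n i : ℕ) (hi : 1 ≤ i) (h2i : 2 * i ≤ n)
    (w0 w1 w' : Equiv.Perm ℤ)
    (hw0 : IsLongestOf n (S n \ {gen n i}) w0)
    (hw1 : IsLongestOf n (S n \ {gen n (2 * i)}) w1)
    (hw' : IsLongestOf n (S n \ {gen n i, gen n (2 * i)}) w') :
    ∀ l : ℤ,
      (1 ≤ l → l ≤ (i : ℤ) → (w' * w1 * w' * w0) l = l + i) ∧
      ((i : ℤ) + 1 ≤ l → l ≤ 2 * (i : ℤ) → (w' * w1 * w' * w0) l = -(2 * (i : ℤ) + 1 - l)) ∧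
      (2 * (i : ℤ) + 1 ≤ l → l ≤ (n : ℤ) → (w' * w1 * w' * w0) l = l) := by
  have J0 : S n \ {gen n i} ⊆ S n := Set.sdiff_subset
  have J1 : S n \ {gen n (2 * i)} ⊆ S n := Set.sdiff_subset
  have J' : S n \ {gen n i, gen n (2 * i)} ⊆ S n := Set.sdiff_subset
  have P0 := PP.closure J0 hw0.1
  have P1 := PP.closure J1 hw1.1
  have P' := PP.closure J' hw'.1
  have d0 : ∀ l : ℕ, 1 ≤ l → l ≤ n → l ≠ i → ff n (w0 (nxt n l)) < ff n (w0 l) := by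
    intro l a b c
    exact desc_of_longest J0 hw0 l a b ⟨⟨l, a, b, rfl⟩, gen_ne n l i a b hi (by omega) c⟩
  have d1 : ∀ l : ℕ, 1 ≤ l → l ≤ n → l ≠ 2 * i → ff n (w1 (nxt n l)) < ff n (w1 l) := by
    intro l a b c
    exact desc_of_longest J1 hw1 l a b
      ⟨⟨l, a, b, rfl⟩, gen_ne n l (2 * i) a b (by omega) (by omega) c⟩
  have d' : ∀ l : ℕ, 1 ≤ l → l ≤ n → l ≠ i → l ≠ 2 * i →
      ff n (w' (nxt n l)) < ff n (w' l) := by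
    intro l a b c d
    refine desc_of_longest J' hw' l a b ⟨⟨l, a, b, rfl⟩, ?_⟩
    rintro (h | h)
    · exact gen_ne n l i a b hi (by omega) c h
    · exact gen_ne n l (2 * i) a b (by omega) (by omega) d h
  have r0 := pres n i _ J0 (by omega) (by simp) w0 hw0.1
  have r1 := pres n (2 * i) _ J1 (by omega) (by simp) w1 hw1.1
  have r' := pres n i _ J' (by omega) (by simp) w' hw'.1
  have r'' := pres n (2 * i) _ J' (by omega) (by simp) w' hw'.1
  have A0 := block n 1 i w0 le_rfl (by omega) (fun l a b => d0 l a (by omega) (by omega))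
    (fun x a b => by have := (r0 x).1 (by omega); omega)
  have B0 := tail n i w0 P0 (by omega) (fun l a b => d0 l (by omega) b (by omega)) r0
  have A1 := block n 1 (2 * i) w1 le_rfl (by omega) (fun l a b => d1 l a (by omega) (by omega))
    (fun x a b => by have := (r1 x).1 (by omega); omega)
  have B1 := tail n (2 * i) w1 P1 (by omega) (fun l a b => d1 l (by omega) b (by omega)) r1
  have A' := block n 1 i w' le_rfl (by omega)
    (fun l a b => d' l a (by omega) (by omega) (by omega))
    (fun x a b => by have := (r' x).1 (by omega); omega)
  have C' := block n (i + 1) (2 * i) w' (by omega) (by omega)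
    (fun l a b => d' l (by omega) (by omega) (by omega) (by omega))
    (fun x a b => by have := r' x; have := r'' x; omega)
  have B' := tail n (2 * i) w' P' (by omega)
    (fun l a b => d' l (by omega) b (by omega) (by omega)) r''
  push_cast at A0 A1 A' B0 B1 B' C'
  intro l
  simp only [Equiv.Perm.mul_apply]
  refine ⟨fun a b => ?_, fun a b => ?_, fun a b => ?_⟩
  · rw [A0 l (by omega) (by omega), A' (1 + i - l) (by omega) (by omega),
      A1 (1 + i - (1 + i - l)) (by omega) (by omega), C' _ (by omega) (by omega)]
    ring
  · rw [B0 l (by omega) (by omega), P'.odd, C' l (by omega) (by omega), P1.odd,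
      A1 (i + 1 + 2 * i - l) (by omega) (by omega), P'.odd, A' _ (by omega) (by omega)]
    ring
  · rw [B0 l (by omega) (by omega), P'.odd, B' l (by omega) (by omega), neg_neg,
      B1 l (by omega) (by omega), P'.odd, B' l (by omega) (by omega), neg_neg]

end Stmt17
end

section
/- Let i, j ≥ 1 with i + j ≤ n, and work in the hyperoctahedral group W(C_n). Then w_{S∖{s_{i+j}}} · s_i · w_{S∖{s_{i+j}}} = s_j and w_{S∖{s_j}} · s_{i+j} · w_{S∖{s_j}} = s_{i+j}. Consequently, the orbit of the pair (s_i, s_{i+j}) under the next-type map next(r,s) = (s, w_{S∖{s}} r w_{S∖{s}}) is {(s_i, s_{i+j}), (s_{i+j}, s_j), (s_j, s_{i+j}), (s_{i+j}, s_i)}, which has cardinality 4 if i ≠ j and cardinality 2 if i = j. -/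
/-!
STATEMENT 18. In the hyperoctahedral group W(C_n) of signed permutations of
{±1, …, ±n} (generators s_l = (l, l+1)(−l, −(l+1)) for 1 ≤ l < n, s_n = (n, −n)), let
i, j ≥ 1 with i + j ≤ n. Then w_{S∖{s_{i+j}}} · s_i · w_{S∖{s_{i+j}}} = s_j and
w_{S∖{s_j}} · s_{i+j} · w_{S∖{s_j}} = s_{i+j}. Consequently, the orbit of the pair
(s_i, s_{i+j}) under the next-type map next(r,s) = (s, w_{S∖{s}} r w_{S∖{s}}) is
{(s_i, s_{i+j}), (s_{i+j}, s_j), (s_j, s_{i+j}), (s_{i+j}, s_i)}, of cardinality 4 if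
i ≠ j and 2 if i = j.
-/

namespace Stmt18

/-- The Coxeter generator `s_l` of the group of signed permutations of `{±1, …, ±n}`:
`s_l = (l, l+1)(−l, −(l+1))` for `1 ≤ l < n`, and `s_n = (n, −n)`. -/
def gen (n : ℕ) (l : ℕ) : Equiv.Perm ℤ :=
  if l = n then Equiv.swap (n : ℤ) (-(n : ℤ))
  else Equiv.swap (l : ℤ) ((l : ℤ) + 1) * Equiv.swap (-(l : ℤ)) (-((l : ℤ) + 1))

/-- The set of Coxeter generators of `W(C_n)`. -/
def S (n : ℕ) : Set (Equiv.Perm ℤ) := {σ | ∃ l : ℕ, 1 ≤ l ∧ l ≤ n ∧ σ = gen n l}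

/-- Word length with respect to the generating set. -/
noncomputable def wordLen (n : ℕ) (w : Equiv.Perm ℤ) : ℕ :=
  sInf {m | ∃ L : List (Equiv.Perm ℤ), L.length = m ∧ (∀ x ∈ L, x ∈ S n) ∧ L.prod = w}

/-- `w` is the longest element of the standard parabolic subgroup `W_J = ⟨J⟩`. -/
def IsLongestOf (n : ℕ) (J : Set (Equiv.Perm ℤ)) (w : Equiv.Perm ℤ) : Prop :=
  w ∈ Subgroup.closure J ∧ ∀ u ∈ Subgroup.closure J, wordLen n u ≤ wordLen n w

lemma gen_apply (n l : ℕ) (hl : 1 ≤ l) (x : ℤ) : gen n l x =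
    if l = n then (if x = n then -(n:ℤ) else if x = -(n:ℤ) then (n:ℤ) else x)
    else if x = l then (l:ℤ)+1 else if x = (l:ℤ)+1 then (l:ℤ) else
      if x = -(l:ℤ) then -((l:ℤ)+1) else if x = -((l:ℤ)+1) then -(l:ℤ) else x := by
  unfold gen
  split_ifs <;> simp only [Equiv.Perm.mul_apply, Equiv.swap_apply_def] <;> split_ifs <;> omega

lemma gen_inj (n l k : ℕ) (hl : 1 ≤ l) (hk : 1 ≤ k) (hln : l ≤ n) (hkn : k ≤ n)
    (h : gen n l = gen n k) : l = k := by
  have h1 := congrArg (fun f : Equiv.Perm ℤ => f (l:ℤ)) h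
  have h2 := congrArg (fun f : Equiv.Perm ℤ => f (k:ℤ)) h
  simp only [gen_apply n l hl, gen_apply n k hk] at h1 h2
  split_ifs at h1 h2 <;> omega

lemma gen_invol (n l : ℕ) (hl : 1 ≤ l) (x : ℤ) : gen n l (gen n l x) = x := by
  simp only [gen_apply n l hl]
  split_ifs <;> omega

lemma gen_mul_self (n l : ℕ) (hl : 1 ≤ l) : gen n l * gen n l = 1 := by
  ext x; simp [gen_invol n l hl x]

def Sgn (n : ℕ) (w : Equiv.Perm ℤ) : Prop :=
  (∀ x, w (-x) = - w x) ∧ ∀ x : ℤ, ((n:ℤ) < x ∨ x < -(n:ℤ)) → w x = x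

lemma Sgn.one (n : ℕ) : Sgn n 1 := by constructor <;> simp

lemma Sgn.mul {n : ℕ} {u v : Equiv.Perm ℤ} (hu : Sgn n u) (hv : Sgn n v) : Sgn n (u * v) := by
  refine ⟨fun x => ?_, fun x hx => ?_⟩
  · simp [hv.1, hu.1]
  · simp [hv.2 x hx, hu.2 x hx]

lemma Sgn.inv {n : ℕ} {u : Equiv.Perm ℤ} (hu : Sgn n u) : Sgn n u⁻¹ := by
  refine ⟨fun x => ?_, fun x hx => ?_⟩
  · rw [Equiv.Perm.inv_eq_iff_eq, hu.1]; simp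
  · rw [Equiv.Perm.inv_eq_iff_eq, hu.2 x hx]

lemma Sgn.gen {n l : ℕ} (hl : 1 ≤ l) (hln : l ≤ n) : Sgn n (gen n l) := by
  refine ⟨fun x => ?_, fun x hx => ?_⟩ <;> simp only [gen_apply n l hl] <;> split_ifs <;> omega

lemma Sgn.zero {n : ℕ} {u : Equiv.Perm ℤ} (hu : Sgn n u) : u 0 = 0 := by
  have := hu.1 0
  simp at this
  omega

lemma Sgn.range {n : ℕ} {u : Equiv.Perm ℤ} (hu : Sgn n u) (x : ℤ) (h1 : -(n:ℤ) ≤ x)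
    (h2 : x ≤ n) : -(n:ℤ) ≤ u x ∧ u x ≤ n := by
  by_contra h
  have h3 := hu.2 (u x) (by omega)
  have := u.injective h3
  omega

lemma Sgn.ext {n : ℕ} {u : Equiv.Perm ℤ} (hu : Sgn n u) (h : ∀ l : ℕ, 1 ≤ l → l ≤ n → u l = l) :
    u = 1 := by
  ext x
  simp only [Equiv.Perm.one_apply]
  by_cases hx : (n:ℤ) < x ∨ x < -(n:ℤ)
  · exact hu.2 x hx
  · rcases lt_trichotomy x 0 with h0 | h0 | h0
    · have := h x.natAbs (by omega) (by omega)
      have h2 := hu.1 x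
      rw [show ((x.natAbs : ℕ) : ℤ) = -x by omega] at this
      omega
    · rw [h0]; exact hu.zero
    · have := h x.natAbs (by omega) (by omega)
      rwa [show ((x.natAbs : ℕ) : ℤ) = x by omega] at this

/-- key giving the order `1 > 2 > ... > n > 0 > -n > ... > -1`. -/
def key (n : ℕ) (x : ℤ) : ℤ := if 0 < x then n + 1 - x else if x < 0 then -(n+1) - x else 0

lemma key_neg (n : ℕ) (x : ℤ) : key n (-x) = - key n x := by
  unfold key; split_ifs <;> omega

lemma key_inj (n : ℕ) {x y : ℤ} (hx : -(n:ℤ) ≤ x ∧ x ≤ n) (hy : -(n:ℤ) ≤ y ∧ y ≤ n)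
    (h : key n x = key n y) : x = y := by
  unfold key at h; split_ifs at h <;> omega

/-- second entry of the simple pair -/
def bet (n l : ℕ) : ℤ := if l = n then 0 else l + 1

noncomputable def A (n : ℕ) (w : Equiv.Perm ℤ) : Finset (ℤ × ℤ) :=
  (Finset.Icc (-(n:ℤ)) n ×ˢ Finset.Icc (-(n:ℤ)) n).filter
    (fun p => p.1 + p.2 ≠ 0 ∧ key n p.2 < key n p.1 ∧ key n (w p.1) < key n (w p.2))

lemma mem_A (n : ℕ) (w : Equiv.Perm ℤ) (x y : ℤ) : (x, y) ∈ A n w ↔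
    ((-(n:ℤ) ≤ x ∧ x ≤ n) ∧ (-(n:ℤ) ≤ y ∧ y ≤ n)) ∧ x + y ≠ 0 ∧ key n y < key n x ∧
      key n (w x) < key n (w y) := by
  simp [A]

lemma key_spec (n : ℕ) (x : ℤ) : (0 < x ∧ key n x = n + 1 - x) ∨
    (x < 0 ∧ key n x = -(n+1) - x) ∨ (x = 0 ∧ key n x = 0) := by
  unfold key; split_ifs <;> omega

set_option maxHeartbeats 1000000 in
lemma gen_key (n l : ℕ) (hl : 1 ≤ l) (hln : l ≤ n) (x y : ℤ) (hx : -(n:ℤ) ≤ x ∧ x ≤ n)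
    (hy : -(n:ℤ) ≤ y ∧ y ≤ n) (h0 : x + y ≠ 0) (h : key n y < key n x) :
    key n (gen n l y) < key n (gen n l x) ∨ (x = l ∧ y = bet n l) ∨ (x = - bet n l ∧ y = -l) := by
  have hx' := gen_apply n l hl x
  have hy' := gen_apply n l hl y
  generalize gen n l x = x' at *
  generalize gen n l y = y' at *
  have k1 := key_spec n x
  have k2 := key_spec n y
  have k3 := key_spec n x'
  have k4 := key_spec n y'
  generalize key n x = a at *
  generalize key n y = b at *
  generalize key n x' = c at *
  generalize key n y' = d at *
  unfold bet
  by_cases hn : l = n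
  · subst hn
    simp only [if_true] at hx' hy' ⊢
    split_ifs at hx' <;> split_ifs at hy' <;> omega
  · simp only [hn, if_false] at hx' hy' ⊢
    split_ifs at hx' <;> split_ifs at hy' <;> omega

lemma gen_flip {n l : ℕ} (hl : 1 ≤ l) (hln : l ≤ n) {w : Equiv.Perm ℤ} (hw : Sgn n w) 
    (h : key n (w (bet n l)) < key n (w l)) :
    key n (w (gen n l l)) < key n (w (gen n l (bet n l))) := by
  rw [gen_apply n l hl, gen_apply n l hl]
  by_cases hn : l = n
  · subst hn
    have : (0:ℤ) ≠ l := by omega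
    have : (0:ℤ) ≠ -l := by omega
    simp_all [bet, hw.zero, hw.1, key_neg]
    simp [key] at h ⊢
    omega
  · simpa [bet, hn] using h

lemma step {n l : ℕ} (hl : 1 ≤ l) (hln : l ≤ n) {w : Equiv.Perm ℤ} (hw : Sgn n w)
    (h : key n (w (bet n l)) < key n (w l)) : (A n (w * gen n l)).card = (A n w).card + 2 := by
  have hs := Sgn.gen hl hln
  have hb : -(n:ℤ) ≤ bet n l ∧ bet n l ≤ n := by unfold bet; split_ifs <;> omega
  have hb0 : (l:ℤ) + bet n l ≠ 0 := by unfold bet; split_ifs <;> omega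
  have hbl : (l:ℤ) ≠ - bet n l := by unfold bet; split_ifs <;> omega
  have hbk : key n (bet n l) < key n l := by unfold bet key; split_ifs <;> omega
  have hflip := gen_flip hl hln hw h
  have hflip1 := gen_flip hl hln (Sgn.one n) (by simpa using hbk)
  simp only [Equiv.Perm.one_apply] at hflip1
  have key1 : A n (w * gen n l) = ((A n w).image (fun p => (gen n l p.1, gen n l p.2))) ∪
      {((l:ℤ), bet n l), (- bet n l, -(l:ℤ))} := by
    ext ⟨x, y⟩
    have him : (x, y) ∈ (A n w).image (fun p => (gen n l p.1, gen n l p.2)) ↔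
        (gen n l x, gen n l y) ∈ A n w := by
      simp only [Finset.mem_image, Prod.exists, Prod.mk.injEq]
      constructor
      · rintro ⟨a, b, hab, rfl, rfl⟩
        simpa [gen_invol n l hl] using hab
      · intro hab
        exact ⟨_, _, hab, gen_invol n l hl x, gen_invol n l hl y⟩
    rw [Finset.mem_union, him, mem_A, mem_A]
    simp only [Finset.mem_insert, Finset.mem_singleton, Prod.mk.injEq, Equiv.Perm.mul_apply]
    constructor
    · rintro ⟨⟨hx, hy⟩, h0, hk, hk2⟩
      rcases gen_key n l hl hln x y hx hy h0 hk with h1 | h1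
      · refine Or.inl ⟨⟨hs.range x hx.1 hx.2, hs.range y hy.1 hy.2⟩, fun h3 => h0 ?_, h1, hk2⟩
        have h4 : gen n l x = gen n l (-y) := by rw [hs.1]; omega
        have := (gen n l).injective h4
        omega
      · exact Or.inr h1
    · rintro (⟨⟨hx, hy⟩, h0, hk, hk2⟩ | ⟨rfl, rfl⟩ | ⟨rfl, rfl⟩)
      · have hx' := hs.range _ hx.1 hx.2
        have hy' := hs.range _ hy.1 hy.2
        have h5 := gen_key n l hl hln _ _ hx hy h0 hk
        rw [gen_invol n l hl] at hx' hy'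
        rw [gen_invol n l hl, gen_invol n l hl] at h5
        refine ⟨⟨hx', hy'⟩, fun h3 => h0 ?_, ?_, hk2⟩
        · rw [show x = -y by omega, hs.1]; omega
        · rcases h5 with h5 | ⟨h5, h6⟩ | ⟨h5, h6⟩
          · exact h5
          · rw [h5, h6] at hk2; omega
          · rw [h5, h6, hw.1, hw.1, key_neg, key_neg] at hk2; omega
      · exact ⟨⟨by omega, hb⟩, hb0, hbk, hflip⟩
      · refine ⟨⟨by omega, by omega⟩, by omega, ?_, ?_⟩
        · rw [key_neg, key_neg]; omega
        · rw [hs.1, hs.1, hw.1, hw.1, key_neg, key_neg]; omega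
  have hdisj : Disjoint ((A n w).image (fun p => (gen n l p.1, gen n l p.2)))
      {((l:ℤ), bet n l), (- bet n l, -(l:ℤ))} := by
    rw [Finset.disjoint_left]
    rintro ⟨x, y⟩ hm hm2
    simp only [Finset.mem_image, Prod.exists, Prod.mk.injEq] at hm
    obtain ⟨a, b, hab, rfl, rfl⟩ := hm
    rw [mem_A] at hab
    simp only [Finset.mem_insert, Finset.mem_singleton, Prod.mk.injEq] at hm2
    have h7 := hab.2.2.1
    rcases hm2 with ⟨h5, h6⟩ | ⟨h5, h6⟩
    · rw [← h5, ← h6, gen_invol n l hl, gen_invol n l hl] at hflip1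
      omega
    · have h8 : gen n l (-b) = l := by rw [hs.1, h6]; omega
      have h9 : gen n l (-a) = bet n l := by rw [hs.1, h5]; omega
      rw [← h8, ← h9, gen_invol n l hl, gen_invol n l hl, key_neg, key_neg] at hflip1
      omega
  rw [key1, Finset.card_union_of_disjoint hdisj, Finset.card_image_of_injective,
    Finset.card_pair]
  · simp [hbl]
  · rintro ⟨a, b⟩ ⟨c, d⟩ h
    simp at h
    simp [h]

lemma dich {n l : ℕ} (hl : 1 ≤ l) (hln : l ≤ n) {w : Equiv.Perm ℤ} (hw : Sgn n w) :
    key n (w (bet n l)) < key n (w l) ∨ key n (w l) < key n (w (bet n l)) := by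
  apply lt_or_gt_of_ne
  intro h
  have hb : -(n:ℤ) ≤ bet n l ∧ bet n l ≤ n := by unfold bet; split_ifs <;> omega
  have := key_inj n (hw.range _ hb.1 hb.2) (hw.range _ (by omega) (by omega)) h
  have := w.injective this
  unfold bet at this
  split_ifs at this <;> omega

lemma step' {n l : ℕ} (hl : 1 ≤ l) (hln : l ≤ n) {w : Equiv.Perm ℤ} (hw : Sgn n w)
    (h : key n (w l) < key n (w (bet n l))) : (A n (w * gen n l)).card + 2 = (A n w).card := by
  have hs := Sgn.gen hl hln
  have hws := hw.mul hs
  have hself : w * gen n l * gen n l = w := by rw [mul_assoc, gen_mul_self n l hl, mul_one]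
  rcases dich hl hln hws with h1 | h1
  · have := step hl hln hws h1
    rw [hself] at this
    exact this.symm
  · exfalso
    rw [Equiv.Perm.mul_apply, Equiv.Perm.mul_apply] at h1
    rw [gen_apply n l hl, gen_apply n l hl] at h1
    by_cases hn : l = n
    · subst hn
      have : (0:ℤ) ≠ l := by omega
      have : (0:ℤ) ≠ -l := by omega
      simp_all [bet, hw.zero, hw.1, key_neg]
      simp [key] at h h1
      omega
    · simp [bet, hn] at h h1
      omega

lemma rigid (f : ℕ → ℤ) (a b : ℕ) (C : ℤ) (hstep : ∀ l, a ≤ l → l < b → f l < f (l+1))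
    (ha : C ≤ f a) (hb : f b ≤ C + (b - a)) : ∀ l, a ≤ l → l ≤ b → f l = C + (l - a) := by
  have h1 : ∀ l, a ≤ l → l ≤ b → C + (l - a) ≤ f l := by
    intro l hl
    induction l, hl using Nat.le_induction with
    | base => intro _; simpa using ha
    | succ m hm ih =>
      intro hmb
      have := ih (by omega)
      have := hstep m hm (by omega)
      push_cast
      omega
  have h2 : ∀ d l : ℕ, a ≤ l → l + d = b → f l ≤ C + (l - a) := by
    intro d
    induction d with
    | zero => intro l _ h; simp at h; subst h; exact hb
    | succ d ih =>
      intro l hl h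
      have := ih (l+1) (by omega) (by omega)
      have := hstep l hl (by omega)
      push_cast at *
      omega
  intro l hl hlb
  have := h1 l hl hlb
  have := h2 (b - l) l hl (by omega)
  omega

lemma no_desc {n : ℕ} {w : Equiv.Perm ℤ} (hw : Sgn n w)
    (h : ∀ l : ℕ, 1 ≤ l → l ≤ n → key n (w (bet n l)) < key n (w l)) : w = 1 := by
  apply hw.ext
  intro l hl hln
  have hr := fun (l : ℕ) (h2 : l ≤ n) => hw.range l (by omega) (by omega)
  have := rigid (fun l => - key n (w l)) 1 n (-n) ?_ ?_ ?_ l hl hln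
  · have h1 := hr l hln
    unfold key at this
    split_ifs at this <;> omega
  · intro m hm hmn
    have := h m hm hmn.le
    simp only [bet, hmn.ne, if_false] at this
    push_cast
    omega
  · have h1 := hr 1 (by omega)
    push_cast at h1 ⊢
    unfold key
    split_ifs <;> omega
  · have := h n (by omega) le_rfl
    simp only [bet, if_true, hw.zero] at this
    have h0 : key n 0 = 0 := by simp [key]
    push_cast
    omega

lemma exists_word (n : ℕ) : ∀ (m : ℕ) (w : Equiv.Perm ℤ), Sgn n w → (A n w).card = m →
    ∃ L : List (Equiv.Perm ℤ), 2 * L.length = m ∧ (∀ x ∈ L, x ∈ S n) ∧ L.prod = w := by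
  intro m
  induction m using Nat.strong_induction_on with
  | _ m ih =>
    intro w hw hm
    by_cases h : ∀ l : ℕ, 1 ≤ l → l ≤ n → key n (w (bet n l)) < key n (w l)
    · have := no_desc hw h
      subst this
      refine ⟨[], ?_, by simp, by simp⟩
      rw [← hm]
      symm
      simp only [List.length_nil, mul_zero, Finset.card_eq_zero]
      rw [Finset.eq_empty_iff_forall_notMem]
      rintro ⟨x, y⟩ hxy
      rw [mem_A] at hxy
      have := hxy.2.2
      simp only [Equiv.Perm.one_apply] at this
      omega
    · push Not at h
      obtain ⟨l, hl, hln, hle⟩ := h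
      have hd := (dich hl hln hw).resolve_left (by omega)
      have h2 := step' hl hln hw hd
      obtain ⟨L, hL1, hL2, hL3⟩ := ih _ (by omega) (w * gen n l) (hw.mul (Sgn.gen hl hln)) rfl
      refine ⟨L ++ [gen n l], ?_, ?_, ?_⟩
      · simp; omega
      · intro x hx
        rcases List.mem_append.1 hx with hx | hx
        · exact hL2 x hx
        · rw [List.mem_singleton] at hx
          exact ⟨l, hl, hln, hx⟩
      · rw [List.prod_append, hL3]
        simp [mul_assoc, gen_mul_self n l hl]

lemma word_bound (n : ℕ) (L : List (Equiv.Perm ℤ)) (hL : ∀ x ∈ L, x ∈ S n) :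
    Sgn n L.prod ∧ (A n L.prod).card ≤ 2 * L.length := by
  induction L using List.reverseRecOn with
  | nil =>
    refine ⟨Sgn.one n, ?_⟩
    simp only [List.length_nil, mul_zero, List.prod_nil, nonpos_iff_eq_zero, Finset.card_eq_zero]
    rw [Finset.eq_empty_iff_forall_notMem]
    rintro ⟨x, y⟩ hxy
    rw [mem_A] at hxy
    have := hxy.2.2
    simp only [Equiv.Perm.one_apply] at this
    omega
  | append_singleton L s ih =>
    obtain ⟨h1, h2⟩ := ih (fun x hx => hL x (by simp [hx]))
    obtain ⟨l, hl, hln, rfl⟩ := hL s (by simp)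
    simp only [List.prod_append, List.prod_singleton, List.length_append, List.length_singleton]
    refine ⟨h1.mul (Sgn.gen hl hln), ?_⟩
    rcases dich hl hln h1 with h | h
    · have := step hl hln h1 h; omega
    · have := step' hl hln h1 h; omega

lemma wordLen_eq {n : ℕ} {w : Equiv.Perm ℤ} (hw : Sgn n w) : 2 * wordLen n w = (A n w).card := by
  obtain ⟨L, hL1, hL2, hL3⟩ := exists_word n _ w hw rfl
  have hne : {m | ∃ L : List (Equiv.Perm ℤ), L.length = m ∧ (∀ x ∈ L, x ∈ S n) ∧
    L.prod = w}.Nonempty := ⟨_, L, rfl, hL2, hL3⟩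
  have h1 : wordLen n w ≤ L.length := Nat.sInf_le ⟨L, rfl, hL2, hL3⟩
  obtain ⟨L', h2, h3, h4⟩ := Nat.sInf_mem hne
  have h5 := (word_bound n L' h3).2
  rw [h4, h2] at h5
  change _ ≤ 2 * wordLen n w at h5
  omega

lemma closure_prop {n k : ℕ} (hk : 1 ≤ k) (hkn : k ≤ n) {w : Equiv.Perm ℤ}
    (hw : w ∈ Subgroup.closure (S n \ {gen n k})) :
    Sgn n w ∧ ∀ x : ℤ, (1 ≤ w x ∧ w x ≤ k) ↔ (1 ≤ x ∧ x ≤ k) := by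
  induction hw using Subgroup.closure_induction with
  | mem x hx =>
    obtain ⟨⟨l, hl, hln, rfl⟩, hne⟩ := hx
    refine ⟨Sgn.gen hl hln, fun x => ?_⟩
    have : l ≠ k := by rintro rfl; exact hne rfl
    rw [gen_apply n l hl]
    split_ifs <;> omega
  | one => exact ⟨Sgn.one n, by simp⟩
  | mul u v _ _ hu hv =>
    refine ⟨hu.1.mul hv.1, fun x => ?_⟩
    rw [Equiv.Perm.mul_apply, hu.2, hv.2]
  | inv u _ hu =>
    refine ⟨hu.1.inv, fun x => ?_⟩
    rw [← hu.2]; simp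

lemma longest_apply {n k : ℕ} (hk : 1 ≤ k) (hkn : k ≤ n) {w : Equiv.Perm ℤ}
    (hw : IsLongestOf n (S n \ {gen n k}) w) (x : ℤ) : w x =
      if 1 ≤ x ∧ x ≤ k then k + 1 - x else if -(k:ℤ) ≤ x ∧ x ≤ -1 then -(k+1) - x
      else if -(n:ℤ) ≤ x ∧ x ≤ n then -x else x := by
  obtain ⟨hwc, hmax⟩ := hw
  obtain ⟨hs, hp⟩ := closure_prop hk hkn hwc
  have hd : ∀ l : ℕ, 1 ≤ l → l ≤ n → l ≠ k → key n (w l) < key n (w (bet n l)) := by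
    intro l hl hln hlk
    refine (dich hl hln hs).resolve_left (fun h => ?_)
    have h1 := step hl hln hs h
    have hg : gen n l ∈ S n \ {gen n k} :=
      ⟨⟨l, hl, hln, rfl⟩, fun h => hlk (gen_inj n l k hl hk hln hkn h)⟩
    have h2 := hmax _ (mul_mem hwc (Subgroup.subset_closure hg))
    have h3 := wordLen_eq hs
    have h4 := wordLen_eq (hs.mul (Sgn.gen hl hln))
    omega
  have hr := fun (l : ℕ) (h2 : l ≤ n) => hs.range l (by omega) (by omega)
  have hA : ∀ l : ℕ, 1 ≤ l → l ≤ k → w l = k + 1 - l := by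
    intro l hl hlk
    have hq := fun (l : ℕ) (h1 : 1 ≤ l) (h2 : l ≤ k) => (hp l).2 (by omega)
    have := rigid (fun l => - w l) 1 k (-k) ?_ ?_ ?_ l hl hlk
    · push_cast at this; omega
    · intro m hm hmk
      have h1 := hd m hm (by omega) (by omega)
      have h2 := hq m hm (by omega)
      have h3 := hq (m+1) (by omega) (by omega)
      have : m ≠ n := by omega
      simp only [bet, this, if_false] at h1
      push_cast at h3 ⊢
      simp only [key] at h1
      split_ifs at h1 <;> omega
    · have := hq 1 le_rfl hk
      push_cast at this ⊢; omega
    · have := hq k hk le_rfl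
      push_cast at this ⊢; omega
  have hB : ∀ l : ℕ, k < l → l ≤ n → w l = - l := by
    intro l hl hln
    have hz : ∀ l : ℕ, k < l → l ≤ n → (w l < -(k:ℤ) ∨ (k:ℤ) < w l) := by
      intro l hl hln
      have h1 := hp l
      have h2 := hp (-l)
      rw [hs.1] at h2
      have h3 : w l ≠ 0 := by
        intro h
        rw [← hs.zero] at h
        have := w.injective h
        omega
      omega
    have := rigid (fun l => key n (w l)) (k+1) n (-(n - k)) ?_ ?_ ?_ l hl hln
    · have h1 := hr l hln
      unfold key at this
      split_ifs at this <;> push_cast at this <;> omega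
    · intro m hm hmn
      have := hd m (by omega) hmn.le (by omega)
      simp only [bet, hmn.ne, if_false] at this
      push_cast
      omega
    · have h1 := hr (k+1) (by omega)
      have h2 := hz (k+1) (by omega) (by omega)
      push_cast at h1 h2 ⊢
      unfold key
      split_ifs <;> omega
    · have := hd n (by omega) le_rfl (by omega)
      simp only [bet, if_true, hs.zero] at this
      have h0 : key n 0 = 0 := by simp [key]
      push_cast
      omega
  have hpos : ∀ l : ℕ, 1 ≤ l → l ≤ n → w l = if l ≤ k then (k:ℤ) + 1 - l else - l := by
    intro l hl hln
    split_ifs with h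
    · exact hA l hl h
    · exact hB l (by omega) hln
  by_cases hx : (n:ℤ) < x ∨ x < -(n:ℤ)
  · rw [hs.2 x hx]; split_ifs <;> omega
  · rcases lt_trichotomy x 0 with h0 | h0 | h0
    · have := hpos x.natAbs (by omega) (by omega)
      have h2 := hs.1 x
      rw [show ((x.natAbs : ℕ) : ℤ) = -x by omega] at this
      split_ifs at * <;> omega
    · subst h0; rw [hs.zero]; split_ifs <;> omega
    · have := hpos x.natAbs (by omega) (by omega)
      rw [show ((x.natAbs : ℕ) : ℤ) = x by omega] at this
      rw [this]
      split_ifs at * <;> omega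

lemma conj1 {n i j : ℕ} (hi : 1 ≤ i) (hj : 1 ≤ j) (hij : i + j ≤ n) {w : Equiv.Perm ℤ}
    (hw : IsLongestOf n (S n \ {gen n (i+j)}) w) : w * gen n i * w = gen n j := by
  have ha := longest_apply (by omega) hij hw
  have hin : i ≠ n := by omega
  have hjn : j ≠ n := by omega
  ext x
  rw [Equiv.Perm.mul_apply, Equiv.Perm.mul_apply, gen_apply n i hi, gen_apply n j hj]
  simp only [hin, hjn, if_false]
  generalize hy : w x = y
  rw [ha] at hy
  push_cast at hy
  split_ifs <;> (rw [ha]; push_cast; split_ifs <;> split_ifs at hy <;> omega)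

set_option maxHeartbeats 1000000 in
lemma conj2 {n i j : ℕ} (hi : 1 ≤ i) (hj : 1 ≤ j) (hij : i + j ≤ n) {w : Equiv.Perm ℤ}
    (hw : IsLongestOf n (S n \ {gen n j}) w) : w * gen n (i+j) * w = gen n (i+j) := by
  have ha := longest_apply (by omega) (by omega) hw
  ext x
  rw [Equiv.Perm.mul_apply, Equiv.Perm.mul_apply, gen_apply n (i+j) (by omega),
    gen_apply n (i+j) (by omega)]
  generalize hy : w x = y
  rw [ha] at hy
  by_cases hn : i + j = n
  · simp only [hn, if_true]
    generalize hz : (if y = (n:ℤ) then -(n:ℤ) else if y = -(n:ℤ) then (n:ℤ) else y) = z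
    have hu := ha z
    generalize w z = u at *
    split_ifs at hy <;> split_ifs at hz <;> split_ifs at hu <;> try omega
  · simp only [hn, if_false]
    push_cast
    generalize hz : (if y = (i:ℤ) + j then (i:ℤ) + j + 1 else _) = z
    have hu := ha z
    generalize w z = u at *
    split_ifs at hy <;> split_ifs at hz <;> split_ifs at hu <;> try omega

theorem stmt_18 (n i j : ℕ) (hi : 1 ≤ i) (hj : 1 ≤ j) (hij : i + j ≤ n)
    -- longest elements of the standard parabolic subgroups
    (wl : Set (Equiv.Perm ℤ) → Equiv.Perm ℤ)
    (hwl : ∀ J ⊆ S n, IsLongestOf n J (wl J))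
    -- the next-type map on ordered pairs
    (next : Equiv.Perm ℤ × Equiv.Perm ℤ → Equiv.Perm ℤ × Equiv.Perm ℤ)
    (hnext : ∀ p, next p = (p.2, wl (S n \ {p.2}) * p.1 * wl (S n \ {p.2}))) :
    wl (S n \ {gen n (i + j)}) * gen n i * wl (S n \ {gen n (i + j)}) = gen n j ∧
    wl (S n \ {gen n j}) * gen n (i + j) * wl (S n \ {gen n j}) = gen n (i + j) ∧
    {p | ∃ m : ℕ, next^[m] (gen n i, gen n (i + j)) = p} =
      {(gen n i, gen n (i + j)), (gen n (i + j), gen n j),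
        (gen n j, gen n (i + j)), (gen n (i + j), gen n i)} ∧
    (i ≠ j → {p | ∃ m : ℕ, next^[m] (gen n i, gen n (i + j)) = p}.ncard = 4) ∧
    (i = j → {p | ∃ m : ℕ, next^[m] (gen n i, gen n (i + j)) = p}.ncard = 2) := by
  have hsub : ∀ g, S n \ {g} ⊆ S n := fun g => Set.sdiff_subset
  have c1 := conj1 hi hj hij (hwl _ (hsub (gen n (i+j))))
  have c2 := conj2 hi hj hij (hwl _ (hsub (gen n j)))
  have hji : j + i ≤ n := by omega
  have c3 := conj1 hj hi hji (hwl _ (hsub (gen n (j+i))))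
  have c4 := conj2 hj hi hji (hwl _ (hsub (gen n i)))
  rw [add_comm j i] at c3 c4
  have n1 : next (gen n i, gen n (i+j)) = (gen n (i+j), gen n j) := by rw [hnext]; simp only [c1]
  have n2 : next (gen n (i+j), gen n j) = (gen n j, gen n (i+j)) := by rw [hnext]; simp only [c2]
  have n3 : next (gen n j, gen n (i+j)) = (gen n (i+j), gen n i) := by rw [hnext]; simp only [c3]
  have n4 : next (gen n (i+j), gen n i) = (gen n i, gen n (i+j)) := by rw [hnext]; simp only [c4]
  have horb : {p | ∃ m : ℕ, next^[m] (gen n i, gen n (i + j)) = p} =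
      {(gen n i, gen n (i + j)), (gen n (i + j), gen n j),
        (gen n j, gen n (i + j)), (gen n (i + j), gen n i)} := by
    ext p
    simp only [Set.mem_ofPred_eq, Set.mem_insert_iff, Set.mem_singleton_iff]
    constructor
    · rintro ⟨m, rfl⟩
      induction m with
      | zero => simp
      | succ m ih =>
        rw [Function.iterate_succ_apply']
        rcases ih with h | h | h | h <;> rw [h]
        · rw [n1]; simp
        · rw [n2]; simp
        · rw [n3]; simp
        · rw [n4]; simp
    · rintro (rfl | rfl | rfl | rfl)
      · exact ⟨0, rfl⟩
      · exact ⟨1, n1⟩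
      · refine ⟨2, ?_⟩
        change next (next _) = _
        rw [n1, n2]
      · refine ⟨3, ?_⟩
        change next (next (next _)) = _
        rw [n1, n2, n3]
  have e1 : gen n i ≠ gen n (i+j) := fun h => by
    have := gen_inj n i (i+j) hi (by omega) (by omega) hij h
    omega
  have e2 : gen n j ≠ gen n (i+j) := fun h => by
    have := gen_inj n j (i+j) hj (by omega) (by omega) hij h
    omega
  refine ⟨c1, c2, horb, fun hne => ?_, fun heq => ?_⟩
  · have e3 : gen n i ≠ gen n j := fun h => hne (gen_inj n i j hi hj (by omega) (by omega) h)
    rw [horb, Set.ncard_insert_of_notMem, Set.ncard_insert_of_notMem, Set.ncard_pair]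
    · simp [e2]
    · simp [e2.symm, e3.symm]
    · simp [e1, e3]
  · rw [horb]
    subst heq
    rw [show ({(gen n i, gen n (i + i)), (gen n (i + i), gen n i),
        (gen n i, gen n (i + i)), (gen n (i + i), gen n i)} : Set _) =
        {(gen n i, gen n (i + i)), (gen n (i + i), gen n i)} by
        ext p; simp only [Set.mem_insert_iff, Set.mem_singleton_iff]; tauto, Set.ncard_pair]
    simp [e1]

end Stmt18
end
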